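/- arXiv:1102.5136 — 3 statements merged into one kernel-verified Lean document; each statement's English description precedes it below -/
import Mathlib

section
/- Let m ≥ 2, let q ≥ 2 be an integer, and let A be a primitive m×m 0-1 matrix. Let (t_i)_{i=0}^{m-1} be the unique vector with t_i > 1 and t_i^q = Σ_{j=0}^{m-1} A(i,j) t_j for all i. Then the Hausdorff dimension of the set Ξ_A equals ((q-1)/q) · log_m(Σ_{i=0}^{m-1} t_i). -/
open scoped Classical ENNReal
open Filter MeasureTheory Topology

noncomputable section

/-- `Begins x u` : the finite word `u` is a prefix of the sequence `x` (indexed by `ℕ+`). -/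
def Begins {m : ℕ} (x : ℕ+ → Fin m) (u : List (Fin m)) : Prop :=
  ∀ j : Fin u.length, x ⟨(j : ℕ) + 1, Nat.succ_pos _⟩ = u.get j

/-- `Cyl u` : the cylinder set of the word `u`. -/
def Cyl {m : ℕ} (u : List (Fin m)) : Set (ℕ+ → Fin m) := {x | Begins x u}

/-- `Pref Ω` : the set of (finite) prefixes of sequences in `Ω`. -/
def Pref {m : ℕ} (Ω : Set (ℕ+ → Fin m)) : Set (List (Fin m)) := {u | ∃ x ∈ Ω, Begins x u}

/-- number of length-`n` words beginning some sequence of `X`. -/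
def NWords {m : ℕ} (n : ℕ) (X : Set (ℕ+ → Fin m)) : ℕ :=
  Set.ncard {u : List (Fin m) | u.length = n ∧ u ∈ Pref X}

/-- restriction of `x` to the geometric progression `J_i = {i, qi, q²i, …}`:
`(x|J_i)_k = x_{q^{k-1} i}` for `k ≥ 1`. -/
def RestrJ {m : ℕ} (q : ℕ+) (x : ℕ+ → Fin m) (i : ℕ+) : ℕ+ → Fin m :=
  fun k => x (q ^ ((k : ℕ) - 1) * i)

/-- the multiplicative subshift `X_Ω = {x : x|J_i ∈ Ω for all i with q ∤ i}`. -/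
def XOm {m : ℕ} (q : ℕ+) (Ω : Set (ℕ+ → Fin m)) : Set (ℕ+ → Fin m) :=
  {x | ∀ i : ℕ+, ¬ q ∣ i → RestrJ q x i ∈ Ω}

/-- the real number `Σ_{k≥1} x_k m^{-k}` with base-`m` digit sequence `x`. -/
def ValMap (m : ℕ) (x : ℕ+ → Fin m) : ℝ := ∑' k : ℕ+, ((x k : ℕ) : ℝ) * (m : ℝ)⁻¹ ^ (k : ℕ)

/-- the subset of `[0,1]` of reals whose base-`m` digit sequence lies in `X`. -/
def XiSet {m : ℕ} (X : Set (ℕ+ → Fin m)) : Set ℝ := {r | ∃ x ∈ X, r = ValMap m x}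

/-- entropy (base-`m` logarithms) of the partition of `Ω` into `k`-cylinders, for a measure
supported on `Ω` (words that are not prefixes of `Ω` get measure `0` and contribute nothing). -/
def Hent (m : ℕ) (μ : Measure (ℕ+ → Fin m)) (k : ℕ) : ℝ :=
  -∑ u : Fin k → Fin m,
    ((μ (Cyl (List.ofFn u))).toReal * Real.logb m (μ (Cyl (List.ofFn u))).toReal)

/-- `s(Ω,μ) = (q-1)² Σ_{k≥1} H_m^μ(α_k)/q^{k+1}`. -/
def sOm (m : ℕ) (q : ℕ+) (μ : Measure (ℕ+ → Fin m)) : ℝ :=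
  ((q : ℝ) - 1) ^ 2 * ∑' k : ℕ, Hent m μ (k + 1) / (q : ℝ) ^ (k + 2)

/-- cylinder determined by the first `n` entries of `x`, i.e. `[x₁…x_n]`. -/
def CylN {m : ℕ} (n : ℕ) (x : ℕ+ → Fin m) : Set (ℕ+ → Fin m) :=
  {y | ∀ k : ℕ+, (k : ℕ) ≤ n → y k = x k}

/-- the cylinder `[u|J_i]` where `u = x₁…x_n`: sequences `y` with
`y_{ℓ+1} = x_{q^ℓ i}` for all `ℓ ≥ 0` with `q^ℓ i ≤ n`. -/
def CylJ {m : ℕ} (q n i : ℕ+) (x : ℕ+ → Fin m) : Set (ℕ+ → Fin m) :=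
  {y | ∀ ℓ : ℕ, q ^ ℓ * i ≤ n → y ⟨ℓ + 1, Nat.succ_pos _⟩ = x (q ^ ℓ * i)}

/-- `P` has the product structure `P[u] = ∏_{i ≤ |u|, q ∤ i} μ[u|J_i]` on cylinders. -/
def ProdProp {m : ℕ} (q : ℕ+) (μ P : Measure (ℕ+ → Fin m)) : Prop :=
  ∀ (n : ℕ+) (x : ℕ+ → Fin m),
    P (CylN (n : ℕ) x) = ∏ i ∈ (Finset.Icc 1 n).filter (fun i => ¬ q ∣ i), μ (CylJ q n i x)

/-- `t` is a `[1, m^{1/(q-1)}]`-valued solution of `t(u)^q = Σ_{j : uj ∈ Pref(Ω)} t(uj)`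
on the tree of prefixes of `Ω`. -/
def TSol {m : ℕ} (q : ℕ+) (Ω : Set (ℕ+ → Fin m)) (t : List (Fin m) → ℝ) : Prop :=
  ∀ u ∈ Pref Ω,
    t u ∈ Set.Icc 1 ((m : ℝ) ^ ((1 : ℝ) / ((q : ℝ) - 1))) ∧
    t u ^ (q : ℕ) =
      ∑ j ∈ Finset.univ.filter (fun j : Fin m => u ++ [j] ∈ Pref Ω), t (u ++ [j])

/-- `μ` has the cylinder values `μ[u₁…u_k] = ∏_{j=1}^k t(u₁…u_j)/t(u₁…u_{j-1})^q`
for prefixes `u` of `Ω`. -/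
def CylVals {m : ℕ} (q : ℕ+) (Ω : Set (ℕ+ → Fin m)) (t : List (Fin m) → ℝ)
    (μ : Measure (ℕ+ → Fin m)) : Prop :=
  ∀ u ∈ Pref Ω,
    μ (Cyl u) =
      ENNReal.ofReal (∏ j ∈ Finset.range u.length, t (u.take (j + 1)) / t (u.take j) ^ (q : ℕ))

/-- predecessor state of position `k`. -/
def kst {m : ℕ} (q : ℕ) (y : ℕ → Fin m) (k : ℕ) : Option (Fin m) :=
  if q ∣ k then some (y (k / q)) else none

/-- cylinder weight. -/
def wt {m : ℕ} (q : ℕ) (p : Option (Fin m) → Fin m → ℝ) (n : ℕ) (y : ℕ → Fin m) : ℝ :=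
  ∏ k ∈ Finset.Icc 1 n, p (kst q y k) (y k)

/-- random sequence driven by independent choices. -/
def rseq {m : ℕ} (q : ℕ) (ω : ℕ × Option (Fin m) → Fin m) (k : ℕ) : Fin m :=
  if h : 2 ≤ q ∧ 0 < k ∧ q ∣ k then ω (k, some (rseq q ω (k / q))) else ω (k, none)
termination_by k
decreasing_by exact Nat.div_lt_self h.2.1 (by omega)

lemma rseq_eq {m q : ℕ} (hq : 2 ≤ q) (ω : ℕ × Option (Fin m) → Fin m) (k : ℕ) (hk : 0 < k) :
    rseq q ω k = ω (k, kst q (rseq q ω) k) := by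
  rw [rseq]
  unfold kst
  by_cases h : q ∣ k
  · simp [h, hq, hk]
  · simp [h]

lemma rseq_measurable {m q : ℕ} (k : ℕ) :
    Measurable (fun ω : ℕ × Option (Fin m) → Fin m => rseq q ω k) := by
  induction k using Nat.strong_induction_on with
  | _ k ih =>
    by_cases h : 2 ≤ q ∧ 0 < k ∧ q ∣ k
    · have h1 : (fun ω : ℕ × Option (Fin m) → Fin m => rseq q ω k) =
          fun ω => ω (k, some (rseq q ω (k / q))) := by
        funext ω
        rw [rseq, dif_pos h]
      rw [h1]
      have h2 := ih (k / q) (Nat.div_lt_self h.2.1 (by omega))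
      have h3 : Measurable (fun z : (ℕ × Option (Fin m) → Fin m) × Fin m => z.1 (k, some z.2)) := by
        apply measurable_from_prod_countable_left
        intro j
        show Measurable (fun w : ℕ × Option (Fin m) → Fin m => w (k, some j))
        exact measurable_pi_apply _
      exact h3.comp (measurable_id.prodMk h2)
    · have h1 : (fun ω : ℕ × Option (Fin m) → Fin m => rseq q ω k) = fun ω => ω (k, none) := by
        funext ω
        rw [rseq, dif_neg h]
      rw [h1]
      exact measurable_pi_apply _

lemma rseq_cyl {m q : ℕ} (hq : 2 ≤ q) (ω : ℕ × Option (Fin m) → Fin m) (n : ℕ) (y : ℕ → Fin m) :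
    (∀ k ∈ Finset.Icc 1 n, rseq q ω k = y k) ↔ ∀ k ∈ Finset.Icc 1 n, ω (k, kst q y k) = y k := by
  induction n with
  | zero => simp
  | succ n ih =>
    have e : ∀ Q : ℕ → Prop, (∀ k ∈ Finset.Icc 1 (n+1), Q k) ↔
        (∀ k ∈ Finset.Icc 1 n, Q k) ∧ Q (n+1) := by
      intro Q
      simp only [Finset.mem_Icc]
      constructor
      · intro h
        exact ⟨fun k hk => h k ⟨hk.1, by omega⟩, h _ ⟨by omega, le_rfl⟩⟩
      · rintro ⟨h1, h2⟩ k ⟨hk1, hk2⟩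
        rcases Nat.lt_or_ge k (n+1) with h | h
        · exact h1 k ⟨hk1, by omega⟩
        · have : k = n + 1 := by omega
          subst this
          exact h2
    rw [e, e, ← ih]
    apply and_congr_right
    intro h
    rw [rseq_eq hq ω (n+1) (by omega)]
    have : kst q (rseq q ω) (n+1) = kst q y (n+1) := by
      unfold kst
      by_cases hd : q ∣ n + 1
      · simp only [hd, if_true]
        congr 1
        apply h
        rw [Finset.mem_Icc]
        have h1 := Nat.div_lt_self (Nat.succ_pos n) (show 1 < q by omega)
        have h2 := Nat.div_pos (Nat.le_of_dvd (Nat.succ_pos n) hd) (by omega : 0 < q)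
        simp only [Nat.succ_eq_add_one] at h1 h2
        omega
      · simp [hd]
    rw [this]

lemma exists_P {m q : ℕ} (hq : 2 ≤ q) (p : Option (Fin m) → Fin m → ℝ)
    (h0 : ∀ s j, 0 ≤ p s j) (h1 : ∀ s, ∑ j, p s j = 1) :
    ∃ P : Measure (ℕ → Fin m), IsProbabilityMeasure P ∧
      ∀ n y, P {z | ∀ k ∈ Finset.Icc 1 n, z k = y k} = ENNReal.ofReal (wt q p n y) := by
  have hs : ∀ s, ∑ j, ENNReal.ofReal (p s j) = 1 := by
    intro s
    rw [← ENNReal.ofReal_sum_of_nonneg (fun j _ => h0 s j), h1 s, ENNReal.ofReal_one]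
  let ν : Option (Fin m) → Measure (Fin m) :=
    fun s => (PMF.ofFintype (fun j => ENNReal.ofReal (p s j)) (hs s)).toMeasure
  have hν : ∀ s, IsProbabilityMeasure (ν s) := fun s => PMF.toMeasure.isProbabilityMeasure _
  let μ : Measure (ℕ × Option (Fin m) → Fin m) :=
    Measure.infinitePi (fun ks : ℕ × Option (Fin m) => ν ks.2)
  have hμ : IsProbabilityMeasure μ := by infer_instance
  have hmeas : Measurable (fun ω : ℕ × Option (Fin m) → Fin m => rseq q ω) :=
    measurable_pi_lambda _ (fun k => rseq_measurable k)
  refine ⟨μ.map (fun ω => rseq q ω), Measure.isProbabilityMeasure_map hmeas.aemeasurable, ?_⟩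
  intro n y
  have hms : MeasurableSet {z : ℕ → Fin m | ∀ k ∈ Finset.Icc 1 n, z k = y k} := by
    have : {z : ℕ → Fin m | ∀ k ∈ Finset.Icc 1 n, z k = y k} =
        ⋂ k ∈ Finset.Icc 1 n, (fun z : ℕ → Fin m => z k) ⁻¹' {y k} := by
      ext z; simp
    rw [this]
    exact Finset.measurableSet_biInter _ (fun k _ => measurable_pi_apply k (measurableSet_singleton _))
  rw [Measure.map_apply hmeas hms]
  have he : (fun ω : ℕ × Option (Fin m) → Fin m => rseq q ω) ⁻¹'
      {z : ℕ → Fin m | ∀ k ∈ Finset.Icc 1 n, z k = y k} =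
      Set.pi ((Finset.Icc 1 n).image (fun k => (k, kst q y k)) : Finset (ℕ × Option (Fin m)))
        (fun ks => {y ks.1}) := by
    ext ω
    simp only [Set.mem_preimage, Set.mem_ofPred_eq, rseq_cyl hq, Set.mem_pi, Finset.coe_image,
      Set.forall_mem_image, Set.mem_singleton_iff, Finset.mem_coe]
  rw [he, Measure.infinitePi_pi _ (fun _ _ => measurableSet_singleton _),
    Finset.prod_image (fun a _ b _ h => (Prod.ext_iff.1 h).1), wt,
    ENNReal.ofReal_prod_of_nonneg (fun k _ => h0 _ _)]
  apply Finset.prod_congr rfl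
  intro k _
  simp only [ν]
  rw [PMF.toMeasure_apply_singleton _ _ (measurableSet_singleton _)]
  rfl

/-- integer coding the first `n` digits. -/
def code {m : ℕ} : ℕ → (ℕ → Fin m) → ℕ
  | 0, _ => 0
  | n + 1, y => m * code n y + (y (n + 1) : ℕ)

lemma code_eq_iff {m : ℕ} (n : ℕ) (y z : ℕ → Fin m) :
    code n z = code n y ↔ ∀ k ∈ Finset.Icc 1 n, z k = y k := by
  induction n with
  | zero => simp [code]
  | succ n ih =>
    have hmpos : 0 < m := (Nat.zero_le _).trans_lt (y 0).isLt
    have key : code (n+1) z = code (n+1) y ↔ code n z = code n y ∧ z (n+1) = y (n+1) := by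
      simp only [code]
      constructor
      · intro h
        have a1 := congrArg (· / m) h
        have a2 := congrArg (· % m) h
        simp only [Nat.mul_add_div hmpos, Nat.mul_add_mod, Nat.div_eq_of_lt (z (n+1)).isLt,
          Nat.div_eq_of_lt (y (n+1)).isLt, Nat.mod_eq_of_lt (z (n+1)).isLt,
          Nat.mod_eq_of_lt (y (n+1)).isLt, add_zero] at a1 a2
        exact ⟨a1, Fin.ext a2⟩
      · rintro ⟨h1, h2⟩
        rw [h1, h2]
    rw [key, ih]
    simp only [Finset.mem_Icc]
    constructor
    · rintro ⟨h1, h2⟩ k ⟨hk1, hk2⟩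
      rcases Nat.lt_or_ge k (n+1) with h | h
      · exact h1 k ⟨hk1, by omega⟩
      · have : k = n + 1 := by omega
        subst this
        exact h2
    · intro h
      exact ⟨fun k hk => h k ⟨hk.1, by omega⟩, h _ ⟨by omega, le_rfl⟩⟩

lemma code_measurable {m : ℕ} (n : ℕ) : Measurable (fun y : ℕ → Fin m => code n y) := by
  induction n with
  | zero => simp only [code]; exact measurable_const
  | succ n ih =>
    simp only [code]
    have : Measurable (fun y : ℕ → Fin m => ((y (n+1) : Fin m) : ℕ)) :=
      (measurable_from_top (f := fun j : Fin m => (j : ℕ))).comp (measurable_pi_apply (n+1))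
    exact (measurable_const.mul ih).add this

lemma sum_code {m : ℕ} (P : Measure (ℕ → Fin m)) [IsProbabilityMeasure P] (n : ℕ) :
    ∑' a : ℕ, P {z | code n z = a} = 1 := by
  have h := tsum_measure_preimage_singleton (μ := P) (Set.countable_univ (α := ℕ))
    (f := fun y : ℕ → Fin m => code n y)
    (fun a _ => code_measurable n (measurableSet_singleton a))
  rw [Set.preimage_univ, measure_univ] at h
  rw [← h, tsum_univ (fun a : ℕ => P ((fun y : ℕ → Fin m => code n y) ⁻¹' {a}))]
  rfl

/-- `P` has cylinder weights `wt q p`. -/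
def HasWt {m : ℕ} (q : ℕ) (p : Option (Fin m) → Fin m → ℝ) (P : Measure (ℕ → Fin m)) : Prop :=
  ∀ n y, P {z | code n z = code n y} = ENNReal.ofReal (wt q p n y)

lemma exists_HasWt {m q : ℕ} (hq : 2 ≤ q) (p : Option (Fin m) → Fin m → ℝ)
    (h0 : ∀ s j, 0 ≤ p s j) (h1 : ∀ s, ∑ j, p s j = 1) :
    ∃ P : Measure (ℕ → Fin m), IsProbabilityMeasure P ∧ HasWt q p P := by
  obtain ⟨P, hP, h⟩ := exists_P hq p h0 h1
  refine ⟨P, hP, fun n y => ?_⟩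
  simp only [code_eq_iff]
  exact h n y

lemma compare {m q : ℕ} {p pt : Option (Fin m) → Fin m → ℝ}
    {P Pt : Measure (ℕ → Fin m)} [IsProbabilityMeasure Pt] (hP : HasWt q p P)
    (hPt : HasWt q pt Pt) (n : ℕ) (C : ℝ) (hC : 0 ≤ C) (E : Set (ℕ → Fin m))
    (hE : ∀ y ∈ E, wt q p n y ≤ C * wt q pt n y) : P E ≤ ENNReal.ofReal C := by
  calc P E ≤ P (⋃ a ∈ (code n '' E), {z | code n z = a}) := by
        apply measure_mono
        intro y hy
        simp only [Set.mem_iUnion]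
        exact ⟨code n y, Set.mem_image_of_mem _ hy, rfl⟩
    _ ≤ ∑' a : (code n '' E), P {z | code n z = a} :=
        measure_biUnion_le P (Set.to_countable _) _
    _ ≤ ∑' a : (code n '' E), ENNReal.ofReal C * Pt {z | code n z = a} := by
        apply ENNReal.tsum_le_tsum
        rintro ⟨a, y, hy, rfl⟩
        simp only
        rw [hP, hPt, ← ENNReal.ofReal_mul hC]
        exact ENNReal.ofReal_le_ofReal (hE y hy)
    _ ≤ ENNReal.ofReal C * 1 := by
        rw [ENNReal.tsum_mul_left]
        gcongr
        rw [← sum_code Pt n]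
        exact ENNReal.tsum_comp_le_tsum_of_injective Subtype.val_injective _
    _ = ENNReal.ofReal C := mul_one _
lemma digit_summable {m : ℕ} (hm : 2 ≤ m) (y : ℕ → Fin m) :
    Summable (fun k : ℕ => ((y (k+1) : ℕ) : ℝ) * (m : ℝ)⁻¹ ^ (k+1)) := by
  have hm' : (2 : ℝ) ≤ m := by exact_mod_cast hm
  have h1 : Summable (fun k : ℕ => (m : ℝ) * (m : ℝ)⁻¹ ^ (k+1)) := by
    apply Summable.mul_left
    apply (summable_nat_add_iff 1).2
    apply summable_geometric_of_lt_one (by positivity)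
    apply inv_lt_one_of_one_lt₀; linarith
  refine Summable.of_nonneg_of_le (fun k => by positivity) (fun k => ?_) h1
  have : ((y (k+1) : ℕ) : ℝ) ≤ m := by exact_mod_cast (y (k+1)).isLt.le
  gcongr

lemma partial_code {m : ℕ} (hm : 2 ≤ m) (y : ℕ → Fin m) (n : ℕ) :
    ∑ k ∈ Finset.range n, ((y (k+1) : ℕ) : ℝ) * (m : ℝ)⁻¹ ^ (k+1) = (code n y : ℝ) / (m : ℝ) ^ n := by
  have hm' : (m : ℝ) ≠ 0 := by
    have : 0 < m := by omega
    exact_mod_cast this.ne'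
  induction n with
  | zero => simp [code]
  | succ n ih =>
    rw [Finset.sum_range_succ, ih, code]
    push_cast
    rw [inv_pow]
    field_simp
    ring

lemma val_bounds {m : ℕ} (hm : 2 ≤ m) (y : ℕ → Fin m) (n : ℕ) :
    (code n y : ℝ) / (m : ℝ) ^ n ≤ ValMap m (fun k => y k) ∧
    ValMap m (fun k => y k) ≤ ((code n y : ℝ) + 1) / (m : ℝ) ^ n := by
  have hm' : (2 : ℝ) ≤ m := by exact_mod_cast hm
  have hv : ValMap m (fun k => y k) = ∑' k : ℕ, ((y (k+1) : ℕ) : ℝ) * (m : ℝ)⁻¹ ^ (k+1) := by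
    unfold ValMap
    exact tsum_pnat_eq_tsum_succ (f := fun k => ((y k : ℕ) : ℝ) * (m : ℝ)⁻¹ ^ k)
  have hs := digit_summable hm y
  rw [hv, ← hs.sum_add_tsum_nat_add n, partial_code hm y n]
  constructor
  · have : 0 ≤ ∑' k : ℕ, ((y (k+n+1) : ℕ) : ℝ) * (m : ℝ)⁻¹ ^ (k+n+1) :=
      tsum_nonneg (fun k => by positivity)
    linarith
  · rw [add_div]
    gcongr
    have hlt : (m : ℝ)⁻¹ < 1 := by apply inv_lt_one_of_one_lt₀; linarith
    have hg := hasSum_geometric_of_lt_one (r := (m : ℝ)⁻¹) (by positivity) hlt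
    have hg2 := hg.mul_left (((m : ℝ) - 1) * (m : ℝ)⁻¹ ^ (n+1))
    have e : ((m : ℝ) - 1) * (m : ℝ)⁻¹ ^ (n+1) * (1 - (m : ℝ)⁻¹)⁻¹ = 1 / (m : ℝ) ^ n := by
      have h1 : (m : ℝ) ≠ 0 := by linarith
      have h2 : (m : ℝ) - 1 ≠ 0 := by linarith
      have h3 : 1 - (m : ℝ)⁻¹ = ((m : ℝ) - 1) / m := by field_simp
      rw [h3, inv_pow, pow_succ]
      field_simp
    rw [← e, ← hg2.tsum_eq]
    apply Summable.tsum_le_tsum _ ((summable_nat_add_iff n).2 hs) hg2.summable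
    intro k
    have h4 : ((y (k+n+1) : ℕ) : ℝ) ≤ (m : ℝ) - 1 := by
      have : (y (k+n+1) : ℕ) + 1 ≤ m := (y (k+n+1)).isLt
      have : ((y (k+n+1) : ℕ) : ℝ) + 1 ≤ m := by exact_mod_cast this
      linarith
    have h5 : (m : ℝ)⁻¹ ^ (k+n+1) = (m : ℝ)⁻¹ ^ (n+1) * (m : ℝ)⁻¹ ^ k := by ring
    rw [h5, mul_assoc]
    gcongr

lemma val_measurable {m : ℕ} (hm : 2 ≤ m) :
    Measurable (fun y : ℕ → Fin m => ValMap m (fun k => y k)) := by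
  have hm' : (2 : ℝ) ≤ m := by exact_mod_cast hm
  refine measurable_of_tendsto_metrizable
    (f := fun (n : ℕ) (y : ℕ → Fin m) => (code n y : ℝ) / (m : ℝ) ^ n) (fun n => ?_) ?_
  · have : Measurable (fun y : ℕ → Fin m => (code n y : ℝ)) :=
      (measurable_from_top (f := fun a : ℕ => (a : ℝ))).comp (code_measurable n)
    exact this.div_const _
  · rw [tendsto_pi_nhds]
    intro y
    have hv : ValMap m (fun k => y k) = ∑' k : ℕ, ((y (k+1) : ℕ) : ℝ) * (m : ℝ)⁻¹ ^ (k+1) := by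
      unfold ValMap
      exact tsum_pnat_eq_tsum_succ (f := fun k => ((y k : ℕ) : ℝ) * (m : ℝ)⁻¹ ^ k)
    rw [hv]
    simp only [← partial_code hm]
    exact (digit_summable hm y).hasSum.tendsto_sum_nat

/-- averaging operator. -/
def pf {m : ℕ} (p : Option (Fin m) → Fin m → ℝ) (f : Fin m → ℝ) (s : Option (Fin m)) : ℝ :=
  ∑ j, p s j * f j

/-- martingale. -/
def Mn {m : ℕ} (q : ℕ) (p : Option (Fin m) → Fin m → ℝ) (f : Fin m → ℝ) (n : ℕ)
    (y : ℕ → Fin m) : ℝ := ∑ k ∈ Finset.Icc 1 n, (f (y k) - pf p f (kst q y k))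

/-- Birkhoff-like sum. -/
def Sn {m : ℕ} (f : Fin m → ℝ) (n : ℕ) (y : ℕ → Fin m) : ℝ := ∑ k ∈ Finset.Icc 1 n, f (y k)

lemma sum_kst {m q : ℕ} (hq : 2 ≤ q) (g : Option (Fin m) → ℝ) (y : ℕ → Fin m) (n : ℕ) :
    ∑ k ∈ Finset.Icc 1 n, g (kst q y k) =
      ((n : ℝ) - (n / q : ℕ)) * g none + Sn (fun i => g (some i)) (n / q) y := by
  induction n with
  | zero => simp [Sn]
  | succ n ih =>
    rw [Finset.sum_Icc_succ_top (by omega), ih, Nat.succ_div]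
    by_cases h : q ∣ n + 1
    · have hd : (n + 1) / q = n / q + 1 := by rw [Nat.succ_div, if_pos h]
      simp only [h, if_true, Sn, kst]
      rw [Finset.sum_Icc_succ_top (Nat.le_add_left 1 _), hd]
      push_cast
      ring
    · simp only [h, if_false, Sn, kst]
      push_cast
      ring

lemma pf_bound {m : ℕ} {p : Option (Fin m) → Fin m → ℝ} (h0 : ∀ s j, 0 ≤ p s j)
    (h1 : ∀ s, ∑ j, p s j = 1) {f : Fin m → ℝ} {B : ℝ} (hB : ∀ j, |f j| ≤ B) (s) :
    |pf p f s| ≤ B := by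
  unfold pf
  calc |∑ j, p s j * f j| ≤ ∑ j, |p s j * f j| := Finset.abs_sum_le_sum_abs _ _
    _ ≤ ∑ j, p s j * B := by
        apply Finset.sum_le_sum
        intro j _
        rw [abs_mul, abs_of_nonneg (h0 s j)]
        exact mul_le_mul_of_nonneg_left (hB j) (h0 s j)
    _ = B := by rw [← Finset.sum_mul, h1, one_mul]

lemma tail {m q : ℕ} (hq : 2 ≤ q) {p : Option (Fin m) → Fin m → ℝ} (h0 : ∀ s j, 0 ≤ p s j)
    (h1 : ∀ s, ∑ j, p s j = 1) {P : Measure (ℕ → Fin m)} (hP : HasWt q p P)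
    {f : Fin m → ℝ} {B : ℝ} (hB0 : 0 ≤ B) (hB : ∀ j, |f j| ≤ B) {ε : ℝ} (hε : 0 < ε) :
    ∀ᵐ y ∂P, ∀ᶠ n : ℕ in atTop, Mn q p f n y < ε * n := by
  set K := 2 * B + 1 with hK
  have hK0 : 0 < K := by positivity
  have hD : ∀ s j, |f j - pf p f s| ≤ K := by
    intro s j
    have a := hB j
    have b := pf_bound h0 h1 hB s
    rw [abs_le] at *
    constructor <;> linarith
  obtain ⟨l, hl0, hl1, hl2⟩ : ∃ l : ℝ, 0 < l ∧ l * K ≤ 1 ∧ l * K ^ 2 ≤ ε / 2 := by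
    refine ⟨min (1 / K) (ε / 2 / K ^ 2), by positivity, ?_, ?_⟩
    · rw [← le_div_iff₀ hK0]; exact min_le_left _ _
    · rw [← le_div_iff₀ (by positivity)]; exact min_le_right _ _
  let Z : Option (Fin m) → ℝ := fun s => ∑ j, p s j * Real.exp (l * (f j - pf p f s))
  have hmean : ∀ s, ∑ j, p s j * (l * (f j - pf p f s)) = 0 := by
    intro s
    have : ∀ j, p s j * (l * (f j - pf p f s)) = l * (p s j * f j) - l * pf p f s * p s j := by
      intro j; ring
    simp only [this]
    rw [Finset.sum_sub_distrib, ← Finset.mul_sum, ← Finset.mul_sum, h1]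
    simp [pf]
  have hZ1 : ∀ s, 1 ≤ Z s := by
    intro s
    calc (1 : ℝ) = ∑ j, p s j * (1 + l * (f j - pf p f s)) := by
          simp only [mul_add, mul_one, Finset.sum_add_distrib, h1, hmean, add_zero]
      _ ≤ Z s := by
          apply Finset.sum_le_sum
          intro j _
          apply mul_le_mul_of_nonneg_left _ (h0 s j)
          linarith [Real.add_one_le_exp (l * (f j - pf p f s))]
  have hZ2 : ∀ s, Z s ≤ Real.exp (l * (ε / 2)) := by
    intro s
    calc Z s ≤ ∑ j, p s j * (1 + l * (f j - pf p f s) + l * (ε / 2)) := by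
          apply Finset.sum_le_sum
          intro j _
          apply mul_le_mul_of_nonneg_left _ (h0 s j)
          have hd := hD s j
          have hx : |l * (f j - pf p f s)| ≤ 1 := by
            rw [abs_mul, abs_of_pos hl0]
            exact (mul_le_mul_of_nonneg_left hd hl0.le).trans hl1
          have := (abs_le.1 (Real.abs_exp_sub_one_sub_id_le hx)).2
          have h3 : (l * (f j - pf p f s)) ^ 2 ≤ l * (ε / 2) := by
            have : (f j - pf p f s) ^ 2 ≤ K ^ 2 := sq_le_sq' (abs_le.1 hd).1 (abs_le.1 hd).2
            calc (l * (f j - pf p f s)) ^ 2 = l * (l * (f j - pf p f s) ^ 2) := by ring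
              _ ≤ l * (l * K ^ 2) := by gcongr
              _ ≤ _ := by gcongr
          linarith
      _ = 1 + l * (ε / 2) := by
          simp only [mul_add, mul_one, Finset.sum_add_distrib, h1, hmean, add_zero]
          rw [← Finset.sum_mul, h1, one_mul]
      _ ≤ _ := by linarith [Real.add_one_le_exp (l * (ε / 2))]
  let pt : Option (Fin m) → Fin m → ℝ := fun s j => p s j * Real.exp (l * (f j - pf p f s)) / Z s
  obtain ⟨Pt, hPt1, hPt⟩ := exists_HasWt hq pt
    (fun s j => div_nonneg (mul_nonneg (h0 s j) (Real.exp_pos _).le) (by linarith [hZ1 s]))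
    (fun s => by
      simp only [pt]
      rw [← Finset.sum_div]
      exact div_self (by linarith [hZ1 s]))
  have hb : ∀ n : ℕ, P {y | ε * n ≤ Mn q p f n y} ≤
      ENNReal.ofReal (Real.exp (-(l * (ε / 2)))) ^ n := by
    intro n
    rw [← ENNReal.ofReal_pow (Real.exp_pos _).le]
    apply compare hP hPt n _ (by positivity)
    intro y hy
    have hy' : ε * n ≤ Mn q p f n y := hy
    have hw : wt q pt n y * ∏ k ∈ Finset.Icc 1 n, Z (kst q y k) =
        wt q p n y * Real.exp (l * Mn q p f n y) := by
      unfold wt Mn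
      rw [Finset.mul_sum, Real.exp_sum, ← Finset.prod_mul_distrib, ← Finset.prod_mul_distrib]
      apply Finset.prod_congr rfl
      intro k _
      simp only [pt]
      have := hZ1 (kst q y k)
      field_simp
    have hw0 : 0 ≤ wt q p n y := Finset.prod_nonneg (fun k _ => h0 _ _)
    have hwt0 : 0 ≤ wt q pt n y := Finset.prod_nonneg (fun k _ =>
      div_nonneg (mul_nonneg (h0 _ _) (Real.exp_pos _).le) (by linarith [hZ1 (kst q y k)]))
    have hZn : ∏ k ∈ Finset.Icc 1 n, Z (kst q y k) ≤ Real.exp (l * (ε / 2)) ^ n := by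
      calc _ ≤ ∏ k ∈ Finset.Icc 1 n, Real.exp (l * (ε / 2)) :=
            Finset.prod_le_prod (fun k _ => by linarith [hZ1 (kst q y k)]) (fun k _ => hZ2 _)
        _ = _ := by simp
    have hfin : wt q p n y * Real.exp (l * (ε * n)) ≤
        wt q pt n y * Real.exp (l * (ε / 2)) ^ n := by
      calc _ ≤ wt q p n y * Real.exp (l * Mn q p f n y) := by gcongr
        _ = _ := hw.symm
        _ ≤ _ := by gcongr
    have e1 : Real.exp (l * (ε * n)) = Real.exp (l * (ε / 2)) ^ n * Real.exp (l * (ε / 2)) ^ n := by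
      rw [← Real.exp_nat_mul, ← Real.exp_add]
      congr 1; ring
    rw [e1] at hfin
    have hpos : 0 < Real.exp (l * (ε / 2)) ^ n := by positivity
    rw [Real.exp_neg, inv_pow, inv_mul_eq_div, le_div_iff₀ hpos]
    nlinarith
  have hsum : ∑' n : ℕ, P {y | ε * n ≤ Mn q p f n y} ≠ ∞ := by
    apply ne_top_of_le_ne_top _ (ENNReal.tsum_le_tsum hb)
    rw [ENNReal.tsum_geometric]
    apply ENNReal.inv_ne_top.2
    rw [Ne, tsub_eq_zero_iff_le, not_le, ENNReal.ofReal_lt_one]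
    exact Real.exp_lt_one_iff.2 (by linarith [mul_pos hl0 (half_pos hε)])
  filter_upwards [ae_eventually_notMem hsum] with y hy
  filter_upwards [hy] with n hn
  exact not_le.1 hn
lemma Sn_rec {m q : ℕ} (hq : 2 ≤ q) (p : Option (Fin m) → Fin m → ℝ) (f : Fin m → ℝ)
    (n : ℕ) (y : ℕ → Fin m) :
    Sn f n y = Mn q p f n y + ((n : ℝ) - (n / q : ℕ)) * pf p f none +
      Sn (fun i => pf p f (some i)) (n / q) y := by
  have := sum_kst hq (pf p f) y n
  unfold Mn
  rw [Finset.sum_sub_distrib, this]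
  unfold Sn
  ring

lemma Sn_bound {m : ℕ} {f : Fin m → ℝ} {B : ℝ} (hB : ∀ j, |f j| ≤ B) (n : ℕ) (y : ℕ → Fin m) :
    |Sn f n y| ≤ B * n := by
  unfold Sn
  calc _ ≤ ∑ k ∈ Finset.Icc 1 n, |f (y k)| := Finset.abs_sum_le_sum_abs _ _
    _ ≤ ∑ k ∈ Finset.Icc 1 n, B := Finset.sum_le_sum (fun k _ => hB _)
    _ = B * n := by simp [mul_comm]

lemma lower_det {m q : ℕ} (hq : 2 ≤ q) {p : Option (Fin m) → Fin m → ℝ} (h0 : ∀ s j, 0 ≤ p s j)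
    (h1 : ∀ s, ∑ j, p s j = 1) {F : ℕ → Fin m → ℝ} {B : ℝ} (hB0 : 0 ≤ B)
    (hB : ∀ l j, |F l j| ≤ B) (hF : ∀ l, F (l+1) = fun i => pf p (F l) (some i))
    (y : ℕ → Fin m)
    (hM : ∀ l, ∀ ε > 0, ∀ᶠ n : ℕ in atTop, |Mn q p (F l) n y| ≤ ε * n) (L : ℕ) :
    ∀ l, ∀ ε > 0, ∀ᶠ n : ℕ in atTop,
      |Sn (F l) n y - q * Sn (F l) (n / q) y| ≤ (2 * B / (q : ℝ) ^ L + ε) * n := by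
  have hq' : (2 : ℝ) ≤ q := by exact_mod_cast hq
  have hdiv : ∀ n : ℕ, (q : ℝ) * ((n / q : ℕ) : ℝ) ≤ n := by
    intro n
    exact_mod_cast Nat.mul_div_le n q
  have hdiv2 : ∀ n : ℕ, (n : ℝ) ≤ (q : ℝ) * ((n / q : ℕ) : ℝ) + q := by
    intro n
    have := Nat.div_add_mod n q
    have h2 := Nat.mod_lt n (show q > 0 by omega)
    have : n ≤ q * (n / q) + q := by omega
    exact_mod_cast this
  have htd : Tendsto (fun n : ℕ => n / q) atTop atTop :=
    Nat.tendsto_div_const_atTop (by omega)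
  induction L with
  | zero =>
    intro l ε hε
    filter_upwards with n
    have a1 := Sn_bound (hB l) n y
    have a2 := Sn_bound (hB l) (n / q) y
    have a3 := mul_le_mul_of_nonneg_left (hdiv n) hB0
    have a4 : |(q : ℝ) * Sn (F l) (n / q) y| ≤ B * n := by
      rw [abs_mul, abs_of_pos (by linarith : (0:ℝ) < q)]
      calc _ ≤ (q : ℝ) * (B * ((n / q : ℕ) : ℝ)) := by gcongr
        _ = B * (q * ((n / q : ℕ) : ℝ)) := by ring
        _ ≤ _ := a3
    have a5 := abs_sub (Sn (F l) n y) (q * Sn (F l) (n / q) y)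
    have : 0 ≤ ε * n := by positivity
    simp only [pow_zero, div_one]
    linarith
  | succ L ih =>
    intro l ε hε
    have e1 := hM l (ε / 8) (by positivity)
    have e2 := htd.eventually e1
    have e3 := htd.eventually (ih (l+1) (ε / 2) (by positivity))
    have e4 : ∀ᶠ n : ℕ in atTop, B * q ≤ ε / 4 * n := by
      have : Tendsto (fun n : ℕ => ε / 4 * (n : ℝ)) atTop atTop :=
        tendsto_natCast_atTop_atTop.const_mul_atTop (by positivity)
      exact this.eventually_ge_atTop _
    filter_upwards [e1, e2, e3, e4] with n b1 b2 b3 b4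
    have r1 := Sn_rec hq p (F l) n y
    have r2 := Sn_rec hq p (F l) (n / q) y
    rw [← hF l] at r1 r2
    set N : ℝ := (n : ℝ)
    set N1 : ℝ := ((n / q : ℕ) : ℝ)
    set N2 : ℝ := ((n / q / q : ℕ) : ℝ)
    have d1 : (q : ℝ) * N1 ≤ N := hdiv n
    have d2 : N ≤ (q : ℝ) * N1 + q := hdiv2 n
    have d3 : (q : ℝ) * N2 ≤ N1 := hdiv (n / q)
    have d4 : N1 ≤ (q : ℝ) * N2 + q := hdiv2 (n / q)
    have c1 : |(q : ℝ) * Mn q p (F l) (n / q) y| ≤ ε / 8 * N := by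
      rw [abs_mul, abs_of_pos (by linarith : (0:ℝ) < q)]
      calc _ ≤ (q : ℝ) * (ε / 8 * N1) := by gcongr
        _ = ε / 8 * (q * N1) := by ring
        _ ≤ _ := by gcongr
    have c2 : |((N - q * N1) - (N1 - q * N2)) * pf p (F l) none| ≤ B * q := by
      rw [abs_mul, mul_comm B]
      have : |(N - q * N1) - (N1 - q * N2)| ≤ q := by
        rw [abs_le]; constructor <;> linarith
      have := pf_bound h0 h1 (hB l) none
      gcongr
    have c3 : (2 * B / (q : ℝ) ^ L + ε / 2) * N1 ≤ (2 * B / (q : ℝ) ^ (L+1) + ε / 2) * N := by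
      have g1 : N1 ≤ N / q := by
        rw [le_div_iff₀ (by linarith)]; linarith
      have g2 : N / q ≤ N := div_le_self (Nat.cast_nonneg n) (by linarith)
      have g3 : 2 * B / (q : ℝ) ^ L * N1 ≤ 2 * B / (q : ℝ) ^ L * (N / q) := by gcongr
      have g4 : 2 * B / (q : ℝ) ^ L * (N / q) = 2 * B / (q : ℝ) ^ (L+1) * N := by
        rw [pow_succ]; field_simp
      have g5 : ε / 2 * N1 ≤ ε / 2 * N := by gcongr; linarith
      linarith
    have key : Sn (F l) n y - q * Sn (F l) (n / q) y =
        Mn q p (F l) n y - q * Mn q p (F l) (n / q) y +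
        ((N - q * N1) - (N1 - q * N2)) * pf p (F l) none +
        (Sn (F (l+1)) (n / q) y - q * Sn (F (l+1)) (n / q / q) y) := by
      rw [r1, r2]; ring
    rw [key]
    rw [abs_le] at *
    constructor <;> linarith [b1.1, b1.2, b3.1, b3.2, c1.1, c1.2, c2.1, c2.2]

lemma upper_det {m q : ℕ} (hq : 2 ≤ q) {f : Fin m → ℝ} (hf : ∀ j, 0 ≤ f j) (y : ℕ → Fin m)
    (δ : ℝ) (hδ : 0 < δ) (N : ℕ) :
    ∃ n ≥ N, q ∣ n ∧ -(δ * n) ≤ Sn f n y - q * Sn f (n / q) y := by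
  by_contra hcon
  push Not at hcon
  have hq' : (2 : ℝ) ≤ q := by exact_mod_cast hq
  have hlt : ∀ l, l < q ^ l := fun l => Nat.lt_pow_self (by omega)
  have step : ∀ l, N ≤ l → Sn f (q ^ (l+1)) y / (q : ℝ) ^ (l+1) ≤
      Sn f (q ^ l) y / (q : ℝ) ^ l - δ := by
    intro l hl
    have h := hcon (q ^ (l+1)) (by have := hlt (l+1); omega) (dvd_pow_self q (by omega))
    have h2 : q ^ (l+1) / q = q ^ l := by
      rw [pow_succ]; exact Nat.mul_div_cancel _ (by omega)
    rw [h2] at h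
    push_cast at h
    rw [div_le_iff₀ (by positivity), sub_mul]
    have e : Sn f (q ^ l) y / (q : ℝ) ^ l * (q : ℝ) ^ (l+1) = q * Sn f (q ^ l) y := by
      rw [pow_succ]; field_simp
    rw [e]; linarith
  have all : ∀ j : ℕ, Sn f (q ^ (N+j)) y / (q : ℝ) ^ (N+j) ≤
      Sn f (q ^ N) y / (q : ℝ) ^ N - j * δ := by
    intro j
    induction j with
    | zero => simp
    | succ j ih =>
      have := step (N+j) (by omega)
      rw [← add_assoc]
      push_cast
      linarith
  obtain ⟨j, hj⟩ := exists_nat_gt (Sn f (q ^ N) y / (q : ℝ) ^ N / δ)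
  rw [div_lt_iff₀ hδ] at hj
  have h1 := all j
  have h2 : 0 ≤ Sn f (q ^ (N+j)) y / (q : ℝ) ^ (N+j) :=
    div_nonneg (Finset.sum_nonneg (fun k _ => hf _)) (by positivity)
  linarith
/-- transition probabilities. -/
def pker {m : ℕ} (q : ℕ) (A : Matrix (Fin m) (Fin m) ℝ) (t : Fin m → ℝ) :
    Option (Fin m) → Fin m → ℝ
  | none, j => t j / ∑ i, t i
  | some i, j => A i j * t j / t i ^ q

/-- normalising logs. -/
def gker {m : ℕ} (q : ℕ) (t : Fin m → ℝ) : Option (Fin m) → ℝ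
  | none => Real.log (∑ i, t i)
  | some i => q * Real.log (t i)

lemma pker_eq {m q : ℕ} {A : Matrix (Fin m) (Fin m) ℝ} {t : Fin m → ℝ} (ht1 : ∀ i, 1 < t i)
    (s : Option (Fin m)) (j : Fin m) (hs : ∀ i, s = some i → A i j = 1) :
    pker q A t s j = Real.exp (Real.log (t j) - gker q t s) := by
  have hj : 0 < t j := by linarith [ht1 j]
  have hT : 0 < ∑ i, t i := Finset.sum_pos (fun i _ => by linarith [ht1 i]) ⟨j, Finset.mem_univ j⟩
  cases s with
  | none => simp only [pker, gker]; rw [Real.exp_sub, Real.exp_log hj, Real.exp_log hT]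
  | some i =>
    have hi : 0 < t i := by linarith [ht1 i]
    simp only [pker, gker]
    rw [hs i rfl, Real.exp_sub, Real.exp_log hj, Real.exp_nat_mul, Real.exp_log hi, one_mul]

lemma wt_formula {m q : ℕ} (hq : 2 ≤ q) {t : Fin m → ℝ} (n : ℕ) (y : ℕ → Fin m) :
    ∏ k ∈ Finset.Icc 1 n, Real.exp (Real.log (t (y k)) - gker q t (kst q y k)) =
    Real.exp (Sn (fun j => Real.log (t j)) n y - q * Sn (fun j => Real.log (t j)) (n / q) y
      - ((n : ℝ) - (n / q : ℕ)) * Real.log (∑ i, t i)) := by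
  rw [← Real.exp_sum, Finset.sum_sub_distrib, sum_kst hq]
  congr 1
  simp only [Sn, gker, ← Finset.mul_sum]
  ring

lemma wt_le {m q : ℕ} (hq : 2 ≤ q) {A : Matrix (Fin m) (Fin m) ℝ} {t : Fin m → ℝ}
    (hA01 : ∀ i j, A i j = 0 ∨ A i j = 1) (ht1 : ∀ i, 1 < t i)
    (h0 : ∀ s j, 0 ≤ pker q A t s j) (n : ℕ) (y : ℕ → Fin m) :
    wt q (pker q A t) n y ≤
    Real.exp (Sn (fun j => Real.log (t j)) n y - q * Sn (fun j => Real.log (t j)) (n / q) y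
      - ((n : ℝ) - (n / q : ℕ)) * Real.log (∑ i, t i)) := by
  rw [← wt_formula hq]
  apply Finset.prod_le_prod (fun k _ => h0 _ _)
  intro k _
  by_cases h : ∀ i, kst q y k = some i → A i (y k) = 1
  · exact (pker_eq ht1 _ _ h).le
  · push Not at h
    obtain ⟨i, hi, hi2⟩ := h
    rw [hi]
    have := (hA01 i (y k)).resolve_right hi2
    simp only [pker, this, zero_mul, zero_div]
    exact (Real.exp_pos _).le

lemma wt_eq {m q : ℕ} (hq : 2 ≤ q) {A : Matrix (Fin m) (Fin m) ℝ} {t : Fin m → ℝ}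
    (ht1 : ∀ i, 1 < t i) (n : ℕ) (y : ℕ → Fin m) (hy : ∀ k, 0 < k → A (y k) (y (q * k)) = 1) :
    wt q (pker q A t) n y =
    Real.exp (Sn (fun j => Real.log (t j)) n y - q * Sn (fun j => Real.log (t j)) (n / q) y
      - ((n : ℝ) - (n / q : ℕ)) * Real.log (∑ i, t i)) := by
  rw [← wt_formula hq]
  apply Finset.prod_congr rfl
  intro k hk
  apply pker_eq ht1
  intro i hi
  unfold kst at hi
  split_ifs at hi with hd
  obtain ⟨l, rfl⟩ := hd
  rw [Nat.mul_div_cancel_left l (by omega)] at hi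
  cases hi
  apply hy
  rw [Finset.mem_Icc] at hk
  rcases Nat.eq_zero_or_pos l with rfl | h
  · simp at hk
  · exact h

lemma pker_nonneg {m q : ℕ} {A : Matrix (Fin m) (Fin m) ℝ} {t : Fin m → ℝ}
    (hA01 : ∀ i j, A i j = 0 ∨ A i j = 1) (ht1 : ∀ i, 1 < t i) (s j) :
    0 ≤ pker q A t s j := by
  have h : ∀ i, 0 ≤ t i := fun i => by linarith [ht1 i]
  cases s with
  | none => exact div_nonneg (h j) (Finset.sum_nonneg (fun i _ => h i))
  | some i =>
    refine div_nonneg (mul_nonneg ?_ (h j)) (pow_nonneg (h i) _)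
    rcases hA01 i j with h | h <;> rw [h] <;> norm_num

lemma pker_sum {m q : ℕ} (hm : 2 ≤ m) {A : Matrix (Fin m) (Fin m) ℝ} {t : Fin m → ℝ}
    (ht1 : ∀ i, 1 < t i) (ht : ∀ i, t i ^ q = ∑ j, A i j * t j) (s) :
    ∑ j, pker q A t s j = 1 := by
  have h : ∀ i, 0 < t i := fun i => by linarith [ht1 i]
  cases s with
  | none =>
    simp only [pker]
    rw [← Finset.sum_div]
    apply div_self
    exact (Finset.sum_pos (fun i _ => h i) ⟨⟨0, by omega⟩, Finset.mem_univ _⟩).ne'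
  | some i =>
    simp only [pker]
    rw [← Finset.sum_div, ← ht i]
    exact div_self (pow_pos (h i) _).ne'

lemma T_gt_one {m : ℕ} (hm : 2 ≤ m) {t : Fin m → ℝ} (ht1 : ∀ i, 1 < t i) : 1 < ∑ i, t i := by
  have : t ⟨0, by omega⟩ ≤ ∑ i, t i :=
    Finset.single_le_sum (f := t) (fun i _ => by linarith [ht1 i]) (Finset.mem_univ _)
  linarith [ht1 ⟨0, by omega⟩]

lemma upper_bound {m q : ℕ} (hm : 2 ≤ m) (hq : 2 ≤ q) {A : Matrix (Fin m) (Fin m) ℝ}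
    (hA01 : ∀ i j, A i j = 0 ∨ A i j = 1) {t : Fin m → ℝ} (ht1 : ∀ i, 1 < t i)
    (ht : ∀ i, t i ^ q = ∑ j, A i j * t j) (X : Set ℝ)
    (hX : ∀ r ∈ X, ∃ y : ℕ → Fin m, (∀ k, 0 < k → A (y k) (y (q * k)) = 1) ∧
      r = ValMap m (fun k => y k)) (s : ℝ) (hs0 : 0 ≤ s)
    (hs : s * Real.log m = (((q : ℝ) - 1) / q) * Real.log (∑ i, t i)) :
    dimH X ≤ ENNReal.ofReal s := by
  have hm' : (2 : ℝ) ≤ m := by exact_mod_cast hm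
  have hq' : (2 : ℝ) ≤ q := by exact_mod_cast hq
  have hlog : 0 < Real.log m := Real.log_pos (by linarith)
  have hT := T_gt_one hm ht1
  have hlT : 0 < Real.log (∑ i, t i) := Real.log_pos hT
  apply dimH_le
  intro d hd
  by_contra hlt
  rw [not_le] at hlt
  have hsd : s < d := by
    rw [← ENNReal.ofReal_coe_nnreal] at hlt
    exact (ENNReal.ofReal_lt_ofReal_iff_of_nonneg hs0).1 hlt
  have hd0 : (0 : ℝ) < d := by linarith
  obtain ⟨P, hP1, hP⟩ := exists_HasWt hq (pker q A t) (pker_nonneg hA01 ht1) (pker_sum hm ht1 ht)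
  set δ := ((d : ℝ) - s) / 2 with hδdef
  have hδ : 0 < δ := by rw [hδdef]; linarith
  set x := Real.exp (-((s + δ) * Real.log m)) with hx
  set z := Real.exp (-(δ * Real.log m)) with hz
  have hxz : ∀ n : ℕ, (((m : ℝ) ^ n)⁻¹) ^ (d : ℝ) = z ^ n * x ^ n := by
    intro n
    rw [Real.rpow_def_of_pos (by positivity), Real.log_inv, Real.log_pow, hx, hz,
      ← Real.exp_nat_mul, ← Real.exp_nat_mul, ← Real.exp_add]
    congr 1
    have : (d : ℝ) = s + 2 * δ := by rw [hδdef]; ring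
    rw [this]; ring
  let U : ℕ → ℕ × ℕ → Set ℝ := fun N na =>
    if N ≤ na.1 ∧ ENNReal.ofReal (x ^ na.1) ≤ P {w | code na.1 w = na.2} then
      Set.Icc ((na.2 : ℝ) / (m : ℝ) ^ na.1) (((na.2 : ℝ) + 1) / (m : ℝ) ^ na.1) else ∅
  have hdiam : ∀ n a : ℕ, Metric.ediam (Set.Icc ((a : ℝ) / (m : ℝ) ^ n) (((a : ℝ) + 1) / (m : ℝ) ^ n))
      = ENNReal.ofReal (((m : ℝ) ^ n)⁻¹) := by
    intro n a
    rw [Real.ediam_Icc]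
    congr 1
    rw [add_div, one_div]; ring
  have hle : Measure.hausdorffMeasure (d : ℝ) X ≤
      liminf (fun N => ∑' na : ℕ × ℕ, Metric.ediam (U N na) ^ (d : ℝ)) atTop := by
    apply Measure.hausdorffMeasure_le_liminf_tsum (d : ℝ) X
      (fun N : ℕ => ENNReal.ofReal (((m : ℝ) ^ N)⁻¹))
    · have h1 : Tendsto (fun N : ℕ => ((m : ℝ) ^ N)⁻¹) atTop (𝓝 0) := by
        apply Tendsto.inv_tendsto_atTop
        exact tendsto_pow_atTop_atTop_of_one_lt (by linarith)
      simpa using ENNReal.tendsto_ofReal h1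
    · filter_upwards with N
      rintro ⟨n, a⟩
      simp only [U]
      split_ifs with h
      · rw [hdiam]
        apply ENNReal.ofReal_le_ofReal
        apply inv_anti₀ (by positivity)
        exact pow_le_pow_right₀ (by linarith) h.1
      · simp
    · filter_upwards with N
      intro r hr
      obtain ⟨y, hy, rfl⟩ := hX r hr
      obtain ⟨n, hn, hqn, hn2⟩ := upper_det hq (f := fun j => Real.log (t j))
        (fun j => Real.log_nonneg (ht1 j).le) y (δ * Real.log m) (by positivity) N
      rw [Set.mem_iUnion]
      refine ⟨(n, code n y), ?_⟩
      have hcond : N ≤ n ∧ ENNReal.ofReal (x ^ n) ≤ P {w | code n w = code n y} := by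
        refine ⟨hn, ?_⟩
        rw [hP n y]
        apply ENNReal.ofReal_le_ofReal
        rw [wt_eq hq ht1 n y hy, hx, ← Real.exp_nat_mul]
        apply Real.exp_le_exp.2
        have e1 : ((n / q : ℕ) : ℝ) = (n : ℝ) / q := Nat.cast_div hqn (by linarith)
        have e2 : ((n : ℝ) - (n / q : ℕ)) * Real.log (∑ i, t i) = n * (s * Real.log m) := by
          rw [hs, e1]; field_simp
        rw [e2]
        linarith
      simp only [U, if_pos hcond]
      exact val_bounds hm y n
  have hbound : ∀ N, ∑' na : ℕ × ℕ, Metric.ediam (U N na) ^ (d : ℝ) ≤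
      ∑' n : ℕ, ENNReal.ofReal z ^ n := by
    intro N
    rw [ENNReal.tsum_prod']
    apply ENNReal.tsum_le_tsum
    intro n
    calc ∑' a : ℕ, Metric.ediam (U N (n, a)) ^ (d : ℝ)
        ≤ ∑' a : ℕ, ENNReal.ofReal z ^ n * P {w | code n w = a} := by
          apply ENNReal.tsum_le_tsum
          intro a
          simp only [U]
          split_ifs with h
          · rw [hdiam, ENNReal.ofReal_rpow_of_pos (by positivity), hxz,
              ENNReal.ofReal_mul (by positivity), ENNReal.ofReal_pow (Real.exp_pos _).le]
            gcongr
            exact h.2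
          · rw [Metric.ediam_empty, ENNReal.zero_rpow_of_pos hd0]
            exact zero_le
      _ = ENNReal.ofReal z ^ n := by rw [ENNReal.tsum_mul_left, sum_code P n, mul_one]
  have hfin : ∑' n : ℕ, ENNReal.ofReal z ^ n ≠ ∞ := by
    rw [ENNReal.tsum_geometric]
    apply ENNReal.inv_ne_top.2
    rw [Ne, tsub_eq_zero_iff_le, not_le, ENNReal.ofReal_lt_one]
    exact Real.exp_lt_one_iff.2 (by linarith [mul_pos hδ hlog])
  have hl2 : liminf (fun N => ∑' na : ℕ × ℕ, Metric.ediam (U N na) ^ (d : ℝ)) atTop ≤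
      ∑' n : ℕ, ENNReal.ofReal z ^ n :=
    (liminf_le_liminf (Eventually.of_forall hbound)).trans (liminf_const _).le
  rw [hd] at hle
  exact hfin (top_le_iff.1 (hle.trans hl2))

/-- iterated averages. -/
def Fit {m : ℕ} (p : Option (Fin m) → Fin m → ℝ) (f : Fin m → ℝ) : ℕ → Fin m → ℝ
  | 0 => f
  | l + 1 => fun i => pf p (Fit p f l) (some i)

lemma ae_small {m q : ℕ} (hm : 2 ≤ m) (hq : 2 ≤ q) {A : Matrix (Fin m) (Fin m) ℝ}
    (hA01 : ∀ i j, A i j = 0 ∨ A i j = 1) {t : Fin m → ℝ} (ht1 : ∀ i, 1 < t i)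
    (ht : ∀ i, t i ^ q = ∑ j, A i j * t j)
    (s : ℝ) (hs : s * Real.log m = (((q : ℝ) - 1) / q) * Real.log (∑ i, t i))
    {P : Measure (ℕ → Fin m)} (hP : HasWt q (pker q A t) P) (d : ℝ) (hd : d < s) :
    ∀ᵐ y ∂P, ∀ᶠ n : ℕ in atTop, wt q (pker q A t) n y ≤ Real.exp (-(d * Real.log m)) ^ n := by
  have hm' : (2 : ℝ) ≤ m := by exact_mod_cast hm
  have hq' : (2 : ℝ) ≤ q := by exact_mod_cast hq
  have hlog : 0 < Real.log m := Real.log_pos (by linarith)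
  have hT := T_gt_one hm ht1
  have hlT : 0 < Real.log (∑ i, t i) := Real.log_pos hT
  have h0 := pker_nonneg (q := q) hA01 ht1
  have h1 := pker_sum hm ht1 ht
  set p := pker q A t with hp
  set f : Fin m → ℝ := fun j => Real.log (t j) with hf
  set F := Fit p f with hF
  set B := ∑ j, |f j| with hBdef
  have hB0 : 0 ≤ B := Finset.sum_nonneg (fun j _ => abs_nonneg _)
  have hB : ∀ l j, |F l j| ≤ B := by
    intro l
    induction l with
    | zero =>
      intro j
      exact Finset.single_le_sum (f := fun j => |f j|) (fun i _ => abs_nonneg _) (Finset.mem_univ j)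
    | succ l ih =>
      intro j
      exact pf_bound h0 h1 ih (some j)
  have hB' : ∀ l j, |(fun i => -F l i) j| ≤ B := by
    intro l j
    simp only [abs_neg]
    exact hB l j
  have hneg : ∀ l n y, Mn q p (fun i => -F l i) n y = -Mn q p (F l) n y := by
    intro l n y
    unfold Mn pf
    rw [← Finset.sum_neg_distrib]
    apply Finset.sum_congr rfl
    intro k _
    simp only [mul_neg, Finset.sum_neg_distrib]
    ring
  have hae1 : ∀ᵐ y ∂P, ∀ l i : ℕ, ∀ᶠ n : ℕ in atTop, Mn q p (F l) n y < 1 / ((i : ℝ) + 1) * n := by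
    rw [ae_all_iff]; intro l
    rw [ae_all_iff]; intro i
    exact tail hq h0 h1 hP hB0 (hB l) (by positivity)
  have hae2 : ∀ᵐ y ∂P, ∀ l i : ℕ, ∀ᶠ n : ℕ in atTop,
      Mn q p (fun j => -F l j) n y < 1 / ((i : ℝ) + 1) * n := by
    rw [ae_all_iff]; intro l
    rw [ae_all_iff]; intro i
    exact tail hq h0 h1 hP hB0 (hB' l) (by positivity)
  filter_upwards [hae1, hae2] with y hy1 hy2
  have hM : ∀ l, ∀ ε > 0, ∀ᶠ n : ℕ in atTop, |Mn q p (F l) n y| ≤ ε * n := by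
    intro l ε hε
    obtain ⟨i, hi⟩ := exists_nat_one_div_lt hε
    filter_upwards [hy1 l i, hy2 l i] with n a1 a2
    rw [hneg] at a2
    have : 1 / ((i : ℝ) + 1) * n ≤ ε * n := by gcongr
    rw [abs_le]
    constructor <;> linarith
  have hη : 0 < (s - d) * Real.log m := mul_pos (by linarith) hlog
  obtain ⟨L, hL⟩ : ∃ L : ℕ, 2 * B / (q : ℝ) ^ L ≤ (s - d) * Real.log m / 2 := by
    have h2 : Tendsto (fun L : ℕ => 2 * B / (q : ℝ) ^ L) atTop (𝓝 0) := by
      apply Tendsto.const_div_atTop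
      exact tendsto_pow_atTop_atTop_of_one_lt (by linarith)
    exact (h2.eventually_le_const (half_pos hη)).exists
  have := lower_det hq h0 h1 hB0 hB (fun l => rfl) y hM L 0 ((s - d) * Real.log m / 2) (half_pos hη)
  filter_upwards [this] with n hn
  have hF0 : F 0 = f := rfl
  rw [hF0] at hn
  refine (wt_le hq hA01 ht1 h0 n y).trans ?_
  rw [← Real.exp_nat_mul]
  apply Real.exp_le_exp.2
  have a1 := (abs_le.1 hn).2
  have a2 : (2 * B / (q : ℝ) ^ L + (s - d) * Real.log m / 2) * n ≤ ((s - d) * Real.log m) * n := by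
    gcongr; linarith
  have a3 : (n : ℝ) * (s * Real.log m) ≤ ((n : ℝ) - (n / q : ℕ)) * Real.log (∑ i, t i) := by
    rw [hs, ← mul_assoc]
    gcongr
    have : ((n / q : ℕ) : ℝ) ≤ (n : ℝ) / q := Nat.cast_div_le
    have e : (n : ℝ) * (((q : ℝ) - 1) / q) = n - n / q := by field_simp
    rw [e]; linarith
  linarith

lemma ae_mem {m q : ℕ} (hq : 2 ≤ q) {A : Matrix (Fin m) (Fin m) ℝ}
    (hA01 : ∀ i j, A i j = 0 ∨ A i j = 1) {t : Fin m → ℝ}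
    {P : Measure (ℕ → Fin m)} [IsProbabilityMeasure P] (hP : HasWt q (pker q A t) P) :
    ∀ᵐ y ∂P, ∀ k, 0 < k → A (y k) (y (q * k)) = 1 := by
  have h : ∀ᵐ y ∂P, ∀ n, wt q (pker q A t) n y ≠ 0 := by
    rw [ae_all_iff]
    intro n
    rw [ae_iff]
    have := compare hP hP n 0 le_rfl {y | ¬ wt q (pker q A t) n y ≠ 0} (by
      intro y hy
      have : wt q (pker q A t) n y = 0 := not_not.1 hy
      rw [this]; simp)
    simpa using this
  filter_upwards [h] with y hy k hk
  have h1 := hy (q * k)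
  unfold wt at h1
  rw [Finset.prod_ne_zero_iff] at h1
  have h2 := h1 (q * k) (by
    rw [Finset.mem_Icc]
    exact ⟨Nat.mul_pos (by omega) hk, le_rfl⟩)
  have h3 : kst q y (q * k) = some (y k) := by
    unfold kst
    rw [if_pos (dvd_mul_right q k), Nat.mul_div_cancel_left k (by omega)]
  rw [h3] at h2
  rcases hA01 (y k) (y (q * k)) with h4 | h4
  · exfalso
    apply h2
    simp [pker, h4]
  · exact h4

lemma mass_cyl {m : ℕ} (hm : 2 ≤ m) (P : Measure (ℕ → Fin m)) (G : Set (ℕ → Fin m)) (n : ℕ)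
    (c : ℝ≥0∞) (hG : ∀ y ∈ G, P {z | code n z = code n y} ≤ c) (U : Set ℝ)
    (hU : Metric.ediam U ≤ ENNReal.ofReal (((m : ℝ) ^ n)⁻¹)) :
    P ((fun y : ℕ → Fin m => ValMap m (fun k => y k)) ⁻¹' U ∩ G) ≤ 5 * c := by
  have hm' : (2 : ℝ) ≤ m := by exact_mod_cast hm
  rcases Set.eq_empty_or_nonempty ((fun y : ℕ → Fin m => ValMap m (fun k => y k)) ⁻¹' U ∩ G)
    with he | ⟨y0, hy0U, hy0⟩
  · rw [he]; simp
  set e := code n y0 with hedef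
  have hpos : 0 < (m : ℝ) ^ n := by positivity
  calc P ((fun y : ℕ → Fin m => ValMap m (fun k => y k)) ⁻¹' U ∩ G)
      ≤ P (⋃ a ∈ Finset.Icc (e - 2) (e + 2), ({z | code n z = a} ∩ G)) := by
        apply measure_mono
        rintro y ⟨hyU, hy⟩
        simp only [Set.mem_iUnion]
        refine ⟨code n y, ?_, rfl, hy⟩
        have hdist : |ValMap m (fun k => y k) - ValMap m (fun k => y0 k)| ≤ ((m : ℝ) ^ n)⁻¹ := by
          have hyU1 : ValMap m (fun k => y k) ∈ U := hyU
          have hyU0 : ValMap m (fun k => y0 k) ∈ U := hy0U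
          have := (Metric.edist_le_ediam_of_mem hyU1 hyU0).trans hU
          rw [edist_dist, ENNReal.ofReal_le_ofReal_iff (by positivity), Real.dist_eq] at this
          exact this
        have b1 := val_bounds hm y n
        have b2 := val_bounds hm y0 n
        rw [div_le_iff₀ hpos, le_div_iff₀ hpos] at b1 b2
        rw [abs_le] at hdist
        have c1 := mul_le_mul_of_nonneg_right hdist.1 hpos.le
        have c2 := mul_le_mul_of_nonneg_right hdist.2 hpos.le
        rw [neg_mul, inv_mul_cancel₀ hpos.ne', sub_mul] at c1
        rw [inv_mul_cancel₀ hpos.ne', sub_mul] at c2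
        have r1 : (code n y : ℝ) ≤ (e : ℝ) + 2 := by linarith
        have r2 : (e : ℝ) ≤ (code n y : ℝ) + 2 := by linarith
        have r1' : code n y ≤ e + 2 := by exact_mod_cast r1
        have r2' : e ≤ code n y + 2 := by exact_mod_cast r2
        rw [Finset.mem_Icc]
        omega
    _ ≤ ∑ a ∈ Finset.Icc (e - 2) (e + 2), P ({z | code n z = a} ∩ G) :=
        measure_biUnion_finset_le _ _
    _ ≤ ∑ a ∈ Finset.Icc (e - 2) (e + 2), c := by
        apply Finset.sum_le_sum
        intro a _
        rcases Set.eq_empty_or_nonempty ({z | code n z = a} ∩ G) with he | ⟨y, hya, hy⟩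
        · rw [he]; simp
        · refine (measure_mono Set.inter_subset_left).trans ?_
          have hya' : code n y = a := hya
          rw [← hya']
          exact hG y hy
    _ ≤ 5 * c := by
        rw [Finset.sum_const, nsmul_eq_mul]
        gcongr
        have : (Finset.Icc (e - 2) (e + 2)).card ≤ 5 := by
          rw [Nat.card_Icc]; omega
        exact_mod_cast this

lemma mass_bound {m : ℕ} (hm : 2 ≤ m) (P : Measure (ℕ → Fin m)) (G : Set (ℕ → Fin m)) (N : ℕ)
    (d : ℝ) (hd : 0 < d)
    (hG : ∀ y ∈ G, ∀ n ≥ N, P {z | code n z = code n y} ≤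
      ENNReal.ofReal (Real.exp (-(d * Real.log m)) ^ n)) (U : Set ℝ)
    (hU : Metric.ediam U ≤ ENNReal.ofReal (((m : ℝ) ^ N)⁻¹)) :
    P ((fun y : ℕ → Fin m => ValMap m (fun k => y k)) ⁻¹' U ∩ G) ≤
      ENNReal.ofReal (5 * (m : ℝ) ^ d) * Metric.ediam U ^ d := by
  have hm' : (2 : ℝ) ≤ m := by exact_mod_cast hm
  have hlog : 0 < Real.log m := Real.log_pos (by linarith)
  set x := Real.exp (-(d * Real.log m)) with hx
  have hx1 : x < 1 := Real.exp_lt_one_iff.2 (by linarith [mul_pos hd hlog])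
  have hx0 : 0 < x := Real.exp_pos _
  have hfin : Metric.ediam U ≠ ∞ := ne_top_of_le_ne_top ENNReal.ofReal_ne_top hU
  by_cases h0 : Metric.ediam U = 0
  · have key : ∀ n ≥ N, P ((fun y : ℕ → Fin m => ValMap m (fun k => y k)) ⁻¹' U ∩ G) ≤
        5 * ENNReal.ofReal (x ^ n) := fun n hn =>
      mass_cyl hm P G n _ (fun y hy => hG y hy n hn) U (by rw [h0]; exact zero_le)
    have hlim : Tendsto (fun n : ℕ => 5 * ENNReal.ofReal (x ^ n)) atTop (𝓝 0) := by
      have h1 := ENNReal.tendsto_ofReal (tendsto_pow_atTop_nhds_zero_of_lt_one hx0.le hx1)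
      have h2 := ENNReal.Tendsto.const_mul (a := 5) h1 (Or.inr (by norm_num))
      simpa using h2
    have : P ((fun y : ℕ → Fin m => ValMap m (fun k => y k)) ⁻¹' U ∩ G) ≤ 0 :=
      ge_of_tendsto hlim (by
        filter_upwards [eventually_ge_atTop N] with n hn
        exact key n hn)
    exact this.trans zero_le
  · set D := (Metric.ediam U).toReal with hD
    have hDU : Metric.ediam U = ENNReal.ofReal D := (ENNReal.ofReal_toReal hfin).symm
    have hD0 : 0 < D := ENNReal.toReal_pos h0 hfin
    rw [hDU] at hU ⊢
    rw [ENNReal.ofReal_le_ofReal_iff (by positivity)] at hU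
    have hi1 : ((m : ℝ))⁻¹ < 1 := by apply inv_lt_one_of_one_lt₀; linarith
    have hi0 : 0 < ((m : ℝ))⁻¹ := by positivity
    rw [← inv_pow] at hU
    obtain ⟨n, hn1, hn2⟩ := exists_nat_pow_near_of_lt_one hD0
      (hU.trans (pow_le_one₀ hi0.le hi1.le)) hi0 hi1
    have hnN : N ≤ n := by
      have := (pow_lt_pow_iff_right_of_lt_one₀ hi0 hi1).1 (hn1.trans_le hU)
      omega
    refine (mass_cyl hm P G n _ (fun y hy => hG y hy n hnN) U ?_).trans ?_
    · rw [hDU, ← inv_pow]; exact ENNReal.ofReal_le_ofReal hn2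
    · rw [ENNReal.ofReal_rpow_of_pos hD0, ← ENNReal.ofReal_mul (by positivity)]
      have e5 : (5 : ℝ≥0∞) = ENNReal.ofReal 5 := by norm_num
      rw [e5, ← ENNReal.ofReal_mul (by norm_num)]
      apply ENNReal.ofReal_le_ofReal
      have e1 : x ^ n = (m : ℝ) ^ d * ((m : ℝ)⁻¹ ^ (n+1)) ^ d := by
        rw [Real.rpow_def_of_pos (by positivity), Real.rpow_def_of_pos (by positivity),
          Real.log_pow, Real.log_inv, hx, ← Real.exp_nat_mul, ← Real.exp_add]
        congr 1
        push_cast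
        ring
      rw [e1, mul_assoc]
      gcongr

lemma lower_bound {m q : ℕ} (hm : 2 ≤ m) (hq : 2 ≤ q) {A : Matrix (Fin m) (Fin m) ℝ}
    (hA01 : ∀ i j, A i j = 0 ∨ A i j = 1) {t : Fin m → ℝ} (ht1 : ∀ i, 1 < t i)
    (ht : ∀ i, t i ^ q = ∑ j, A i j * t j) (X : Set ℝ)
    (hX : ∀ y : ℕ → Fin m, (∀ k, 0 < k → A (y k) (y (q * k)) = 1) →
      ValMap m (fun k => y k) ∈ X) (s : ℝ)
    (hs : s * Real.log m = (((q : ℝ) - 1) / q) * Real.log (∑ i, t i)) (d : NNReal)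
    (hd0 : 0 < (d : ℝ)) (hd : (d : ℝ) < s) : (d : ℝ≥0∞) ≤ dimH X := by
  have hm' : (2 : ℝ) ≤ m := by exact_mod_cast hm
  obtain ⟨P, hP1, hP⟩ := exists_HasWt hq (pker q A t) (pker_nonneg hA01 ht1) (pker_sum hm ht1 ht)
  have hae := ae_small hm hq hA01 ht1 ht s hs hP d hd
  have hmem := ae_mem hq hA01 hP
  let G : ℕ → Set (ℕ → Fin m) := fun N => {y | (∀ k, 0 < k → A (y k) (y (q * k)) = 1) ∧
    ∀ n ≥ N, wt q (pker q A t) n y ≤ Real.exp (-((d : ℝ) * Real.log m)) ^ n}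
  have hun : P (⋃ N, G N) ≠ 0 := by
    have h1 : ∀ᵐ y ∂P, y ∈ ⋃ N, G N := by
      filter_upwards [hae, hmem] with y h1 h2
      rw [eventually_atTop] at h1
      obtain ⟨N, hN⟩ := h1
      exact Set.mem_iUnion.2 ⟨N, h2, hN⟩
    intro h0
    have h2 : ∀ᵐ y ∂P, y ∉ ⋃ N, G N := measure_eq_zero_iff_ae_notMem.1 h0
    have h3 : ∀ᵐ y ∂P, False := by
      filter_upwards [h1, h2] with y a b
      exact b a
    rw [ae_iff] at h3
    simp at h3
  obtain ⟨N, hN⟩ := exists_measure_pos_of_not_measure_iUnion_null hun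
  let V : (ℕ → Fin m) → ℝ := fun y => ValMap m (fun k => y k)
  have hV : Measurable V := val_measurable hm
  let ν : Measure ℝ := (P.restrict (G N)).map V
  set c := ENNReal.ofReal (5 * (m : ℝ) ^ (d : ℝ)) with hc
  have hc0 : c ≠ 0 := by
    rw [hc, Ne, ENNReal.ofReal_eq_zero, not_le]; positivity
  have hct : c ≠ ∞ := ENNReal.ofReal_ne_top
  have hle : c⁻¹ • ν ≤ Measure.hausdorffMeasure (d : ℝ) := by
    apply Measure.le_hausdorffMeasure (d : ℝ) _ (ENNReal.ofReal (((m : ℝ) ^ N)⁻¹))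
      (by rw [ENNReal.ofReal_pos]; positivity)
    intro U hU
    have h1 : ν (closure U) ≤ c * Metric.ediam U ^ (d : ℝ) := by
      rw [Measure.map_apply hV isClosed_closure.measurableSet,
        Measure.restrict_apply (hV isClosed_closure.measurableSet)]
      have := mass_bound hm P (G N) N d hd0 (fun y hy n hn => by
        rw [hP n y]
        exact ENNReal.ofReal_le_ofReal (hy.2 n hn)) (closure U) (by
          rw [Metric.ediam_closure]; exact hU)
      rw [Metric.ediam_closure] at this
      exact this
    calc (c⁻¹ • ν) U = c⁻¹ * ν U := by simp
      _ ≤ c⁻¹ * (c * Metric.ediam U ^ (d : ℝ)) := by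
          gcongr
          exact (measure_mono subset_closure).trans h1
      _ = Metric.ediam U ^ (d : ℝ) := by
          rw [← mul_assoc, ENNReal.inv_mul_cancel hc0 hct, one_mul]
  apply le_dimH_of_hausdorffMeasure_ne_zero
  have h2 : 0 < (c⁻¹ • ν) X := by
    have h3 : 0 < ν X := by
      calc 0 < P (G N) := hN
        _ ≤ P (V ⁻¹' X ∩ G N) := by
            apply measure_mono
            intro y hy
            exact ⟨hX y hy.1, hy⟩
        _ ≤ (P.restrict (G N)) (V ⁻¹' X) := Measure.le_restrict_apply _ _
        _ ≤ ν X := Measure.le_map_apply hV.aemeasurable _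
    have : (c⁻¹ • ν) X = c⁻¹ * ν X := by simp
    rw [this]
    exact ENNReal.mul_pos (ENNReal.inv_ne_zero.2 hct) h3.ne'
  exact (h2.trans_le (hle X)).ne.symm

/-- **Theorem 1.3 (i).** `dim_H(Ξ_A) = ((q-1)/q) log_m Σ_i t_i`. -/
theorem stmt1 (m : ℕ) (hm : 2 ≤ m) (q : ℕ+) (hq : 2 ≤ (q : ℕ))
    (A : Matrix (Fin m) (Fin m) ℝ)
    (hA01 : ∀ i j, A i j = 0 ∨ A i j = 1)
    (hAprim : ∃ n : ℕ, ∀ i j, 0 < (A ^ n) i j)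
    (t : Fin m → ℝ) (ht1 : ∀ i, 1 < t i)
    (ht : ∀ i, t i ^ (q : ℕ) = ∑ j, A i j * t j) :
    dimH (XiSet {x : ℕ+ → Fin m | ∀ k : ℕ+, A (x k) (x (q * k)) = 1}) =
      ENNReal.ofReal ((((q : ℝ) - 1) / (q : ℝ)) * Real.logb m (∑ i, t i)) := by
  have hm' : (2 : ℝ) ≤ m := by exact_mod_cast hm
  have hq' : (2 : ℝ) ≤ ((q : ℕ) : ℝ) := by exact_mod_cast hq
  have hlog : 0 < Real.log m := Real.log_pos (by linarith)
  have hT := T_gt_one hm ht1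
  have hlT : 0 < Real.log (∑ i, t i) := Real.log_pos hT
  set s := (((q : ℝ) - 1) / (q : ℝ)) * Real.logb m (∑ i, t i) with hsdef
  have hs : s * Real.log m = ((((q : ℕ) : ℝ) - 1) / ((q : ℕ) : ℝ)) * Real.log (∑ i, t i) := by
    rw [hsdef, Real.logb]
    field_simp
  have hs0 : 0 < s := by
    have h1 : 0 < s * Real.log m := by
      rw [hs]
      exact mul_pos (div_pos (by linarith) (by linarith)) hlT
    exact pos_of_mul_pos_left h1 hlog.le
  apply le_antisymm
  · apply upper_bound hm hq hA01 ht1 ht _ _ s hs0.le hs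
    rintro r ⟨x, hx, rfl⟩
    refine ⟨fun k => x (Nat.toPNat' k), ?_, ?_⟩
    · intro k hk
      have h := hx (Nat.toPNat' k)
      have e : q * Nat.toPNat' k = Nat.toPNat' ((q : ℕ) * k) := by
        apply PNat.eq
        rw [PNat.mul_coe, Nat.toPNat'_coe, Nat.toPNat'_coe, if_pos hk,
          if_pos (Nat.mul_pos q.pos hk)]
      rw [e] at h
      exact h
    · congr 1
      funext k
      simp
  · apply le_of_forall_lt
    intro c hc
    obtain ⟨d, hd1, hd2⟩ := ENNReal.lt_iff_exists_nnreal_btwn.1 hc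
    have hds : (d : ℝ) < s := by
      rw [← ENNReal.ofReal_coe_nnreal] at hd2
      exact (ENNReal.ofReal_lt_ofReal_iff_of_nonneg d.2).1 hd2
    have hd0 : 0 < (d : ℝ) := by
      have : (0 : ℝ≥0∞) < d := lt_of_le_of_lt zero_le hd1
      exact_mod_cast this
    refine hd1.trans_le (lower_bound hm hq hA01 ht1 ht _ ?_ s hs d hd0 hds)
    intro y hy
    refine ⟨fun k => y k, ?_, rfl⟩
    intro k
    have := hy k k.pos
    simpa [PNat.mul_coe] using this
end
end

section
/- Let m ≥ 2, let q ≥ 2 be an integer, and let A be a primitive m×m 0-1 matrix. Then the Minkowski (box-counting) dimension of X_A exists, i.e. the limit lim_{n→∞} log_m N_n(X_A) / n exists, and it equals (q-1)² · Σ_{k=1}^∞ log_m⟨A^{k-1} 𝟙, 𝟙⟩ / q^{k+1}, where 𝟙 = (1,…,1)^T ∈ ℝ^m and ⟨·,·⟩ is the standard inner product (so ⟨A^{k-1}𝟙, 𝟙⟩ is the sum of all entries of A^{k-1}). -/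
open scoped Classical ENNReal
open Filter MeasureTheory Topology

noncomputable section

def ZZ (m q : ℕ) (A : Matrix (Fin m) (Fin m) ℝ) (r : ℕ) (w : ℕ → Fin m → ℝ) : ℝ :=
  ∑ u : Fin r → Fin m, ∏ j : Fin r, (w (j + 1) (u j) *
    (if q ∣ (j : ℕ) + 1 then
      A (u ⟨((j : ℕ) + 1) / q - 1, by have := Nat.div_le_self ((j:ℕ)+1) q; omega⟩) (u j) else 1))

lemma ZZ_succ_not (m q : ℕ) (A : Matrix (Fin m) (Fin m) ℝ) (r : ℕ) (w : ℕ → Fin m → ℝ)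
    (h : ¬ q ∣ r + 1) : ZZ m q A (r + 1) w = ZZ m q A r w * ∑ a, w (r + 1) a := by
  unfold ZZ
  rw [← (Fin.snocEquiv (fun _ => Fin m)).sum_comp, Fintype.sum_prod_type, Finset.sum_comm,
    Finset.sum_mul]
  refine Finset.sum_congr rfl fun u _ => ?_
  rw [Finset.mul_sum]
  refine Finset.sum_congr rfl fun a _ => ?_
  rw [Fin.prod_univ_castSucc]
  congr 1
  · refine Finset.prod_congr rfl fun j _ => ?_
    have hj : ((j : ℕ) + 1) / q - 1 < r := by
      have := Nat.div_le_self ((j:ℕ)+1) q; omega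
    have e : (⟨((j.castSucc : ℕ) + 1) / q - 1, by
      have := Nat.div_le_self ((j:ℕ)+1) q; simp; omega⟩ : Fin (r + 1))
        = Fin.castSucc ⟨((j : ℕ) + 1) / q - 1, hj⟩ := by ext; simp
    simp only [Fin.snocEquiv, Equiv.coe_fn_mk]
    rw [e, Fin.snoc_castSucc, Fin.snoc_castSucc]
    simp
  · simp [Fin.snocEquiv, h]

lemma ZZ_succ_dvd (m q : ℕ) (hq : 2 ≤ q) (A : Matrix (Fin m) (Fin m) ℝ) (r : ℕ)
    (w w' : ℕ → Fin m → ℝ) (k : ℕ) (h : r + 1 = q * k)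
    (hw : ∀ j, j ≤ r → j ≠ k → w' j = w j)
    (hk : ∀ a, w' k a = w k a * ∑ b, A a b * w (r + 1) b) :
    ZZ m q A (r + 1) w = ZZ m q A r w' := by
  have hk0 : 0 < k := by rcases Nat.eq_zero_or_pos k with rfl | h' <;> omega
  have hkr : k - 1 < r := by nlinarith [Nat.sub_add_cancel hk0]
  unfold ZZ
  rw [← (Fin.snocEquiv (fun _ => Fin m)).sum_comp, Fintype.sum_prod_type, Finset.sum_comm]
  refine Finset.sum_congr rfl fun u _ => ?_
  have e2 : ∀ f : Fin r → ℝ, (∏ j : Fin r, (w' (j + 1) (u j) * f j)) =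
      (∏ j : Fin r, (w (j + 1) (u j) * f j)) * ∑ b, A (u ⟨k-1, hkr⟩) b * w (r + 1) b := by
    intro f
    rw [← Finset.mul_prod_erase Finset.univ _ (Finset.mem_univ (⟨k-1, hkr⟩ : Fin r)),
      ← Finset.mul_prod_erase Finset.univ (fun j : Fin r => w (j + 1) (u j) * f j)
        (Finset.mem_univ (⟨k-1, hkr⟩ : Fin r))]
    have : ∀ j ∈ Finset.univ.erase (⟨k-1, hkr⟩ : Fin r),
        w' (j + 1) (u j) * f j = w (j + 1) (u j) * f j := by
      intro j hj
      rw [hw]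
      · have := j.2; omega
      · intro h'
        apply (Finset.mem_erase.1 hj).1
        ext; simp; omega
    rw [Finset.prod_congr rfl this]
    simp only [Nat.sub_add_cancel hk0]
    rw [hk]; ring
  rw [e2, Finset.mul_sum]
  refine Finset.sum_congr rfl fun a _ => ?_
  rw [Fin.prod_univ_castSucc]
  congr 1
  · refine Finset.prod_congr rfl fun j _ => ?_
    have hj : ((j : ℕ) + 1) / q - 1 < r := by
      have := Nat.div_le_self ((j:ℕ)+1) q; omega
    have e : (⟨((j.castSucc : ℕ) + 1) / q - 1, by
      have := Nat.div_le_self ((j:ℕ)+1) q; simp; omega⟩ : Fin (r + 1))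
        = Fin.castSucc ⟨((j : ℕ) + 1) / q - 1, hj⟩ := by ext; simp
    simp only [Fin.snocEquiv, Equiv.coe_fn_mk]
    rw [e, Fin.snoc_castSucc, Fin.snoc_castSucc]
    simp
  · have e : (⟨((Fin.last r : Fin (r+1)) + 1 : ℕ) / q - 1, by
      have := Nat.div_le_self (r+1) q; simp; omega⟩ : Fin (r + 1))
        = Fin.castSucc ⟨k - 1, hkr⟩ := by
      ext; simp [h, Nat.mul_div_cancel_left k (by omega : 0 < q)]
    simp only [Fin.snocEquiv, Equiv.coe_fn_mk]
    rw [e, Fin.snoc_castSucc, Fin.snoc_last]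
    simp [h]; ring

lemma ZZ_prod (m q : ℕ) (hq : 2 ≤ q) (A : Matrix (Fin m) (Fin m) ℝ) (n r : ℕ) (hr : r ≤ n) :
    ZZ m q A n (fun _ _ => 1) = (∏ i ∈ (Finset.Ioc r n).filter (fun i => ¬ q ∣ i),
      ∑ a, ∑ b, (A ^ (Nat.log q (n / i))) a b) *
      ZZ m q A r (fun k a => if r < q * k then ∑ b, (A ^ (Nat.log q (n / k))) a b else 1) := by
  induction hd : n - r generalizing r with
  | zero =>
    obtain rfl : r = n := by omega
    simp only [Finset.Ioc_self, Finset.filter_empty, Finset.prod_empty, one_mul]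
    unfold ZZ
    refine Finset.sum_congr rfl fun u _ => Finset.prod_congr rfl fun j _ => ?_
    congr 1
    beta_reduce
    split_ifs with h
    · have : r / (j + 1) < q := by
        rw [Nat.div_lt_iff_lt_mul (by omega)]; exact h
      rw [Nat.log_of_lt this]
      simp [Matrix.one_apply]
    · rfl
  | succ d ih =>
    rw [ih (r + 1) (by omega) (by omega)]
    have hI : Finset.Ioc r n = insert (r + 1) (Finset.Ioc (r + 1) n) := by
      ext x; simp; omega
    have hni : r + 1 ∉ (Finset.Ioc (r + 1) n).filter (fun i => ¬ q ∣ i) := by simp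
    by_cases h : q ∣ r + 1
    · rw [hI, Finset.filter_insert, if_neg (by simpa using h)]
      congr 1
      obtain ⟨k, hk⟩ := h
      have hk0 : 0 < k := by rcases Nat.eq_zero_or_pos k with rfl | h' <;> omega
      apply ZZ_succ_dvd m q hq A r _ _ k hk
      · intro j hj hjk
        ext a
        have : r < q * j ↔ r + 1 < q * j := by
          constructor
          · intro h1
            rcases Nat.lt_or_ge (r+1) (q * j) with h2 | h2
            · exact h2
            · exfalso; apply hjk
              have : q * j = q * k := by omega
              exact Nat.eq_of_mul_eq_mul_left (by omega) this
          · omega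
        simp only [this]
      · intro a
        have h1 : r < q * k := by omega
        have h2 : ¬ (r + 1 < q * k) := by omega
        have h3 : r + 1 < q * (r + 1) := by nlinarith
        simp only [h1, h2, h3, if_true, if_false, one_mul]
        have h4 : Nat.log q (n / k) = Nat.log q (n / (r + 1)) + 1 := by
          rw [hk, mul_comm, ← Nat.div_div_eq_div_mul, Nat.log_div_base]
          have : 1 ≤ Nat.log q (n / k) := by
            apply Nat.le_log_of_pow_le (by omega)
            rw [Nat.le_div_iff_mul_le hk0]; simp; omega
          omega
        rw [h4, pow_succ']
        simp only [Matrix.mul_apply, Finset.mul_sum]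
        rw [Finset.sum_comm]
    · rw [hI, Finset.filter_insert, if_pos h, Finset.prod_insert hni, ZZ_succ_not _ _ _ _ _ h]
      have h3 : r + 1 < q * (r + 1) := by nlinarith
      simp only [h3, if_true]
      have : ZZ m q A r (fun k a => if r + 1 < q * k then ∑ b, (A ^ (Nat.log q (n / k))) a b else 1)
        = ZZ m q A r (fun k a => if r < q * k then ∑ b, (A ^ (Nat.log q (n / k))) a b else 1) := by
        congr 1
        ext k a
        have : r < q * k ↔ r + 1 < q * k := by
          constructor
          · intro h1
            rcases Nat.lt_or_ge (r+1) (q * k) with h2 | h2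
            · exact h2
            · exact absurd ⟨k, by omega⟩ h
          · omega
        simp only [this]
      rw [this]; ring

lemma ZZ_eq (m q : ℕ) (hq : 2 ≤ q) (A : Matrix (Fin m) (Fin m) ℝ) (n : ℕ) :
    ZZ m q A n (fun _ _ => 1) = ∏ i ∈ (Finset.Ioc 0 n).filter (fun i => ¬ q ∣ i),
      ∑ a, ∑ b, (A ^ (Nat.log q (n / i))) a b := by
  rw [ZZ_prod m q hq A n 0 (by omega)]
  simp [ZZ]

def extw {m n : ℕ} (q : ℕ) (u : Fin n → Fin m) (s : Fin m → Fin m) (d : Fin m) (k : ℕ) : Fin m :=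
  if h : k < n then u ⟨k, h⟩ else
    if h2 : q ∣ k + 1 ∧ 2 ≤ q then s (extw q u s d ((k + 1) / q - 1)) else d
termination_by k
decreasing_by
  obtain ⟨⟨c, hc⟩, hq⟩ := h2
  rw [hc, Nat.mul_div_cancel_left c (by omega)]
  have : 0 < c := by rcases Nat.eq_zero_or_pos c with rfl | h' <;> omega
  have : 2 * c ≤ q * c := Nat.mul_le_mul_right _ hq
  omega

lemma NW_eq (m : ℕ) (hm : 2 ≤ m) (q : ℕ+) (hq : 2 ≤ (q : ℕ))
    (A : Matrix (Fin m) (Fin m) ℝ)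
    (hA01 : ∀ i j, A i j = 0 ∨ A i j = 1) (hrow : ∀ i, ∃ j, A i j = 1) (n : ℕ) :
    (NWords n {x : ℕ+ → Fin m | ∀ k : ℕ+, A (x k) (x (q * k)) = 1} : ℝ) =
      ZZ m q A n (fun _ _ => 1) := by
  have hpar : ∀ j : Fin n, ((j : ℕ) + 1) / q - 1 < n := fun j => by
    have := Nat.div_le_self ((j:ℕ)+1) q; omega
  set S : Finset (Fin n → Fin m) := Finset.univ.filter (fun u => ∀ j : Fin n,
    (q : ℕ) ∣ (j : ℕ) + 1 → A (u ⟨((j : ℕ) + 1) / q - 1, hpar j⟩) (u j) = 1) with hS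
  have h1 : ZZ m q A n (fun _ _ => 1) = S.card := by
    unfold ZZ
    rw [hS, Finset.card_filter]
    push_cast
    refine Finset.sum_congr rfl fun u _ => ?_
    split_ifs with h
    · apply Finset.prod_eq_one
      intro j _
      split_ifs with h'
      · simp [h j h']
      · simp
    · push Not at h
      obtain ⟨j, hj, hne⟩ := h
      apply Finset.prod_eq_zero (Finset.mem_univ j)
      rw [if_pos hj, (hA01 _ _).resolve_right hne]; simp
  rw [h1, NWords]
  norm_cast
  rw [← Set.ncard_coe_finset S, ← Set.ncard_image_of_injective (S : Set (Fin n → Fin m))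
    (List.ofFn_injective (n := n))]
  congr 1
  ext l
  constructor
  · rintro ⟨hl, x, hx, hb⟩
    subst hl
    refine ⟨l.get, ?_, List.ofFn_get l⟩
    simp only [hS, Finset.coe_filter, Finset.mem_univ, true_and, Set.mem_ofPred_eq]
    intro j hj
    rw [← hb, ← hb]
    obtain ⟨c, hc⟩ := hj
    have hc0 : 0 < c := by rcases Nat.eq_zero_or_pos c with rfl | h' <;> omega
    have := hx ⟨c, hc0⟩
    convert this using 2
    · congr 1
      apply PNat.eq
      simp only [PNat.mk_coe, hc, Nat.mul_div_cancel_left c q.pos]; omega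
    · congr 1
      apply PNat.eq
      exact hc
  · rintro ⟨u, hu, rfl⟩
    simp only [hS, Finset.coe_filter, Finset.mem_univ, true_and, Set.mem_ofPred_eq] at hu
    refine ⟨by simp, ?_⟩
    choose s hs using hrow
    refine ⟨fun k => extw q u s ⟨0, by omega⟩ ((k : ℕ) - 1), ?_, ?_⟩
    · intro k
      have hk := k.pos
      have h2 : 2 * (k:ℕ) ≤ q * k := Nat.mul_le_mul_right _ hq
      have e : (q : ℕ) * k - 1 + 1 = q * k := by omega
      have e' : ((q : ℕ) * k - 1 + 1) / q - 1 = k - 1 := by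
        rw [e, Nat.mul_div_cancel_left _ q.pos]
      have hd : (q : ℕ) ∣ (q : ℕ) * k - 1 + 1 := by rw [e]; exact dvd_mul_right _ _
      simp only [PNat.mul_coe]
      by_cases h : (q : ℕ) * k - 1 < n
      · have := hu ⟨(q:ℕ) * k - 1, h⟩ hd
        have g : (k : ℕ) - 1 < n := by omega
        have f1 : extw (q:ℕ) u s ⟨0, by omega⟩ ((q:ℕ) * k - 1) = u ⟨(q:ℕ) * k - 1, h⟩ := by
          rw [extw, dif_pos h]
        have f2 : extw (q:ℕ) u s ⟨0, by omega⟩ ((k:ℕ) - 1) = u ⟨(k:ℕ) - 1, g⟩ := by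
          rw [extw, dif_pos g]
        rw [f1, f2]
        convert this using 3
        exact Fin.ext e'.symm
      · rw [extw.eq_def (k := (q:ℕ) * k - 1), dif_neg h, dif_pos ⟨hd, hq⟩, e']
        exact hs _
    · intro j
      have hj : (j : ℕ) < n := by simpa using j.2
      simp only [PNat.mk_coe, Nat.add_sub_cancel]
      rw [extw, dif_pos hj]
      simp

lemma divlim (d : ℕ) : Tendsto (fun n : ℕ => ((n / d : ℕ) : ℝ) / n) atTop (𝓝 (1 / d)) := by
  have h := (tendsto_nat_floor_mul_div_atTop (R := ℝ) (a := 1 / (d:ℝ)) (by positivity)).comp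
    tendsto_natCast_atTop_atTop
  refine h.congr fun n => ?_
  simp only [Function.comp]
  rw [← Nat.floor_div_eq_div (K := ℝ)]
  congr 3; ring

def DD (q M : ℕ) : ℕ := ((Finset.Ioc 0 M).filter (fun i => ¬ q ∣ i)).card

lemma DD_eq (q M : ℕ) : (DD q M : ℝ) = M - (M / q : ℕ) := by
  have h := Finset.card_filter_add_card_filter_not (s := Finset.Ioc 0 M) (fun i => q ∣ i)
  rw [Nat.Ioc_filter_dvd_card_eq_div, Nat.card_Ioc] at h
  unfold DD
  have h' := congrArg (Nat.cast : ℕ → ℝ) h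
  push_cast at h'
  simp at h'
  push_cast
  linarith

def cc (q k n : ℕ) : ℕ :=
  (((Finset.Ioc 0 n).filter (fun i => ¬ q ∣ i)).filter (fun i => Nat.log q (n / i) = k)).card

lemma cc_eq (q : ℕ) (hq : 2 ≤ q) (k n : ℕ) :
    (cc q k n : ℝ) = (DD q (n / q ^ k) : ℝ) - DD q (n / q ^ (k + 1)) := by
  have : cc q k n + DD q (n / q ^ (k + 1)) = DD q (n / q ^ k) := by
    unfold cc DD
    rw [← Finset.card_union_of_disjoint]
    · congr 1
      ext i
      have hp : 0 < q ^ k := by positivity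
      have hp' : 0 < q ^ (k+1) := by positivity
      have hkk : q ^ k ≤ q ^ (k+1) := Nat.pow_le_pow_right (by omega) (by omega)
      simp only [Finset.mem_union, Finset.mem_filter, Finset.mem_Ioc, Nat.le_div_iff_mul_le hp,
        Nat.le_div_iff_mul_le hp']
      rcases Nat.eq_zero_or_pos i with rfl | hi
      · simp
      by_cases hin : i ≤ n
      · have hne : n / i ≠ 0 := (Nat.div_pos hin hi).ne'
        rw [Nat.log_eq_iff (Or.inr ⟨by omega, hne⟩), Nat.le_div_iff_mul_le hi,
          Nat.div_lt_iff_lt_mul hi, mul_comm (q ^ k), mul_comm (q ^ (k+1))]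
        have : i * q ^ k ≤ i * q ^ (k+1) := Nat.mul_le_mul_left _ hkk
        constructor
        · rintro (⟨⟨_, h⟩, h1, h2⟩ | ⟨h1, h2⟩)
          · exact ⟨⟨hi, h1⟩, h⟩
          · exact ⟨⟨hi, by omega⟩, h2⟩
        · rintro ⟨⟨_, h1⟩, h⟩
          by_cases h3 : i * q ^ (k+1) ≤ n
          · exact Or.inr ⟨⟨hi, h3⟩, h⟩
          · exact Or.inl ⟨⟨⟨hi, hin⟩, h⟩, h1, by omega⟩
      · have h1 : i ≤ i * q ^ k := Nat.le_mul_of_pos_right _ hp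
        have h2 : i ≤ i * q ^ (k+1) := Nat.le_mul_of_pos_right _ hp'
        constructor
        · rintro (⟨⟨h, _⟩, _⟩ | ⟨h, _⟩) <;> omega
        · rintro ⟨h, _⟩; omega
    · rw [Finset.disjoint_left]
      intro i hi hi'
      simp only [Finset.mem_filter, Finset.mem_Ioc] at hi hi'
      have hi0 := hi'.1.1
      have h1 := (Nat.le_div_iff_mul_le (by positivity)).1 hi'.1.2
      have h2 : q ^ (k+1) ≤ n / i := (Nat.le_div_iff_mul_le hi0).2 (by rwa [mul_comm])
      have h3 := Nat.le_log_of_pow_le (by omega) h2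
      omega
  rw [← this]; push_cast; ring

lemma cc_le (q : ℕ) (hq : 2 ≤ q) (k n : ℕ) : (cc q k n : ℝ) ≤ n / q ^ k := by
  rw [cc_eq q hq, DD_eq]
  have h1 : ((n / q ^ k : ℕ) : ℝ) ≤ n / q ^ k := by exact_mod_cast Nat.cast_div_le
  have h2 : (0:ℝ) ≤ ((n / q ^ k / q : ℕ) : ℝ) := by positivity
  have h3 : (0:ℝ) ≤ (DD q (n / q ^ (k + 1)) : ℝ) := by positivity
  linarith

lemma cc_lim (q : ℕ) (hq : 2 ≤ q) (k : ℕ) : Tendsto (fun n : ℕ => (cc q k n : ℝ) / n) atTop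
    (𝓝 (((q : ℝ) - 1) ^ 2 / q ^ (k + 2))) := by
  have h := (((divlim (q ^ k)).sub (divlim (q ^ (k+1)))).sub (divlim (q ^ (k+1)))).add
    (divlim (q ^ (k+2)))
  have e : ((q : ℝ) - 1) ^ 2 / q ^ (k + 2) = 1 / ((q ^ k : ℕ) : ℝ) - 1 / ((q ^ (k+1) : ℕ) : ℝ)
      - 1 / ((q ^ (k+1) : ℕ) : ℝ) + 1 / ((q ^ (k+2) : ℕ) : ℝ) := by
    have : (q : ℝ) ≠ 0 := by positivity
    push_cast
    field_simp
    ring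
  rw [e]
  refine h.congr fun n => ?_
  rw [cc_eq q hq, DD_eq, DD_eq, Nat.div_div_eq_div_mul, Nat.div_div_eq_div_mul, ← pow_succ,
    ← pow_succ]
  ring

lemma sum_lim (q : ℕ) (hq : 2 ≤ q) (L : ℕ → ℝ) (hL : ∀ k, |L k| ≤ k + 1) :
    Tendsto (fun n : ℕ => (∑ i ∈ (Finset.Ioc 0 n).filter (fun i => ¬ q ∣ i),
      L (Nat.log q (n / i))) / n) atTop
      (𝓝 (((q : ℝ) - 1) ^ 2 * ∑' k : ℕ, L k / (q : ℝ) ^ (k + 2))) := by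
  have hq1 : (1:ℝ) < q := by exact_mod_cast (by omega : 1 < q)
  have e : ∀ n : ℕ, (∑ i ∈ (Finset.Ioc 0 n).filter (fun i => ¬ q ∣ i),
      L (Nat.log q (n / i))) / n = ∑' k : ℕ, L k * ((cc q k n : ℝ) / n) := by
    intro n
    rw [tsum_eq_sum (s := Finset.range (n + 1))]
    · rw [← Finset.sum_fiberwise_of_maps_to (t := Finset.range (n + 1))
        (g := fun i => Nat.log q (n / i)), Finset.sum_div]
      · refine Finset.sum_congr rfl fun k _ => ?_
        rw [Finset.sum_congr rfl (g := fun _ => L k)]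
        · rw [Finset.sum_const, nsmul_eq_mul]; unfold cc; ring
        · intro i hi; rw [(Finset.mem_filter.1 hi).2]
      · intro i hi
        rw [Finset.mem_range]
        have h1 := Nat.log_le_self q (n / i)
        have h2 := Nat.div_le_self n i
        omega
    · intro k hk
      have : cc q k n = 0 := by
        unfold cc
        rw [Finset.card_eq_zero, Finset.filter_eq_empty_iff]
        intro i hi h
        apply hk
        rw [Finset.mem_range]
        have h1 := Nat.log_le_self q (n / i)
        have h2 := Nat.div_le_self n i
        omega
      simp [this]
  rw [← tsum_mul_left]
  simp_rw [e]
  have e2 : ∀ k, ((q : ℝ) - 1) ^ 2 * (L k / (q : ℝ) ^ (k + 2)) =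
    L k * (((q : ℝ) - 1) ^ 2 / q ^ (k + 2)) := fun k => by ring
  simp_rw [e2]
  apply tendsto_tsum_of_dominated_convergence (bound := fun k : ℕ => ((k:ℝ) + 1) * (1 / (q:ℝ)) ^ k)
  · have hr : ‖(1 / (q:ℝ))‖ < 1 := by
      rw [Real.norm_of_nonneg (by positivity), div_lt_one (by positivity)]; exact hq1
    have h1 := summable_pow_mul_geometric_of_norm_lt_one 1 hr
    have h2 := summable_geometric_of_norm_lt_one hr
    refine (h1.add h2).congr fun k => ?_
    ring
  · intro k
    exact (cc_lim q hq k).const_mul _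
  · filter_upwards with n k
    rw [norm_mul, Real.norm_eq_abs, Real.norm_of_nonneg (by positivity)]
    apply mul_le_mul (hL k) _ (by positivity) (by positivity)
    have := cc_le q hq k n
    rcases Nat.eq_zero_or_pos n with rfl | hn
    · simp
    · rw [div_le_iff₀ (by positivity)]
      calc _ ≤ _ := this
        _ = _ := by rw [one_div, inv_pow]; ring

lemma row_bounds (m : ℕ) (A : Matrix (Fin m) (Fin m) ℝ)
    (hA01 : ∀ i j, A i j = 0 ∨ A i j = 1) (hrow : ∀ i, ∃ j, A i j = 1) (k : ℕ) (i : Fin m) :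
    1 ≤ ∑ j, (A ^ k) i j ∧ ∑ j, (A ^ k) i j ≤ (m:ℝ) ^ k := by
  have h0 : ∀ i j, 0 ≤ A i j := fun i j => by rcases hA01 i j with h | h <;> simp [h]
  have h1 : ∀ i j, A i j ≤ 1 := fun i j => by rcases hA01 i j with h | h <;> simp [h]
  induction k generalizing i with
  | zero => simp [Matrix.one_apply]
  | succ k ih =>
    have e : ∑ j, (A ^ (k+1)) i j = ∑ l, A i l * ∑ j, (A ^ k) l j := by
      rw [pow_succ']
      simp only [Matrix.mul_apply, Finset.mul_sum]
      rw [Finset.sum_comm]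
    rw [e]
    constructor
    · obtain ⟨l, hl⟩ := hrow i
      calc (1:ℝ) ≤ A i l * ∑ j, (A ^ k) l j := by rw [hl, one_mul]; exact (ih l).1
        _ ≤ _ := Finset.single_le_sum (f := fun l => A i l * ∑ j, (A ^ k) l j)
          (fun l _ => mul_nonneg (h0 i l) (by linarith [(ih l).1])) (Finset.mem_univ l)
    · calc ∑ l, A i l * ∑ j, (A ^ k) l j ≤ ∑ l : Fin m, (m:ℝ) ^ k := by
            refine Finset.sum_le_sum fun l _ => ?_
            calc _ ≤ 1 * (m:ℝ) ^ k := mul_le_mul (h1 i l) (ih l).2 (by linarith [(ih l).1]) (by norm_num)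
              _ = _ := one_mul _
        _ = _ := by simp [pow_succ']

/-- **Theorem 1.3 (ii), first part.** The Minkowski dimension of `X_A` exists and equals
`(q-1)² Σ_{k≥1} log_m ⟨A^{k-1} 𝟙, 𝟙⟩ / q^{k+1}`. -/
theorem stmt2 (m : ℕ) (hm : 2 ≤ m) (q : ℕ+) (hq : 2 ≤ (q : ℕ))
    (A : Matrix (Fin m) (Fin m) ℝ)
    (hA01 : ∀ i j, A i j = 0 ∨ A i j = 1)
    (hAprim : ∃ n : ℕ, ∀ i j, 0 < (A ^ n) i j) :
    Tendsto
      (fun n : ℕ =>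
        Real.logb m (NWords n {x : ℕ+ → Fin m | ∀ k : ℕ+, A (x k) (x (q * k)) = 1}) / n)
      atTop
      (𝓝 (((q : ℝ) - 1) ^ 2 *
        ∑' k : ℕ, Real.logb m (∑ i, ∑ j, (A ^ k) i j) / (q : ℝ) ^ (k + 2))) := by
  have hm1 : (1:ℝ) < m := by exact_mod_cast (by omega : 1 < m)
  have hrow : ∀ i, ∃ j, A i j = 1 := by
    intro i
    by_contra hcon
    push Not at hcon
    have hz : ∀ j, A i j = 0 := fun j => (hA01 i j).resolve_right (hcon j)
    obtain ⟨n, hn⟩ := hAprim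
    rcases n with _ | n
    · have h1 := hn ⟨0, by omega⟩ ⟨1, by omega⟩
      simp [Matrix.one_apply] at h1
    · have := hn i i
      rw [pow_succ', Matrix.mul_apply] at this
      simp [hz] at this
  have hb : ∀ k, 1 ≤ ∑ i, ∑ j, (A ^ k) i j ∧ ∑ i, ∑ j, (A ^ k) i j ≤ (m:ℝ) ^ (k + 1) := by
    intro k
    have h := row_bounds m A hA01 hrow k
    constructor
    · calc (1:ℝ) ≤ ∑ j, (A ^ k) ⟨0, by omega⟩ j := (h _).1
        _ ≤ _ := Finset.single_le_sum (f := fun i => ∑ j, (A ^ k) i j)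
          (fun l _ => by linarith [(h l).1]) (Finset.mem_univ _)
    · calc _ ≤ ∑ l : Fin m, (m:ℝ) ^ k := Finset.sum_le_sum fun l _ => (h l).2
        _ = _ := by simp [pow_succ']
  have hlim := sum_lim q hq (fun k => Real.logb m (∑ i, ∑ j, (A ^ k) i j)) (by
    intro k
    rw [abs_of_nonneg (Real.logb_nonneg hm1 (hb k).1)]
    rw [Real.logb_le_iff_le_rpow hm1 (by linarith [(hb k).1])]
    exact_mod_cast (hb k).2)
  refine hlim.congr fun n => ?_
  rw [NW_eq m hm q hq A hA01 hrow n, ZZ_eq m q hq A n, Real.logb_prod]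
  intro i _
  linarith [(hb (Nat.log q (n / i))).1]
end
end

section
/- Let m ≥ 2, let q ≥ 2 be an integer, and let A be a primitive m×m 0-1 matrix. Then the Hausdorff dimension of Ξ_A equals the Minkowski dimension of X_A if and only if all row sums of A are equal (equivalently, the all-ones vector 𝟙 is an eigenvector of A). -/
open scoped Classical ENNReal
open Filter MeasureTheory Topology

noncomputable section

namespace MS

/-- words of length `n` (as functions vanishing outside `[1,n]`). -/
def W {m : ℕ} [NeZero m] (q : ℕ) (A : Matrix (Fin m) (Fin m) ℝ) : ℕ → Finset (ℕ → Fin m)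
  | 0 => {fun _ => 0}
  | n + 1 => (((W q A n) ×ˢ (Finset.univ : Finset (Fin m))).filter
      (fun p => q ∣ n + 1 → A (p.1 ((n + 1) / q)) p.2 = 1)).image
      (fun p => Function.update p.1 (n + 1) p.2)

lemma W_supp {m : ℕ} [NeZero m] {q : ℕ} {A : Matrix (Fin m) (Fin m) ℝ} {n : ℕ} :
    ∀ {x : ℕ → Fin m}, x ∈ W q A n → ∀ k, (k = 0 ∨ n < k) → x k = 0 := by
  induction n with
  | zero => intro x hx k _; simp [W] at hx; simp [hx]
  | succ n ih =>
    intro x hx k hk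
    simp only [W, Finset.mem_image, Finset.mem_filter, Finset.mem_product] at hx
    obtain ⟨⟨y, a⟩, ⟨⟨hy, _⟩, _⟩, rfl⟩ := hx
    rw [Function.update_of_ne (by omega)]
    exact ih hy k (by omega)

lemma sum_W_succ {m : ℕ} [NeZero m] {q : ℕ} {A : Matrix (Fin m) (Fin m) ℝ} {n : ℕ}
    (f : (ℕ → Fin m) → ℝ) :
    ∑ w ∈ W q A (n + 1), f w = ∑ w ∈ W q A n, ∑ a : Fin m,
      if (q ∣ n + 1 → A (w ((n + 1) / q)) a = 1) then f (Function.update w (n + 1) a) else 0 := by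
  rw [W, Finset.sum_image, Finset.sum_filter, Finset.sum_product]
  rintro ⟨x, a⟩ hx ⟨y, b⟩ hy h
  simp only [Finset.coe_filter, Finset.mem_product, Set.mem_ofPred_eq] at hx hy
  simp only at h
  have hab : a = b := by
    have := congrFun h (n + 1)
    simpa using this
  have hxy : x = y := by
    funext k
    by_cases hk : k = n + 1
    · rw [W_supp hx.1.1 k (by omega), W_supp hy.1.1 k (by omega)]
    · have := congrFun h k
      simpa [Function.update_of_ne hk] using this
  rw [hab, hxy]

lemma mem_W {m : ℕ} [NeZero m] {q : ℕ} (hq : 2 ≤ q) {A : Matrix (Fin m) (Fin m) ℝ} {n : ℕ} :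
    ∀ {x : ℕ → Fin m}, x ∈ W q A n ↔ (∀ k, (k = 0 ∨ n < k) → x k = 0) ∧
      ∀ k, 1 ≤ k → q * k ≤ n → A (x k) (x (q * k)) = 1 := by
  induction n with
  | zero =>
    intro x
    simp only [W, Finset.mem_singleton]
    constructor
    · rintro rfl
      refine ⟨fun _ _ => rfl, fun k hk hk' => ?_⟩
      have : 1 ≤ q * k := Nat.one_le_iff_ne_zero.2 (by positivity)
      omega
    · rintro ⟨h, -⟩
      funext k
      exact h k (by omega)
  | succ n ih =>
    intro x
    constructor
    · intro hx
      refine ⟨W_supp hx, fun k hk hkn => ?_⟩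
      simp only [W, Finset.mem_image, Finset.mem_filter, Finset.mem_product] at hx
      obtain ⟨⟨y, a⟩, ⟨⟨hy, _⟩, hA⟩, rfl⟩ := hx
      have hlt : k < q * k := by nlinarith
      simp only at hA ⊢
      rw [Function.update_of_ne (by omega)]
      by_cases he : q * k = n + 1
      · have h1 := hA ⟨k, he.symm⟩
        rw [← he, Nat.mul_div_cancel_left _ (by omega)] at h1
        rw [he, Function.update_self]
        exact h1
      · rw [Function.update_of_ne he]
        exact (ih.1 hy).2 k hk (by omega)
    · rintro ⟨h0, h1⟩
      simp only [W, Finset.mem_image, Finset.mem_filter, Finset.mem_product]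
      refine ⟨(Function.update x (n + 1) 0, x (n + 1)), ⟨⟨ih.2 ⟨?_, ?_⟩, Finset.mem_univ _⟩, ?_⟩, ?_⟩
      · intro k hk
        dsimp only
        by_cases hk1 : k = n + 1
        · simp [hk1]
        · rw [Function.update_of_ne hk1]; exact h0 k (by omega)
      · intro k hk hkn
        have hlt : k < q * k := by nlinarith
        dsimp only
        rw [Function.update_of_ne (by omega), Function.update_of_ne (by omega)]
        exact h1 k hk (by omega)
      · rintro ⟨k, hk⟩
        have hk1 : 1 ≤ k := by
          rcases Nat.eq_zero_or_pos k with h | h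
          · subst h; simp at hk
          · exact h
        have hlt : k < q * k := by nlinarith
        simp only
        rw [hk, Nat.mul_div_cancel_left _ (by omega), Function.update_of_ne (by omega)]
        exact h1 k hk1 (by omega)
      · simp

/-- dependence on the coordinates `≤ n` only -/
def Dep {m : ℕ} (n : ℕ) (g : (ℕ → Fin m) → ℝ) : Prop :=
  ∀ x y : ℕ → Fin m, (∀ k ≤ n, x k = y k) → g x = g y

lemma Dep.upd {m : ℕ} {n : ℕ} {g : (ℕ → Fin m) → ℝ} (h : Dep n g) (x : ℕ → Fin m) (k : ℕ)
    (hk : n < k) (a : Fin m) : g (Function.update x k a) = g x := by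
  apply h
  intro j hj
  rw [Function.update_of_ne (by omega)]

lemma Dep.mono {m : ℕ} {n n' : ℕ} {g : (ℕ → Fin m) → ℝ} (h : Dep n g) (hn : n ≤ n') : Dep n' g :=
  fun x y hxy => h x y fun k hk => hxy k (hk.trans hn)

lemma Dep.mul {m : ℕ} {n : ℕ} {g f : (ℕ → Fin m) → ℝ} (hg : Dep n g) (hf : Dep n f) :
    Dep n (fun x => g x * f x) := fun x y hxy => by
  simp only [hg x y hxy, hf x y hxy]

lemma dep_coord {m : ℕ} {n k : ℕ} (hk : k ≤ n) (h : Fin m → ℝ) : Dep n (fun x => h (x k)) :=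
  fun x y hxy => by simp only [hxy k hk]

lemma dep_prod {m : ℕ} {n : ℕ} {s : Finset ℕ} (hk : ∀ k ∈ s, k ≤ n) (h : Fin m → ℝ) :
    Dep n (fun x => ∏ k ∈ s, h (x k)) :=
  fun x y hxy => Finset.prod_congr rfl fun k hks => by rw [hxy k (hk k hks)]

lemma sum_step_free {m : ℕ} [NeZero m] {q : ℕ} {A : Matrix (Fin m) (Fin m) ℝ} {n : ℕ}
    (hn : ¬ q ∣ n + 1) {g : (ℕ → Fin m) → ℝ} (hg : Dep n g) (h : Fin m → ℝ) :
    ∑ w ∈ W q A (n + 1), g w * h (w (n + 1)) = (∑ a, h a) * ∑ w ∈ W q A n, g w := by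
  rw [sum_W_succ, Finset.mul_sum]
  refine Finset.sum_congr rfl fun w _ => ?_
  rw [Finset.sum_mul]
  refine Finset.sum_congr rfl fun a _ => ?_
  rw [if_pos (fun h' => absurd h' hn), hg.upd _ _ (by omega), Function.update_self, mul_comm]

lemma sum_step_mul {m : ℕ} [NeZero m] {q : ℕ} {A : Matrix (Fin m) (Fin m) ℝ} {n : ℕ}
    (hA01 : ∀ i j, A i j = 0 ∨ A i j = 1)
    (hn : q ∣ n + 1) {g : (ℕ → Fin m) → ℝ} (hg : Dep n g) (h : Fin m → ℝ) :
    ∑ w ∈ W q A (n + 1), g w * h (w (n + 1)) =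
      ∑ w ∈ W q A n, g w * (∑ a, A (w ((n + 1) / q)) a * h a) := by
  rw [sum_W_succ]
  refine Finset.sum_congr rfl fun w _ => ?_
  rw [Finset.mul_sum]
  refine Finset.sum_congr rfl fun a _ => ?_
  rw [hg.upd _ _ (by omega), Function.update_self]
  rcases hA01 (w ((n + 1) / q)) a with h' | h' <;> simp [h', hn]

/-- Summing out the positions in `(M, N]`, where `N / q ≤ M`. -/
lemma sum_out {m : ℕ} [NeZero m] {q : ℕ} (hq : 2 ≤ q) {A : Matrix (Fin m) (Fin m) ℝ}
    (hA01 : ∀ i j, A i j = 0 ∨ A i j = 1) (h : Fin m → ℝ) (M r : ℕ) :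
    ∀ {g : (ℕ → Fin m) → ℝ}, Dep M g → (M + r) / q ≤ M →
    ∃ c : ℕ, c + ((M + r) / q - M / q) = r ∧
    ∑ w ∈ W q A (M + r), g w * ∏ k ∈ Finset.Ioc M (M + r), h (w k) =
      (∑ a, h a) ^ c * ∑ w ∈ W q A M, g w *
        ∏ k ∈ Finset.Ioc (M / q) ((M + r) / q), (∑ a, A (w k) a * h a) := by
  induction r with
  | zero => intro g hg _; exact ⟨0, by simp, by simp⟩
  | succ r ih =>
    intro g hg hr
    have hq0 : 0 < q := by omega
    have e1 : Finset.Ioc M (M + (r + 1)) = insert (M + r + 1) (Finset.Ioc M (M + r)) := by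
      ext k; simp only [Finset.mem_Ioc, Finset.mem_insert]; omega
    have e1' : ∀ w : ℕ → Fin m, g w * ∏ k ∈ Finset.Ioc M (M + (r + 1)), h (w k) =
        (g w * ∏ k ∈ Finset.Ioc M (M + r), h (w k)) * h (w (M + r + 1)) := by
      intro w
      rw [e1, Finset.prod_insert (by simp), mul_comm (h _), mul_assoc]
    have hd : Dep (M + r) (fun w => g w * ∏ k ∈ Finset.Ioc M (M + r), h (w k)) :=
      (hg.mono (by omega)).mul (dep_prod (fun k hk => (Finset.mem_Ioc.1 hk).2) h)
    simp_rw [e1']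
    have hmono : M / q ≤ (M + r) / q := Nat.div_le_div_right (by omega)
    rw [← add_assoc] at hr ⊢
    by_cases hdv : q ∣ M + r + 1
    · rw [sum_step_mul hA01 hdv hd]
      have hdiv : (M + r + 1) / q = (M + r) / q + 1 := Nat.succ_div_of_dvd hdv
      obtain ⟨c, hc, hs⟩ := ih (g := fun w => g w * (∑ a, A (w ((M + r + 1) / q)) a * h a))
        (hg.mul (dep_coord hr (fun i => ∑ a, A i a * h a))) (by omega)
      refine ⟨c, by omega, ?_⟩
      have e2 : Finset.Ioc (M / q) ((M + r + 1) / q) =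
          insert ((M + r + 1) / q) (Finset.Ioc (M / q) ((M + r) / q)) := by
        ext k; simp only [Finset.mem_Ioc, Finset.mem_insert]; omega
      have e2n : (M + r + 1) / q ∉ Finset.Ioc (M / q) ((M + r) / q) := by
        simp only [Finset.mem_Ioc]; omega
      simp_rw [e2, Finset.prod_insert e2n, ← mul_assoc (g _)]
      rw [← hs]
      refine Finset.sum_congr rfl fun w _ => by ring
    · rw [sum_step_free hdv hd]
      have hdiv : (M + r + 1) / q = (M + r) / q := Nat.succ_div_of_not_dvd hdv
      obtain ⟨c, hc, hs⟩ := ih hg (by omega)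
      refine ⟨c + 1, by omega, ?_⟩
      rw [hs, hdiv, pow_succ]
      ring

end MS

namespace MS

lemma holder_pow {ι : Type*} (s : Finset ι) (w f : ι → ℝ) (hw : ∀ i ∈ s, 0 ≤ w i)
    (hf : ∀ i ∈ s, 0 ≤ f i) (q : ℕ) :
    (∑ i ∈ s, w i * f i) ^ (q + 1) ≤ (∑ i ∈ s, w i) ^ q * ∑ i ∈ s, w i * f i ^ (q + 1) := by
  rcases (Finset.sum_nonneg hw).eq_or_lt with h | h
  · have h0 : ∀ i ∈ s, w i = 0 := (Finset.sum_eq_zero_iff_of_nonneg hw).1 h.symm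
    rw [Finset.sum_congr rfl (g := fun _ => (0 : ℝ)) fun i hi => by rw [h0 i hi, zero_mul],
      Finset.sum_congr rfl (g := fun _ => (0 : ℝ)) (f := fun i => w i * f i ^ (q + 1))
        fun i hi => by rw [h0 i hi, zero_mul]]
    simp
  · set S := ∑ i ∈ s, w i with hS
    have h1 := Real.pow_arith_mean_le_arith_mean_pow s (fun i => w i / S) f
      (fun i hi => div_nonneg (hw i hi) h.le)
      (by rw [← Finset.sum_div, ← hS, div_self h.ne']) hf (q + 1)
    simp_rw [div_mul_eq_mul_div] at h1
    rw [← Finset.sum_div, ← Finset.sum_div, div_pow, div_le_div_iff₀ (by positivity) h] at h1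
    refine le_of_mul_le_mul_right (h1.trans (le_of_eq ?_)) h
    rw [pow_succ]; ring

lemma strict_pow {m : ℕ} [NeZero m] {q : ℕ} (hq : 2 ≤ q) {t : Fin m → ℝ} (ht : ∀ i, 0 ≤ t i)
    {i j : Fin m} (hij : t i ≠ t j) :
    (∑ a, t a) ^ q < (m : ℝ) ^ (q - 1) * ∑ a, t a ^ q := by
  have hm : (0 : ℝ) < m := by exact_mod_cast NeZero.pos m
  have h := (strictConvexOn_pow hq).map_sum_lt (t := Finset.univ) (w := fun _ : Fin m => (m : ℝ)⁻¹)
    (p := t) (fun _ _ => by positivity) (by simp [hm.ne']) (fun i _ => ht i)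
    ⟨i, Finset.mem_univ _, j, Finset.mem_univ _, hij⟩
  simp only [smul_eq_mul] at h
  rw [← Finset.mul_sum, ← Finset.mul_sum, mul_pow] at h
  have h2 := mul_lt_mul_of_pos_left h (pow_pos hm q)
  rw [← mul_assoc, ← mul_pow, mul_inv_cancel₀ hm.ne', one_pow, one_mul, ← mul_assoc] at h2
  obtain ⟨p, rfl⟩ : ∃ p, q = p + 1 := ⟨q - 1, by omega⟩
  rwa [pow_succ (m : ℝ), mul_assoc (_ ^ p), mul_inv_cancel₀ hm.ne', mul_one] at h2

/-- existence of the solution of `t_i^q = ∑ A_ij t_j`. -/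
lemma exists_t {m : ℕ} {q : ℕ} (hq : 2 ≤ q) {A : Matrix (Fin m) (Fin m) ℝ}
    (hA01 : ∀ i j, A i j = 0 ∨ A i j = 1) (hrow : ∀ i, ∃ j, A i j = 1) (hm : 1 ≤ m) :
    ∃ t : Fin m → ℝ, (∀ i, 1 ≤ t i) ∧ ∀ i, t i ^ q = ∑ j, A i j * t j := by
  have hA0 : ∀ i j, 0 ≤ A i j := fun i j => by rcases hA01 i j with h | h <;> simp [h]
  have hA1 : ∀ i j, A i j ≤ 1 := fun i j => by rcases hA01 i j with h | h <;> simp [h]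
  have hq0 : q ≠ 0 := by omega
  have hqi : (0 : ℝ) ≤ (q : ℝ)⁻¹ := by positivity
  let Φ : (Fin m → ℝ) → (Fin m → ℝ) := fun t i => (∑ j, A i j * t j) ^ ((q : ℝ)⁻¹)
  have hmono : ∀ s t : Fin m → ℝ, (∀ i, 0 ≤ s i) → (∀ i, s i ≤ t i) → ∀ i, Φ s i ≤ Φ t i := by
    intro s t hs hst i
    refine Real.rpow_le_rpow (Finset.sum_nonneg fun j _ => mul_nonneg (hA0 i j) (hs j)) ?_ hqi
    exact Finset.sum_le_sum fun j _ => mul_le_mul_of_nonneg_left (hst j) (hA0 i j)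
  let T : ℕ → Fin m → ℝ := fun n => Φ^[n] (fun _ => 1)
  have hT : ∀ n, T (n + 1) = Φ (T n) := fun n => Function.iterate_succ_apply' Φ n _
  have h1 : ∀ n i, 1 ≤ T n i := by
    intro n
    induction n with
    | zero => intro i; exact le_refl _
    | succ n ih =>
      intro i
      rw [hT]
      obtain ⟨j, hj⟩ := hrow i
      refine Real.one_le_rpow ?_ hqi
      calc (1 : ℝ) ≤ A i j * T n j := by rw [hj, one_mul]; exact ih j
        _ ≤ _ := Finset.single_le_sum (f := fun j => A i j * T n j)
          (fun j _ => mul_nonneg (hA0 i j) (zero_le_one.trans (ih j))) (Finset.mem_univ j)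
  have hmT : ∀ n i, T n i ≤ T (n + 1) i := by
    intro n
    induction n with
    | zero => intro i; exact h1 1 i
    | succ n ih =>
      intro i
      rw [hT, hT (n + 1)]
      exact hmono _ _ (fun i => zero_le_one.trans (h1 n i)) ih i
  have hm1 : (1 : ℝ) ≤ m := by exact_mod_cast hm
  have hbd : ∀ n i, T n i ≤ m := by
    intro n
    induction n with
    | zero => intro i; exact hm1
    | succ n ih =>
      intro i
      rw [hT]
      have : ∑ j, A i j * T n j ≤ (m : ℝ) ^ q := by
        calc ∑ j, A i j * T n j ≤ ∑ j : Fin m, (m : ℝ) := Finset.sum_le_sum fun j _ => by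
              calc A i j * T n j ≤ 1 * T n j :=
                    mul_le_mul_of_nonneg_right (hA1 i j) (zero_le_one.trans (h1 n j))
                _ ≤ m := by rw [one_mul]; exact ih j
          _ = (m : ℝ) ^ 2 := by simp [sq]
          _ ≤ (m : ℝ) ^ q := pow_le_pow_right₀ hm1 hq
      calc Φ (T n) i ≤ ((m : ℝ) ^ q) ^ ((q : ℝ)⁻¹) := Real.rpow_le_rpow
            (Finset.sum_nonneg fun j _ => mul_nonneg (hA0 i j) (zero_le_one.trans (h1 n j))) this hqi
        _ = m := Real.pow_rpow_inv_natCast (by positivity) hq0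
  have hlim : ∀ i, Tendsto (fun n => T n i) atTop (𝓝 (⨆ n, T n i)) := fun i =>
    tendsto_atTop_ciSup (monotone_nat_of_le_succ fun n => hmT n i)
      ⟨m, by rintro _ ⟨n, rfl⟩; exact hbd n i⟩
  refine ⟨fun i => ⨆ n, T n i, fun i => ge_of_tendsto' (hlim i) fun n => h1 n i, fun i => ?_⟩
  have l1 : Tendsto (fun n => T (n + 1) i ^ q) atTop (𝓝 ((⨆ n, T n i) ^ q)) :=
    ((tendsto_add_atTop_iff_nat 1).2 (hlim i)).pow q
  have l2 : Tendsto (fun n => ∑ j, A i j * T n j) atTop (𝓝 (∑ j, A i j * ⨆ n, T n j)) :=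
    tendsto_finsetSum _ fun j _ => (hlim j).const_mul _
  refine tendsto_nhds_unique l1 (l2.congr fun n => ?_)
  rw [hT]
  exact (Real.rpow_inv_natCast_pow
    (Finset.sum_nonneg fun j _ => mul_nonneg (hA0 i j) (zero_le_one.trans (h1 n j))) hq0).symm

lemma freq_of_bdd {f : ℕ → ℝ} {B : ℝ} (hB : ∀ n, f n ≤ B) {ε : ℝ} (hε : 0 < ε) :
    ∃ᶠ n in atTop, f (n + 1) - f n ≤ ε := by
  intro h
  rw [eventually_atTop] at h
  obtain ⟨N, hN⟩ := h
  have h2 : ∀ k : ℕ, f N + k * ε ≤ f (N + k) := by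
    intro k
    induction k with
    | zero => simp
    | succ k ih =>
      have := hN (N + k) (by omega)
      push Not at this
      push_cast
      rw [← add_assoc]
      linarith
  obtain ⟨k, hk⟩ := exists_nat_gt ((B - f N) / ε)
  rw [div_lt_iff₀ hε] at hk
  linarith [h2 k, hB (N + k)]

end MS

namespace MS

lemma card_W_le {m : ℕ} [NeZero m] {q : ℕ} {A : Matrix (Fin m) (Fin m) ℝ} (n : ℕ) :
    (W q A n).card ≤ m ^ n := by
  induction n with
  | zero => simp [W]
  | succ n ih =>
    rw [W]
    refine Finset.card_image_le.trans ((Finset.card_filter_le _ _).trans ?_)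
    rw [Finset.card_product, Finset.card_univ, Fintype.card_fin, pow_succ]
    exact Nat.mul_le_mul_right _ ih

lemma W_nonempty {m : ℕ} [NeZero m] {q : ℕ} {A : Matrix (Fin m) (Fin m) ℝ}
    (hrow : ∀ i, ∃ j, A i j = 1) (n : ℕ) : (W q A n).Nonempty := by
  induction n with
  | zero => simp [W]
  | succ n ih =>
    obtain ⟨x, hx⟩ := ih
    obtain ⟨j, hj⟩ := hrow (x ((n + 1) / q))
    rw [W]
    refine Finset.Nonempty.image ⟨(x, j), ?_⟩ _
    simp [hx, hj]

lemma sum_out' {m : ℕ} [NeZero m] {q : ℕ} (hq : 2 ≤ q) {A : Matrix (Fin m) (Fin m) ℝ}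
    (hA01 : ∀ i j, A i j = 0 ∨ A i j = 1) (h : Fin m → ℝ) (K : ℕ) :
    ∑ w ∈ W q A (q * (q * K)), ∏ k ∈ Finset.Ioc (q * K) (q * (q * K)), h (w k) =
      (∑ a, h a) ^ ((q - 1) ^ 2 * K) * ∑ w ∈ W q A (q * K),
        ∏ k ∈ Finset.Ioc K (q * K), (∑ a, A (w k) a * h a) := by
  obtain ⟨p, rfl⟩ : ∃ p, q = p + 1 := ⟨q - 1, by omega⟩
  have e : (p + 1) * ((p + 1) * K) = (p + 1) * K + p * ((p + 1) * K) := by ring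
  have hd : ((p + 1) * K + p * ((p + 1) * K)) / (p + 1) = (p + 1) * K := by
    rw [← e, Nat.mul_div_cancel_left _ (by omega)]
  have hd' : ((p + 1) * K) / (p + 1) = K := Nat.mul_div_cancel_left _ (by omega)
  obtain ⟨c, hc, hs⟩ := sum_out hq hA01 h ((p + 1) * K) (p * ((p + 1) * K))
    (g := fun _ => 1) (fun _ _ _ => rfl) (by rw [hd])
  rw [hd, hd'] at hc hs
  simp only [one_mul] at hs
  rw [← e] at hs
  have hcc : c = (p + 1 - 1) ^ 2 * K := by
    have h1 : (p + 1) * K - K = p * K := by rw [add_mul, one_mul, Nat.add_sub_cancel]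
    rw [h1] at hc
    have h2 : p * ((p + 1) * K) = p ^ 2 * K + p * K := by ring
    rw [Nat.add_sub_cancel]; omega
  rw [hs, hcc]

/-- partition-like function -/
def F {m : ℕ} [NeZero m] (q : ℕ) (A : Matrix (Fin m) (Fin m) ℝ) (t : Fin m → ℝ) (K : ℕ) : ℝ :=
  ∑ w ∈ W q A (q * K), ∏ k ∈ Finset.Ioc K (q * K), t (w k)

lemma F_pos {m : ℕ} [NeZero m] {q : ℕ} {A : Matrix (Fin m) (Fin m) ℝ}
    (hrow : ∀ i, ∃ j, A i j = 1) {t : Fin m → ℝ} (ht : ∀ i, 0 < t i) (K : ℕ) : 0 < F q A t K :=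
  Finset.sum_pos (fun _ _ => Finset.prod_pos fun _ _ => ht _) (W_nonempty hrow _)

lemma F_step {m : ℕ} [NeZero m] {q : ℕ} (hq : 2 ≤ q) {A : Matrix (Fin m) (Fin m) ℝ}
    (hA01 : ∀ i j, A i j = 0 ∨ A i j = 1) (hrow : ∀ i, ∃ j, A i j = 1)
    {t : Fin m → ℝ} (ht : ∀ i, 1 ≤ t i) (hte : ∀ i, t i ^ q = ∑ j, A i j * t j) (K : ℕ) :
    (F q A t (q * K)) ^ q * (((m : ℝ) ^ (q - 1) * ∑ a, t a ^ q) / (∑ a, t a) ^ q) ^ ((q - 1) ^ 2 * K)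
      * (∑ a, t a) ^ ((q - 1) ^ 2 * (q * K)) ≤
    ((W q A (q * (q * K))).card : ℝ) ^ (q - 1) * F q A t (q * (q * K)) := by
  have hm : (0 : ℝ) < m := by exact_mod_cast NeZero.pos m
  have hA0 : ∀ i j, 0 ≤ A i j := fun i j => by rcases hA01 i j with h | h <;> simp [h]
  have ht0 : ∀ i, 0 < t i := fun i => zero_lt_one.trans_le (ht i)
  have hT : 0 < ∑ a, t a := Finset.sum_pos (fun a _ => ht0 a) ⟨0, Finset.mem_univ _⟩
  have hTq : 0 < ∑ a, t a ^ q := Finset.sum_pos (fun a _ => pow_pos (ht0 a) q) ⟨0, Finset.mem_univ _⟩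
  have hA1 : ∀ i, 0 < ∑ a, A i a := fun i => by
    obtain ⟨j, hj⟩ := hrow i
    exact Finset.sum_pos' (fun a _ => hA0 i a) ⟨j, Finset.mem_univ _, by rw [hj]; norm_num⟩
  set c := (q - 1) ^ 2 * K with hc
  set T := ∑ a, t a with hTdef
  set U := ∑ a, t a ^ q with hU
  set S1 := ∑ w ∈ W q A (q * K), ∏ k ∈ Finset.Ioc K (q * K), (∑ a, A (w k) a) with hS1
  set S2 := ∑ w ∈ W q A (q * K), ∏ k ∈ Finset.Ioc K (q * K), (∑ a, A (w k) a * t a) with hS2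
  set S3 := ∑ w ∈ W q A (q * K), ∏ k ∈ Finset.Ioc K (q * K), (∑ a, A (w k) a * t a ^ q) with hS3
  have e1 : F q A t (q * K) = T ^ c * S2 := sum_out' hq hA01 t K
  have e2 : ((W q A (q * (q * K))).card : ℝ) = (m : ℝ) ^ c * S1 := by
    have := sum_out' hq hA01 (fun _ => 1) K
    simpa using this
  have e3 : F q A t (q * (q * K)) = T ^ ((q - 1) ^ 2 * (q * K)) * (U ^ c * S3) := by
    rw [F, sum_out' hq hA01 t (q * K)]
    simp_rw [← hte]
    rw [sum_out' hq hA01 (fun a => t a ^ q) K]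
  have key : S2 ^ q ≤ S1 ^ (q - 1) * S3 := by
    obtain ⟨p, rfl⟩ : ∃ p, q = p + 1 := ⟨q - 1, by omega⟩
    have hH := holder_pow (W (p + 1) A ((p + 1) * K))
      (fun w => ∏ k ∈ Finset.Ioc K ((p + 1) * K), (∑ a, A (w k) a))
      (fun w => ∏ k ∈ Finset.Ioc K ((p + 1) * K), ((∑ a, A (w k) a * t a) / ∑ a, A (w k) a))
      (fun w _ => Finset.prod_nonneg fun k _ => (hA1 _).le)
      (fun w _ => Finset.prod_nonneg fun k _ => div_nonneg
        (Finset.sum_nonneg fun a _ => mul_nonneg (hA0 _ _) (ht0 a).le) (hA1 _).le) p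
    have h2 : ∀ w : ℕ → Fin m, (∏ k ∈ Finset.Ioc K ((p + 1) * K), (∑ a, A (w k) a)) *
        (∏ k ∈ Finset.Ioc K ((p + 1) * K), ((∑ a, A (w k) a * t a) / ∑ a, A (w k) a)) =
        ∏ k ∈ Finset.Ioc K ((p + 1) * K), (∑ a, A (w k) a * t a) := by
      intro w
      rw [← Finset.prod_mul_distrib]
      exact Finset.prod_congr rfl fun k _ => mul_div_cancel₀ _ (hA1 _).ne'
    simp_rw [h2] at hH
    refine hH.trans ?_
    rw [Nat.add_sub_cancel]
    refine mul_le_mul_of_nonneg_left ?_ (pow_nonneg (Finset.sum_nonneg fun w _ =>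
      Finset.prod_nonneg fun k _ => (hA1 _).le) _)
    refine Finset.sum_le_sum fun w _ => ?_
    rw [← Finset.prod_pow, ← Finset.prod_mul_distrib]
    refine Finset.prod_le_prod (fun k _ => mul_nonneg (hA1 _).le (pow_nonneg (div_nonneg
        (Finset.sum_nonneg fun a _ => mul_nonneg (hA0 _ _) (ht0 a).le) (hA1 _).le) _))
      fun k _ => ?_
    have h3 := holder_pow Finset.univ (fun a => A (w k) a) t (fun a _ => hA0 _ a)
      (fun a _ => (ht0 a).le) p
    rw [div_pow, mul_div_assoc', div_le_iff₀ (pow_pos (hA1 _) _)]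
    calc _ ≤ (∑ a, A (w k) a) * ((∑ a, A (w k) a) ^ p * ∑ a, A (w k) a * t a ^ (p + 1)) :=
          mul_le_mul_of_nonneg_left h3 (hA1 _).le
      _ = _ := by ring
  rw [e1, e2, e3]
  calc (T ^ c * S2) ^ q * ((m : ℝ) ^ (q - 1) * U / T ^ q) ^ c * T ^ ((q - 1) ^ 2 * (q * K))
      = S2 ^ q * ((m : ℝ) ^ (q - 1) * U) ^ c * T ^ ((q - 1) ^ 2 * (q * K)) := by
        rw [mul_pow, div_pow, ← pow_mul, ← pow_mul, mul_comm c q]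
        field_simp
    _ ≤ (S1 ^ (q - 1) * S3) * ((m : ℝ) ^ (q - 1) * U) ^ c * T ^ ((q - 1) ^ 2 * (q * K)) := by
        gcongr
    _ = _ := by
        rw [mul_pow, mul_pow, ← pow_mul, ← pow_mul, mul_comm c (q - 1)]
        ring

lemma strict_dim {m : ℕ} [NeZero m] {q : ℕ} (hq : 2 ≤ q) {A : Matrix (Fin m) (Fin m) ℝ}
    (hA01 : ∀ i j, A i j = 0 ∨ A i j = 1) (hrow : ∀ i, ∃ j, A i j = 1)
    {t : Fin m → ℝ} (ht : ∀ i, 1 ≤ t i) (hte : ∀ i, t i ^ q = ∑ j, A i j * t j)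
    {i j : Fin m} (hij : t i ≠ t j) {D : ℝ}
    (hD : Tendsto (fun n : ℕ => Real.log (W q A n).card / n) atTop (𝓝 D)) :
    (1 - 1 / (q : ℝ)) * Real.log (∑ a, t a) < D := by
  have hm : (0 : ℝ) < m := by exact_mod_cast NeZero.pos m
  have hm1 : (1 : ℝ) ≤ m := by exact_mod_cast NeZero.pos m
  have hq0 : (0 : ℝ) < q := by positivity
  have hq1 : (0 : ℝ) < (q : ℝ) - 1 := by
    have : (2 : ℝ) ≤ q := by exact_mod_cast hq
    linarith
  have hqc : ((q - 1 : ℕ) : ℝ) = (q : ℝ) - 1 := by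
    rw [Nat.cast_sub (by omega)]; simp
  have ht0 : ∀ i, 0 < t i := fun i => zero_lt_one.trans_le (ht i)
  have hT : 0 < ∑ a, t a := Finset.sum_pos (fun a _ => ht0 a) ⟨0, Finset.mem_univ _⟩
  have hstr := strict_pow hq (fun i => (ht0 i).le) hij
  have hstep := F_step hq hA01 hrow ht hte
  set T := ∑ a, t a with hTdef
  set κ := ((m : ℝ) ^ (q - 1) * ∑ a, t a ^ q) / T ^ q with hκ
  have hκ1 : 1 < κ := by rw [hκ, lt_div_iff₀ (by positivity), one_mul]; exact hstr
  have hlκ : 0 < Real.log κ := Real.log_pos hκ1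
  have hF : ∀ K, 0 < F q A t K := F_pos hrow ht0
  have hW : ∀ n, (0 : ℝ) < (W q A n).card := fun n => by
    exact_mod_cast Finset.card_pos.2 (W_nonempty hrow n)
  let f : ℕ → ℝ := fun L => Real.log (F q A t (q ^ (L + 1))) / (q : ℝ) ^ (L + 2)
  have hlog : ∀ L, (f (L + 1) - f L) ≥ ((q : ℝ) - 1) ^ 2 / q ^ 2 * Real.log T
      + ((q : ℝ) - 1) ^ 2 / q ^ 3 * Real.log κ
      - ((q : ℝ) - 1) / q * (Real.log (W q A (q ^ (L + 2))).card / ((q ^ (L + 2) : ℕ) : ℝ)) := by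
    intro L
    have h := hstep (q ^ L)
    rw [show q * q ^ L = q ^ (L + 1) by ring, show q * q ^ (L + 1) = q ^ (L + 2) by ring] at h
    have h' := Real.log_le_log (by have := hF (q ^ (L + 1)); positivity) h
    rw [Real.log_mul (by have := hF (q ^ (L + 1)); positivity) (by positivity),
      Real.log_mul (pow_pos (hF _) _).ne' (by positivity),
      Real.log_mul (pow_pos (hW _) _).ne' (hF _).ne', Real.log_pow, Real.log_pow, Real.log_pow,
      Real.log_pow] at h'
    push_cast at h'
    rw [hqc] at h'
    simp only [f]
    push_cast
    have hqL : (0 : ℝ) < (q : ℝ) ^ (L + 3) := by positivity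
    have h2 := div_le_div_of_nonneg_right h' hqL.le
    have eL : (q : ℝ) ^ (L + 3) = (q : ℝ) ^ L * q ^ 3 := by ring
    have eL2 : (q : ℝ) ^ (L + 2) = (q : ℝ) ^ L * q ^ 2 := by ring
    have eL1 : (q : ℝ) ^ (L + 1) = (q : ℝ) ^ L * q := by ring
    have hq' : (q : ℝ) ^ L ≠ 0 := by positivity
    rw [show L + 1 + 2 = L + 3 by ring, show L + 1 + 1 = L + 2 by ring]
    rw [eL, eL1] at h2
    rw [eL, eL2]
    have l1 : (↑q * Real.log (F q A t (q ^ (L + 1))) + (↑q - 1) ^ 2 * ↑q ^ L * Real.log κ +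
        (↑q - 1) ^ 2 * (↑q ^ L * ↑q) * Real.log T) / ((q : ℝ) ^ L * q ^ 3) =
        Real.log (F q A t (q ^ (L + 1))) / ((q : ℝ) ^ L * q ^ 2) +
        ((q : ℝ) - 1) ^ 2 / q ^ 3 * Real.log κ + ((q : ℝ) - 1) ^ 2 / q ^ 2 * Real.log T := by
      field_simp
    have l2 : ((↑q - 1) * Real.log ↑(W q A (q ^ (L + 2))).card +
        Real.log (F q A t (q ^ (L + 2)))) / ((q : ℝ) ^ L * q ^ 3) =
        ((q : ℝ) - 1) / q * (Real.log ↑(W q A (q ^ (L + 2))).card / ((q : ℝ) ^ L * q ^ 2)) +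
        Real.log (F q A t (q ^ (L + 2))) / ((q : ℝ) ^ L * q ^ 3) := by
      field_simp
    rw [l1, l2] at h2
    linarith
  have hfB : ∀ L, f L ≤ Real.log m + Real.log T := by
    intro L
    have htT : ∀ i, t i ≤ T := fun i =>
      Finset.single_le_sum (f := t) (fun a _ => (ht0 a).le) (Finset.mem_univ i)
    have hT1 : 1 ≤ T := (ht 0).trans (htT 0)
    set K := q ^ (L + 1) with hK
    have h1 : F q A t K ≤ (m : ℝ) ^ (q * K) * T ^ (q * K) := by
      calc F q A t K ≤ ∑ w ∈ W q A (q * K), T ^ (q * K) := by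
            refine Finset.sum_le_sum fun w _ => ?_
            calc ∏ k ∈ Finset.Ioc K (q * K), t (w k) ≤ ∏ k ∈ Finset.Ioc K (q * K), T :=
                  Finset.prod_le_prod (fun _ _ => (ht0 _).le) fun _ _ => htT _
              _ = T ^ (q * K - K) := by simp
              _ ≤ _ := pow_le_pow_right₀ hT1 (Nat.sub_le _ _)
        _ = (W q A (q * K)).card * T ^ (q * K) := by simp
        _ ≤ _ := by
          refine mul_le_mul_of_nonneg_right ?_ (by positivity)
          exact_mod_cast card_W_le (q * K)
    have h2 := Real.log_le_log (hF K) h1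
    rw [Real.log_mul (by positivity) (by positivity), Real.log_pow, Real.log_pow] at h2
    have e : ((q * K : ℕ) : ℝ) = (q : ℝ) ^ (L + 2) := by rw [hK]; push_cast; ring
    rw [e] at h2
    simp only [f]
    rw [div_le_iff₀ (by positivity)]
    linarith
  have hsub : Tendsto (fun L : ℕ => Real.log (W q A (q ^ (L + 2))).card / ((q ^ (L + 2) : ℕ) : ℝ))
      atTop (𝓝 D) :=
    hD.comp ((tendsto_pow_atTop_atTop_of_one_lt (by omega)).comp (tendsto_add_atTop_nat 2))
  -- by contradiction
  by_contra hcon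
  push Not at hcon
  set ε := ((q : ℝ) - 1) ^ 2 / q ^ 3 * Real.log κ / 4 with hε
  have hε0 : 0 < ε := by positivity
  have hev : ∀ᶠ L in atTop,
      Real.log (W q A (q ^ (L + 2))).card / ((q ^ (L + 2) : ℕ) : ℝ) < D + ε :=
    hsub.eventually (gt_mem_nhds (by linarith))
  obtain ⟨L, hL1, hL2⟩ := ((freq_of_bdd hfB hε0).and_eventually hev).exists
  have h3 := hlog L
  have h4 : ((q : ℝ) - 1) / q * (Real.log (W q A (q ^ (L + 2))).card / ((q ^ (L + 2) : ℕ) : ℝ)) ≤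
      ((q : ℝ) - 1) / q * D + ε := by
    have a1 : ((q : ℝ) - 1) / q ≤ 1 := by rw [div_le_one hq0]; linarith
    have a0 : 0 ≤ ((q : ℝ) - 1) / q := by positivity
    calc _ ≤ ((q : ℝ) - 1) / q * (D + ε) := mul_le_mul_of_nonneg_left hL2.le a0
      _ ≤ _ := by nlinarith
  have h5 : ((q : ℝ) - 1) / q * D ≤ ((q : ℝ) - 1) ^ 2 / q ^ 2 * Real.log T := by
    calc _ ≤ ((q : ℝ) - 1) / q * ((1 - 1 / (q : ℝ)) * Real.log T) :=
          mul_le_mul_of_nonneg_left hcon (by positivity)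
      _ = _ := by field_simp
  have h6 : ((q : ℝ) - 1) ^ 2 / q ^ 3 * Real.log κ = 4 * ε := by rw [hε]; ring
  rw [h6] at h3
  linarith

end MS

namespace MS

/-- extend a `ℕ+`-indexed sequence to `ℕ` -/
def toN {m : ℕ} [NeZero m] (x : ℕ+ → Fin m) : ℕ → Fin m :=
  fun k => if h : 0 < k then x ⟨k, h⟩ else 0

/-- truncation -/
def trunc {m : ℕ} [NeZero m] (n : ℕ) (y : ℕ → Fin m) : ℕ → Fin m :=
  fun k => if 1 ≤ k ∧ k ≤ n then y k else 0

/-- the multiplicative subshift of the theorem -/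
def XA {m : ℕ} (q : ℕ+) (A : Matrix (Fin m) (Fin m) ℝ) : Set (ℕ+ → Fin m) :=
  {x : ℕ+ → Fin m | ∀ k : ℕ+, A (x k) (x (q * k)) = 1}

lemma toN_succ {m : ℕ} [NeZero m] (x : ℕ+ → Fin m) (k : ℕ) :
    toN x (k + 1) = x ⟨k + 1, Nat.succ_pos k⟩ := by
  simp [toN]

lemma toN_coe {m : ℕ} [NeZero m] (x : ℕ+ → Fin m) (k : ℕ+) : toN x k = x k := by
  simp only [toN, dif_pos k.pos]
  rfl

lemma valMap_eq {m : ℕ} [NeZero m] (x : ℕ+ → Fin m) :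
    ValMap m x = Real.ofDigits (fun i => toN x (i + 1)) := by
  rw [ValMap, Real.ofDigits]
  have := tsum_pnat_eq_tsum_succ (f := fun k : ℕ => ((toN x k : ℕ) : ℝ) * (m : ℝ)⁻¹ ^ k)
  simp only [toN_coe] at this
  rw [this]
  refine tsum_congr fun i => ?_
  simp [Real.ofDigitsTerm]

lemma XA_toN {m : ℕ} [NeZero m] {q : ℕ+} {A : Matrix (Fin m) (Fin m) ℝ} {x : ℕ+ → Fin m}
    (hx : x ∈ XA q A) (k : ℕ) (hk : 1 ≤ k) : A (toN x k) (toN x (q * k)) = 1 := by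
  obtain ⟨κ, rfl⟩ : ∃ κ : ℕ+, (κ : ℕ) = k := ⟨⟨k, hk⟩, rfl⟩
  rw [toN_coe, ← PNat.mul_coe, toN_coe]
  exact hx κ

lemma XA_of_nat {m : ℕ} {q : ℕ+} {A : Matrix (Fin m) (Fin m) ℝ} {y : ℕ → Fin m}
    (hy : ∀ k : ℕ, 1 ≤ k → A (y k) (y (q * k)) = 1) : (fun k : ℕ+ => y k) ∈ XA q A := by
  intro k
  have := hy k k.pos
  simpa using this

lemma trunc_mem {m : ℕ} [NeZero m] {q : ℕ+} (hq : 2 ≤ (q : ℕ)) {A : Matrix (Fin m) (Fin m) ℝ}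
    {x : ℕ+ → Fin m} (hx : x ∈ XA q A) (n : ℕ) : trunc n (toN x) ∈ W q A n := by
  rw [mem_W hq]
  constructor
  · intro k hk
    simp only [trunc]
    rw [if_neg (by omega)]
  · intro k hk hkn
    have : k ≤ q * k := Nat.le_mul_of_pos_left _ q.pos
    simp only [trunc]
    rw [if_pos ⟨hk, by omega⟩, if_pos ⟨by omega, hkn⟩]
    exact XA_toN hx k hk

/-- extension of a word to an infinite sequence -/
def extw {m : ℕ} [NeZero m] (q : ℕ) (hq : 2 ≤ q) (s : Fin m → Fin m) (n : ℕ) (w : ℕ → Fin m)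
    (k : ℕ) : Fin m :=
  if _h : k ≤ n then w k else if q ∣ k then s (extw q hq s n w (k / q)) else 0
termination_by k
decreasing_by exact Nat.div_lt_self (by omega) (by omega)

lemma exists_ext {m : ℕ} [NeZero m] {q : ℕ+} (hq : 2 ≤ (q : ℕ)) {A : Matrix (Fin m) (Fin m) ℝ}
    (hrow : ∀ i, ∃ j, A i j = 1) {n : ℕ} {w : ℕ → Fin m} (hw : w ∈ W q A n) :
    ∃ x ∈ XA q A, trunc n (toN x) = w := by
  choose s hs using hrow
  have hlow : ∀ k ≤ n, extw q hq s n w k = w k := fun k hk => by rw [extw, dif_pos hk]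
  refine ⟨fun k : ℕ+ => extw q hq s n w k, XA_of_nat fun k hk => ?_, ?_⟩
  · have hlt : k < q * k := by nlinarith
    by_cases h : q * k ≤ n
    · rw [hlow _ h, hlow _ (by omega)]
      exact ((mem_W hq).1 hw).2 k hk h
    · rw [extw.eq_1 (k := q * k), dif_neg h, if_pos (Dvd.intro _ rfl),
        Nat.mul_div_cancel_left _ (by omega)]
      exact hs _
  · funext k
    simp only [trunc]
    split_ifs with h
    · have := toN_coe (fun k : ℕ+ => extw q hq s n w k) ⟨k, h.1⟩
      simp only [PNat.mk_coe] at this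
      rw [this, hlow k h.2]
    · exact (W_supp hw k (by omega)).symm

lemma nwords_eq {m : ℕ} [NeZero m] {q : ℕ+} (hq : 2 ≤ (q : ℕ)) {A : Matrix (Fin m) (Fin m) ℝ}
    (hrow : ∀ i, ∃ j, A i j = 1) (n : ℕ) : NWords n (XA q A) = (W q A n).card := by
  have himg : {u : List (Fin m) | u.length = n ∧ u ∈ Pref (XA q A)} =
      (fun w : ℕ → Fin m => List.ofFn (fun j : Fin n => w (j + 1))) '' (W q A n : Set (ℕ → Fin m)) := by
    ext u
    constructor
    · rintro ⟨hu, x, hx, hb⟩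
      refine ⟨trunc n (toN x), trunc_mem hq hx n, ?_⟩
      apply List.ext_getElem
      · simp [hu]
      · intro i h1 h2
        have := hb ⟨i, h2⟩
        simp only [List.getElem_ofFn, trunc]
        rw [if_pos ⟨by omega, by omega⟩, toN_succ]
        simpa using this
    · rintro ⟨w, hw, rfl⟩
      obtain ⟨x, hx, rfl⟩ := exists_ext hq hrow hw
      refine ⟨by simp, x, hx, ?_⟩
      change Begins x (List.ofFn (fun j : Fin n => trunc n (toN x) (j + 1)))
      intro j
      have hj : (j : ℕ) < n := by simpa using j.2
      have h1 : (List.ofFn (fun j : Fin n => trunc n (toN x) (j + 1))).get j =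
          trunc n (toN x) (j + 1) := by
        rw [List.get_eq_getElem, List.getElem_ofFn]
      rw [h1]
      simp only [trunc]
      rw [if_pos ⟨by omega, by omega⟩, toN_succ]
  rw [NWords, himg, Set.InjOn.ncard_image, Set.ncard_coe_finset]
  intro w hw w' hw' h
  simp only [List.ofFn_inj] at h
  funext k
  by_cases hk : k = 0 ∨ n < k
  · rw [W_supp hw k hk, W_supp hw' k hk]
  · have := congrFun h ⟨k - 1, by omega⟩
    simp only at this
    rwa [Nat.sub_add_cancel (by omega)] at this

/-- value of a word -/
def val {m : ℕ} (n : ℕ) (w : ℕ → Fin m) : ℝ :=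
  ∑ i ∈ Finset.range n, Real.ofDigitsTerm (fun i => w (i + 1)) i

lemma valMap_mem {m : ℕ} [NeZero m] (x : ℕ+ → Fin m) (n : ℕ) :
    ValMap m x ∈ Set.Icc (val n (toN x)) (val n (toN x) + ((m : ℝ) ^ n)⁻¹) := by
  rw [valMap_eq, Real.ofDigits_eq_sum_add_ofDigits _ n]
  have h0 := Real.ofDigits_nonneg (fun i => toN x (i + n + 1))
  have h1 := Real.ofDigits_le_one (fun i => toN x (i + n + 1))
  have hm : (0 : ℝ) < ((m : ℝ) ^ n)⁻¹ := by
    have : (0 : ℝ) < m := by exact_mod_cast NeZero.pos m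
    positivity
  constructor
  · rw [val]; nlinarith
  · rw [val]; nlinarith

lemma val_trunc {m : ℕ} [NeZero m] (n : ℕ) (y : ℕ → Fin m) : val n (trunc n y) = val n y := by
  refine Finset.sum_congr rfl fun i hi => ?_
  have : i < n := Finset.mem_range.1 hi
  simp only [Real.ofDigitsTerm, trunc]
  rw [if_pos ⟨by omega, by omega⟩]

lemma dimH_le_of_cover {m : ℕ} [NeZero m] (hm : 2 ≤ m) (X : Set (ℕ+ → Fin m)) (s : ℝ) (hs : 0 ≤ s)
    (G : ℕ → Finset (ℕ → Fin m))
    (hcard : ∀ᶠ n : ℕ in atTop, ((G n).card : ℝ) ≤ (m : ℝ) ^ (s * n))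
    (hX : ∀ x ∈ X, ∃ᶠ n in atTop, trunc n (toN x) ∈ G n) :
    dimH (XiSet X) ≤ ENNReal.ofReal s := by
  have hm1 : (1 : ℝ) < m := by exact_mod_cast hm
  have hm0 : (0 : ℝ) < m := by linarith
  refine ENNReal.le_of_forall_pos_le_add fun ε hε _ => ?_
  have hdd : ENNReal.ofReal s + (ε : ℝ≥0∞) = ((s.toNNReal + ε : NNReal) : ℝ≥0∞) := by
    rw [ENNReal.coe_add]; rfl
  rw [hdd]
  apply dimH_le_of_hausdorffMeasure_ne_top
  have hd : ((s.toNNReal + ε : NNReal) : ℝ) = s + ε := by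
    rw [NNReal.coe_add, Real.coe_toNNReal s hs]
  rw [hd]
  have hε' : (0 : ℝ) < ε := by exact_mod_cast hε
  set ρ : ℝ := (m : ℝ) ^ (-(ε : ℝ)) with hρ
  have hρ0 : 0 < ρ := Real.rpow_pos_of_pos hm0 _
  have hρ1 : ρ < 1 := Real.rpow_lt_one_of_one_lt_of_neg hm1 (by linarith)
  have hr : Tendsto (fun N : ℕ => ENNReal.ofReal (((m : ℝ) ^ N)⁻¹)) atTop (𝓝 0) := by
    rw [← ENNReal.ofReal_zero]
    refine (ENNReal.continuous_ofReal.tendsto 0).comp ?_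
    exact tendsto_inv_atTop_zero.comp (tendsto_pow_atTop_atTop_of_one_lt hm1)
  have hdiam : ∀ (n : ℕ) (w : ℕ → Fin m),
      Metric.ediam (Set.Icc (val n w) (val n w + ((m : ℝ) ^ n)⁻¹)) =
        ENNReal.ofReal (((m : ℝ) ^ n)⁻¹) := by
    intro n w
    rw [Real.ediam_Icc, add_sub_cancel_left]
  have := Measure.hausdorffMeasure_le_liminf_tsum (β := ℕ)
    (ι := fun N => Σ n : ℕ, {w : ℕ → Fin m // w ∈ G (n + N)}) (s + ε) (XiSet X) (l := atTop)
    (fun N : ℕ => ENNReal.ofReal (((m : ℝ) ^ N)⁻¹)) hr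
    (fun N p => Set.Icc (val (p.1 + N) p.2.1) (val (p.1 + N) p.2.1 + ((m : ℝ) ^ (p.1 + N))⁻¹))
    (Eventually.of_forall fun N p => by
      rw [hdiam]
      refine ENNReal.ofReal_le_ofReal (inv_anti₀ (by positivity) ?_)
      exact pow_le_pow_right₀ hm1.le (by omega))
    (Eventually.of_forall fun N r hr => by
      obtain ⟨x, hx, rfl⟩ := hr
      obtain ⟨n, hn, hnG⟩ := (frequently_atTop.1 (hX x hx)) N
      obtain ⟨k, rfl⟩ := Nat.exists_eq_add_of_le' hn
      refine Set.mem_iUnion.2 ⟨⟨k, ⟨_, hnG⟩⟩, ?_⟩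
      simp only
      rw [val_trunc]
      exact valMap_mem x _)
  refine ne_top_of_le_ne_top ?_ (this.trans (liminf_le_of_frequently_le' (Eventually.frequently ?_)
    (x := (1 - ENNReal.ofReal ρ)⁻¹)))
  · rw [ENNReal.inv_ne_top]
    have : ENNReal.ofReal ρ < 1 := by
      rw [← ENNReal.ofReal_one]; exact (ENNReal.ofReal_lt_ofReal_iff zero_lt_one).2 hρ1
    exact (tsub_pos_of_lt this).ne'
  · obtain ⟨n0, hn0⟩ := eventually_atTop.1 hcard
    filter_upwards [eventually_ge_atTop n0] with N hN
    rw [ENNReal.tsum_sigma', ← ENNReal.tsum_geometric]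
    refine ENNReal.tsum_le_tsum fun n => ?_
    simp_rw [hdiam]
    rw [ENNReal.tsum_const, ENat.card_eq_coe_fintype_card, Fintype.card_coe]
    have hc := hn0 (n + N) (by omega)
    rw [ENNReal.ofReal_rpow_of_pos (by positivity), ← ENNReal.ofReal_pow hρ0.le]
    have e1 : (((((G (n + N)).card : ℕ) : ℕ∞)) : ℝ≥0∞) =
        ENNReal.ofReal (((G (n + N)).card : ℕ) : ℝ) := by simp
    rw [e1, ← ENNReal.ofReal_mul (by positivity)]
    refine ENNReal.ofReal_le_ofReal ?_
    have e2 : (((m : ℝ) ^ (n + N))⁻¹) ^ (s + (ε : ℝ)) = (m : ℝ) ^ (-(s + ε) * ((n + N : ℕ) : ℝ)) := by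
      rw [← Real.rpow_natCast, ← Real.rpow_neg hm0.le, ← Real.rpow_mul hm0.le]
      congr 1; ring
    have e3 : ρ ^ (n + N) = (m : ℝ) ^ (-(ε : ℝ) * ((n + N : ℕ) : ℝ)) := by
      rw [hρ, ← Real.rpow_natCast, ← Real.rpow_mul hm0.le]
    calc _ ≤ (m : ℝ) ^ (s * ((n + N : ℕ) : ℝ)) * (m : ℝ) ^ (-(s + ε) * ((n + N : ℕ) : ℝ)) := by
          rw [e2]; exact mul_le_mul_of_nonneg_right hc (by positivity)
      _ = ρ ^ (n + N) := by
          rw [e3, ← Real.rpow_add hm0]; congr 1; ring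
      _ ≤ ρ ^ n := pow_le_pow_of_le_one hρ0.le hρ1.le (by omega)

lemma dimH_le_mink {m : ℕ} [NeZero m] (hm : 2 ≤ m) {q : ℕ+} (hq : 2 ≤ (q : ℕ))
    {A : Matrix (Fin m) (Fin m) ℝ} (hrow : ∀ i, ∃ j, A i j = 1) {d : ℝ}
    (hd : Tendsto (fun n : ℕ => Real.logb m (W q A n).card / n) atTop (𝓝 d)) :
    dimH (XiSet (XA q A)) ≤ ENNReal.ofReal d := by
  have hm1 : (1 : ℝ) < m := by exact_mod_cast hm
  have hm0 : (0 : ℝ) < m := by linarith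
  have hW : ∀ n, (0 : ℝ) < (W q A n).card := fun n => by
    exact_mod_cast Finset.card_pos.2 (W_nonempty hrow n)
  have hd0 : 0 ≤ d := ge_of_tendsto' hd fun n => by
    refine div_nonneg (Real.logb_nonneg hm1 ?_) (by positivity)
    exact_mod_cast Finset.card_pos.2 (W_nonempty hrow n)
  have key : ∀ ε > 0, dimH (XiSet (XA q A)) ≤ ENNReal.ofReal (d + ε) := by
    intro ε hε
    refine dimH_le_of_cover hm _ (d + ε) (by linarith) (fun n => W q A n) ?_
      (fun x hx => Eventually.frequently (Eventually.of_forall fun n => trunc_mem hq hx n))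
    filter_upwards [hd.eventually (gt_mem_nhds (by linarith : d < d + ε)), eventually_gt_atTop 0]
      with n hn hn0
    have hn0' : (0 : ℝ) < n := by exact_mod_cast hn0
    rw [div_lt_iff₀ hn0'] at hn
    exact ((Real.logb_le_iff_le_rpow hm1 (hW n)).1 hn.le)
  refine ENNReal.le_of_forall_pos_le_add fun ε hε _ => ?_
  have := key ε (by exact_mod_cast hε)
  rwa [ENNReal.ofReal_add hd0 (by positivity), ENNReal.ofReal_coe_nnreal] at this

/-- weights of words -/
def P {m : ℕ} (q : ℕ) (t : Fin m → ℝ) (n : ℕ) (w : ℕ → Fin m) : ℝ :=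
  ((∑ a, t a) ^ (n - n / q))⁻¹ * (∏ k ∈ Finset.Ioc 0 n, t (w k)) *
    ∏ k ∈ Finset.Ioc 0 (n / q), (t (w k) ^ q)⁻¹

lemma P_dep {m : ℕ} (q : ℕ) (t : Fin m → ℝ) (n : ℕ) : Dep n (P q t n) := by
  intro x y h
  unfold P
  rw [Finset.prod_congr rfl (g := fun k => t (y k)) fun k hk => by
    rw [h k (Finset.mem_Ioc.1 hk).2], Finset.prod_congr rfl (g := fun k => (t (y k) ^ q)⁻¹)
    (s₁ := Finset.Ioc 0 (n / q)) fun k hk => by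
    rw [h k ((Finset.mem_Ioc.1 hk).2.trans (Nat.div_le_self _ _))]]

lemma P_sum {m : ℕ} [NeZero m] {q : ℕ} (hq : 2 ≤ q) {A : Matrix (Fin m) (Fin m) ℝ}
    (hA01 : ∀ i j, A i j = 0 ∨ A i j = 1)
    {t : Fin m → ℝ} (ht : ∀ i, 1 ≤ t i) (hte : ∀ i, t i ^ q = ∑ j, A i j * t j) (n : ℕ) :
    ∑ w ∈ W q A n, P q t n w = 1 := by
  have ht0 : ∀ i, 0 < t i := fun i => zero_lt_one.trans_le (ht i)
  have hT : 0 < ∑ a, t a := Finset.sum_pos (fun a _ => ht0 a) ⟨0, Finset.mem_univ _⟩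
  induction n with
  | zero => simp [W, P]
  | succ n ih =>
    have hle : n / q ≤ n := Nat.div_le_self _ _
    have e0 : Finset.Ioc 0 (n + 1) = insert (n + 1) (Finset.Ioc 0 n) := by
      ext k; simp only [Finset.mem_Ioc, Finset.mem_insert]; omega
    by_cases hdv : q ∣ n + 1
    · have hdiv : (n + 1) / q = n / q + 1 := Nat.succ_div_of_dvd hdv
      have hlt : (n + 1) / q ≤ n := by
        have : (n + 1) / q < n + 1 := Nat.div_lt_self (Nat.succ_pos n) (by omega : 1 < q)
        omega
      have e : ∀ w : ℕ → Fin m, P q t (n + 1) w =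
          (P q t n w * (t (w ((n + 1) / q)) ^ q)⁻¹) * t (w (n + 1)) := by
        intro w
        have e1 : Finset.Ioc 0 ((n + 1) / q) = insert ((n + 1) / q) (Finset.Ioc 0 (n / q)) := by
          rw [hdiv]
          generalize n / q = z
          ext k; simp only [Finset.mem_Ioc, Finset.mem_insert]; omega
        unfold P
        rw [e0, e1, Finset.prod_insert (by simp), Finset.prod_insert (by simp [hdiv]), hdiv,
          show n + 1 - (n / q + 1) = n - n / q by omega]
        ring
      simp_rw [e]
      rw [sum_step_mul hA01 hdv ((P_dep q t n).mul (dep_coord hlt (fun i => (t i ^ q)⁻¹)))]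
      rw [← ih]
      refine Finset.sum_congr rfl fun w _ => ?_
      rw [← hte, mul_assoc, inv_mul_cancel₀ (pow_pos (ht0 _) _).ne', mul_one]
    · have hdiv : (n + 1) / q = n / q := Nat.succ_div_of_not_dvd hdv
      have e : ∀ w : ℕ → Fin m, P q t (n + 1) w =
          (P q t n w * (∑ a, t a)⁻¹) * t (w (n + 1)) := by
        intro w
        unfold P
        rw [e0, Finset.prod_insert (by simp), hdiv,
          show n + 1 - n / q = n - n / q + 1 by omega, pow_succ, mul_inv]
        ring
      simp_rw [e]
      rw [sum_step_free hdv ((P_dep q t n).mul (fun _ _ _ => rfl)), ← Finset.sum_mul, ih, one_mul,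
        mul_inv_cancel₀ hT.ne']

lemma dimH_le_t {m : ℕ} [NeZero m] (hm : 2 ≤ m) {q : ℕ+} (hq : 2 ≤ (q : ℕ))
    {A : Matrix (Fin m) (Fin m) ℝ} (hA01 : ∀ i j, A i j = 0 ∨ A i j = 1)
    {t : Fin m → ℝ} (ht : ∀ i, 1 ≤ t i) (hte : ∀ i, t i ^ (q : ℕ) = ∑ j, A i j * t j)
    {ε : ℝ} (hε : 0 < ε) :
    dimH (XiSet (XA q A)) ≤
      ENNReal.ofReal (((1 - 1 / (q : ℝ)) * Real.log (∑ a, t a) + ε) / Real.log m) := by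
  have hm1 : (1 : ℝ) < m := by exact_mod_cast hm
  have hm0 : (0 : ℝ) < m := by linarith
  have hlm : 0 < Real.log m := Real.log_pos hm1
  have hq1 : (1 : ℝ) ≤ q := by exact_mod_cast q.pos
  have hq0 : (0 : ℝ) < q := by linarith
  have ht0 : ∀ i, 0 < t i := fun i => zero_lt_one.trans_le (ht i)
  have hT : 0 < ∑ a, t a := Finset.sum_pos (fun a _ => ht0 a) ⟨0, Finset.mem_univ _⟩
  have hT1 : 1 ≤ ∑ a, t a := (ht 0).trans
    (Finset.single_le_sum (f := t) (fun a _ => (ht0 a).le) (Finset.mem_univ 0))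
  have hP0 : ∀ n w, 0 < P q t n w := fun n w => by
    have h1 : 0 < ∏ k ∈ Finset.Ioc 0 n, t (w k) := Finset.prod_pos fun _ _ => ht0 _
    have h2 : 0 < ∏ k ∈ Finset.Ioc 0 (n / q), (t (w k) ^ (q : ℕ))⁻¹ :=
      Finset.prod_pos fun _ _ => inv_pos.2 (pow_pos (ht0 _) _)
    unfold P
    positivity
  set E := (1 - 1 / (q : ℝ)) * Real.log (∑ a, t a) + ε with hE
  have hE0 : 0 ≤ E := by
    have : 0 ≤ 1 - 1 / (q : ℝ) := by
      rw [sub_nonneg, div_le_one hq0]; exact hq1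
    have := mul_nonneg this (Real.log_nonneg hT1)
    linarith
  refine dimH_le_of_cover hm _ _ (div_nonneg hE0 hlm.le)
    (fun n => (W q A n).filter (fun w => Real.exp (-(E * n)) ≤ P q t n w))
    (Eventually.of_forall fun n => ?_) fun x hx => ?_
  · have h1 : (((W q A n).filter (fun w => Real.exp (-(E * n)) ≤ P q t n w)).card : ℝ) *
        Real.exp (-(E * n)) ≤ 1 := by
      rw [← P_sum hq hA01 ht hte n, ← nsmul_eq_mul]
      refine (Finset.card_nsmul_le_sum _ _ _ fun w hw => (Finset.mem_filter.1 hw).2).trans ?_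
      exact Finset.sum_le_sum_of_subset_of_nonneg (Finset.filter_subset _ _)
        fun w _ _ => (hP0 n w).le
    have h2 := mul_le_mul_of_nonneg_right h1 (Real.exp_pos (E * n)).le
    rw [mul_assoc, ← Real.exp_add, neg_add_cancel, Real.exp_zero, mul_one, one_mul] at h2
    rw [Real.rpow_def_of_pos hm0]
    refine h2.trans (le_of_eq ?_)
    congr 1
    field_simp
  · set y := toN x with hy
    let S : ℕ → ℝ := fun n => ∑ k ∈ Finset.Ioc 0 n, Real.log (t (y k))
    let f : ℕ → ℝ := fun L => -(S (q ^ L) / (q : ℝ) ^ L)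
    have hf : ∀ L, f L ≤ 0 := fun L => by
      have : 0 ≤ S (q ^ L) := Finset.sum_nonneg fun k _ => Real.log_nonneg (ht _)
      simp only [f]
      have : 0 ≤ S (q ^ L) / (q : ℝ) ^ L := by positivity
      linarith
    have htend : Tendsto (fun L : ℕ => (q : ℕ) ^ (L + 1)) atTop atTop :=
      (tendsto_pow_atTop_atTop_of_one_lt (by omega)).comp (tendsto_add_atTop_nat 1)
    refine htend.frequently ((freq_of_bdd hf hε).mono fun L hL => ?_)
    rw [Finset.mem_filter]
    refine ⟨trunc_mem hq hx _, ?_⟩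
    have hPt : P q t (q ^ (L + 1)) (trunc (q ^ (L + 1)) y) = P q t (q ^ (L + 1)) y := by
      have hle : (q : ℕ) ^ (L + 1) / q ≤ q ^ (L + 1) := Nat.div_le_self _ _
      unfold P
      congr 1
      · congr 1
        refine Finset.prod_congr rfl fun k hk => ?_
        rw [Finset.mem_Ioc] at hk
        simp only [trunc]; rw [if_pos ⟨by omega, by omega⟩]
      · refine Finset.prod_congr rfl fun k hk => ?_
        rw [Finset.mem_Ioc] at hk
        simp only [trunc]; rw [if_pos ⟨by omega, by omega⟩]
    rw [hPt, ← Real.le_log_iff_exp_le (hP0 _ _)]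
    have hdv : (q : ℕ) ^ (L + 1) / q = q ^ L := by
      rw [pow_succ, Nat.mul_div_cancel _ q.pos]
    have hlogP : Real.log (P q t (q ^ (L + 1)) y) =
        -(((q : ℝ) ^ (L + 1) - (q : ℝ) ^ L) * Real.log (∑ a, t a)) + S (q ^ (L + 1)) -
          q * S (q ^ L) := by
      unfold P
      have hne1 : ∏ k ∈ Finset.Ioc 0 ((q : ℕ) ^ (L + 1)), t (y k) ≠ 0 :=
        (Finset.prod_pos fun _ _ => ht0 _).ne'
      have hne2 : ∏ k ∈ Finset.Ioc 0 ((q : ℕ) ^ L), (t (y k) ^ (q : ℕ))⁻¹ ≠ 0 :=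
        (Finset.prod_pos fun _ _ => inv_pos.2 (pow_pos (ht0 _) _)).ne'
      rw [hdv, Real.log_mul (mul_ne_zero (by positivity) hne1) hne2,
        Real.log_mul (by positivity) hne1, Real.log_inv, Real.log_pow,
        Real.log_prod (fun _ _ => (ht0 _).ne'),
        Real.log_prod (fun _ _ => (inv_pos.2 (pow_pos (ht0 _) _)).ne'),
        Nat.cast_sub (Nat.pow_le_pow_right q.pos (by omega))]
      simp only [Real.log_inv, Real.log_pow, S, Finset.sum_neg_distrib, ← Finset.mul_sum]
      push_cast
      ring
    rw [hlogP]
    simp only [f] at hL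
    have hqL : (0 : ℝ) < (q : ℝ) ^ (L + 1) := by positivity
    have h1 : S (q ^ L) / (q : ℝ) ^ L = (q * S (q ^ L)) / (q : ℝ) ^ (L + 1) := by
      rw [pow_succ]; field_simp
    rw [h1, neg_sub_neg, ← sub_div, div_le_iff₀ hqL] at hL
    have h2 : E * (((q : ℕ) ^ (L + 1) : ℕ) : ℝ) =
        ((q : ℝ) ^ (L + 1) - (q : ℝ) ^ L) * Real.log (∑ a, t a) + ε * (q : ℝ) ^ (L + 1) := by
      rw [hE]; push_cast; rw [pow_succ]; field_simp
    rw [h2]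
    linarith

end MS

namespace MS

/-- integer with base `m` digits `y 1, …, y n` -/
def In {m : ℕ} (y : ℕ → Fin m) : ℕ → ℕ
  | 0 => 0
  | n + 1 => m * In y n + (y (n + 1) : ℕ)

lemma val_In {m : ℕ} [NeZero m] (y : ℕ → Fin m) (n : ℕ) :
    val n y * (m : ℝ) ^ n = (In y n : ℝ) := by
  have hm0 : (m : ℝ) ≠ 0 := by exact_mod_cast NeZero.ne m
  induction n with
  | zero => simp [val, In]
  | succ n ih =>
    rw [val, Finset.sum_range_succ, ← val, add_mul, pow_succ, ← mul_assoc, ih, In]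
    simp only [Real.ofDigitsTerm]
    push_cast
    field_simp
    ring

lemma In_inj {m : ℕ} {y w : ℕ → Fin m} {n : ℕ} (h : In y n = In w n) :
    ∀ k, 1 ≤ k → k ≤ n → y k = w k := by
  induction n with
  | zero => intro k h1 h2; omega
  | succ n ih =>
    simp only [In] at h
    have hy := (y (n + 1)).2
    have hw := (w (n + 1)).2
    have h1 : (y (n + 1) : ℕ) = (w (n + 1) : ℕ) := by
      have := congrArg (· % m) h
      simpa [Nat.mul_add_mod, Nat.mod_eq_of_lt hy, Nat.mod_eq_of_lt hw] using this
    have h2 : In y n = In w n := by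
      rw [h1] at h
      have := Nat.add_right_cancel h
      exact Nat.eq_of_mul_eq_mul_left (by omega) this
    intro k hk hkn
    rcases Nat.lt_or_ge n k with hlt | hle
    · obtain rfl : k = n + 1 := by omega
      exact Fin.ext h1
    · exact ih h2 k hk hle

lemma toN_restrict {m : ℕ} [NeZero m] (y : ℕ → Fin m) (k : ℕ) :
    toN (fun k : ℕ+ => y k) (k + 1) = y (k + 1) := by
  rw [toN_succ]; rfl

lemma valMap_mem' {m : ℕ} [NeZero m] (y : ℕ → Fin m) (n : ℕ) :
    ValMap m (fun k : ℕ+ => y k) ∈ Set.Icc (val n y) (val n y + ((m : ℝ) ^ n)⁻¹) := by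
  have h := valMap_mem (fun k : ℕ+ => y k) n
  have e : val n (toN (fun k : ℕ+ => y k)) = val n y := by
    refine Finset.sum_congr rfl fun i _ => ?_
    simp only [Real.ofDigitsTerm, toN_restrict]
  rwa [e] at h

lemma measurable_valMap {m : ℕ} [NeZero m] {Ω : Type*} [MeasurableSpace Ω] {Φ : Ω → ℕ → Fin m}
    (hΦ : ∀ k, Measurable (fun ω => Φ ω k)) :
    Measurable (fun ω => ValMap m (fun k : ℕ+ => Φ ω k)) := by
  have e : (fun ω => ValMap m (fun k : ℕ+ => Φ ω k)) =
      Real.ofDigits ∘ (fun ω i => Φ ω (i + 1)) := by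
    funext ω
    rw [valMap_eq]
    simp only [toN_restrict, Function.comp]
  rw [e]
  exact Real.continuous_ofDigits.measurable.comp (measurable_pi_lambda _ fun i => hΦ (i + 1))

lemma dimH_ge {m : ℕ} [NeZero m] (hm : 2 ≤ m) (X : Set (ℕ+ → Fin m)) {Ω : Type*}
    [MeasurableSpace Ω] (μ : Measure Ω) [IsProbabilityMeasure μ] (Φ : Ω → ℕ → Fin m)
    (hΦ : ∀ k, Measurable (fun ω => Φ ω k)) (hX : ∀ ω, (fun k : ℕ+ => Φ ω k) ∈ X)
    {s : ℝ} (n0 : ℕ)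
    (hcyl : ∀ n, n0 ≤ n → ∀ w : ℕ → Fin m, w 0 = 0 →
      μ {ω | ∀ k, 1 ≤ k → k ≤ n → Φ ω k = w k} ≤ ENNReal.ofReal ((m : ℝ) ^ (-(s * n))))
    (h0 : ∀ ω, Φ ω 0 = 0)
    {p : NNReal} (hp0 : 0 < (p : ℝ)) (hp : (p : ℝ) < s) :
    (p : ℝ≥0∞) ≤ dimH (XiSet X) := by
  have hm1 : (1 : ℝ) < m := by exact_mod_cast hm
  have hm0 : (0 : ℝ) < m := by linarith
  set V : Ω → ℝ := fun ω => ValMap m (fun k : ℕ+ => Φ ω k) with hV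
  have hVm : Measurable V := measurable_valMap hΦ
  -- measure of small balls
  have hball : ∀ n, n0 ≤ n → ∀ a : ℝ, μ.map V (Metric.closedBall a ((m : ℝ) ^ n)⁻¹) ≤
      ENNReal.ofReal (4 * (m : ℝ) ^ (-(s * n))) := by
    intro n hn a
    rw [Measure.map_apply hVm measurableSet_closedBall]
    have hmn : (0 : ℝ) < (m : ℝ) ^ n := by positivity
    set I : Finset ℤ := Finset.Icc ⌈a * (m : ℝ) ^ n - 2⌉ ⌊a * (m : ℝ) ^ n + 1⌋ with hI
    have hsub : V ⁻¹' Metric.closedBall a ((m : ℝ) ^ n)⁻¹ ⊆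
        ⋃ z ∈ I, {ω | ((In (Φ ω) n : ℕ) : ℤ) = z} := by
      intro ω hω
      simp only [Set.mem_preimage, Metric.mem_closedBall, Real.dist_eq, abs_le] at hω
      simp only [Set.mem_iUnion, Set.mem_ofPred_eq, exists_prop, exists_eq_right']
      have hv := valMap_mem' (Φ ω) n
      have hVω : V ω = ValMap m (fun k : ℕ+ => Φ ω k) := rfl
      rw [← hVω] at hv
      have hIn := val_In (Φ ω) n
      have hinv : ((m : ℝ) ^ n)⁻¹ * (m : ℝ) ^ n = 1 := inv_mul_cancel₀ hmn.ne'
      have u1 : V ω * (m : ℝ) ^ n ≤ a * (m : ℝ) ^ n + 1 := by nlinarith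
      have u2 : a * (m : ℝ) ^ n - 1 ≤ V ω * (m : ℝ) ^ n := by nlinarith
      have u3 : val n (Φ ω) * (m : ℝ) ^ n ≤ V ω * (m : ℝ) ^ n := by nlinarith [hv.1]
      have u4 : V ω * (m : ℝ) ^ n ≤ val n (Φ ω) * (m : ℝ) ^ n + 1 := by nlinarith [hv.2]
      rw [hI, Finset.mem_Icc, Int.ceil_le, Int.le_floor]
      push_cast
      constructor <;> linarith
    have hcard : I.card ≤ 4 := by
      rw [hI, Int.card_Icc]
      have h1 := Int.le_ceil (a * (m : ℝ) ^ n - 2)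
      have h2 := Int.floor_le (a * (m : ℝ) ^ n + 1)
      have h3 : (⌊a * (m : ℝ) ^ n + 1⌋ : ℝ) ≤ ((⌈a * (m : ℝ) ^ n - 2⌉ + 3 : ℤ) : ℝ) := by
        push_cast; linarith
      have h4 := Int.cast_le.1 h3
      omega
    calc μ (V ⁻¹' Metric.closedBall a ((m : ℝ) ^ n)⁻¹)
        ≤ μ (⋃ z ∈ I, {ω | ((In (Φ ω) n : ℕ) : ℤ) = z}) := measure_mono hsub
      _ ≤ ∑ z ∈ I, μ {ω | ((In (Φ ω) n : ℕ) : ℤ) = z} := measure_biUnion_finset_le _ _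
      _ ≤ ∑ z ∈ I, ENNReal.ofReal ((m : ℝ) ^ (-(s * n))) := by
          refine Finset.sum_le_sum fun z _ => ?_
          rcases Set.eq_empty_or_nonempty {ω | ((In (Φ ω) n : ℕ) : ℤ) = z} with he | ⟨ω', hω'⟩
          · rw [he]; simp
          · refine (measure_mono ?_).trans (hcyl n hn (Φ ω') (h0 _))
            intro ω hω
            have : In (Φ ω) n = In (Φ ω') n := by
              simp only [Set.mem_ofPred_eq] at hω hω'
              omega
            exact In_inj this
      _ ≤ ENNReal.ofReal (4 * (m : ℝ) ^ (-(s * n))) := by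
          rw [Finset.sum_const, nsmul_eq_mul, ENNReal.ofReal_mul (by norm_num)]
          gcongr
          rw [ENNReal.ofReal_ofNat]
          exact_mod_cast hcard
  have hsp : 0 < s - p := by linarith
  -- threshold
  obtain ⟨N, hN0, hN⟩ : ∃ N : ℕ, n0 ≤ N ∧ ∀ n ≥ N,
      4 * (m : ℝ) ^ (-(s * n)) ≤ (m : ℝ) ^ (-(p * (n + 1 : ℝ))) := by
    have ht : Tendsto (fun n : ℕ => ((m : ℝ) ^ (s - p)) ^ n) atTop atTop :=
      tendsto_pow_atTop_atTop_of_one_lt (Real.one_lt_rpow hm1 hsp)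
    obtain ⟨N, hN⟩ := eventually_atTop.1 (ht.eventually_ge_atTop (4 * (m : ℝ) ^ (p : ℝ)))
    refine ⟨max N n0, le_max_right _ _, fun n hn => ?_⟩
    have h1 := hN n ((le_max_left _ _).trans hn)
    rw [← Real.rpow_natCast, ← Real.rpow_mul hm0.le] at h1
    have h2 := mul_le_mul_of_nonneg_right h1
      (Real.rpow_pos_of_pos hm0 (-(s * n) - p)).le
    rw [mul_assoc, ← Real.rpow_add hm0, ← Real.rpow_add hm0] at h2
    have e1 : (p : ℝ) + (-(s * n) - p) = -(s * n) := by ring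
    have e2 : (s - p) * (n : ℝ) + (-(s * n) - p) = -(p * (n + 1 : ℝ)) := by ring
    rwa [e1, e2] at h2
  have hle : μ.map V ≤ μH[(p : ℝ)] := by
    refine Measure.le_hausdorffMeasure _ _ (ENNReal.ofReal (((m : ℝ) ^ N)⁻¹)) (by positivity)
      fun U hU => ?_
    rcases Set.eq_empty_or_nonempty U with rfl | ⟨a, ha⟩
    · simp
    have hfin : Metric.ediam U ≠ ⊤ := ne_top_of_le_ne_top ENNReal.ofReal_ne_top hU
    obtain ⟨δ, hδ0, hδ⟩ : ∃ δ : ℝ, 0 ≤ δ ∧ Metric.ediam U = ENNReal.ofReal δ :=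
      ⟨_, ENNReal.toReal_nonneg, (ENNReal.ofReal_toReal hfin).symm⟩
    have hgen : ∀ n, n0 ≤ n → δ ≤ ((m : ℝ) ^ n)⁻¹ → μ.map V U ≤
        ENNReal.ofReal (4 * (m : ℝ) ^ (-(s * n))) := by
      intro n hn hd
      refine (measure_mono ?_).trans (hball n hn a)
      intro b hb
      rw [Metric.mem_closedBall]
      have h1 := Metric.edist_le_ediam_of_mem hb ha
      rw [hδ, edist_dist] at h1
      exact ((ENNReal.ofReal_le_ofReal_iff hδ0).1 h1).trans hd
    have hδN : δ ≤ ((m : ℝ) ^ N)⁻¹ := by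
      rw [hδ] at hU
      exact (ENNReal.ofReal_le_ofReal_iff (by positivity)).1 hU
    rcases hδ0.eq_or_lt with hz | hpos
    · have : ∀ n ≥ N, μ.map V U ≤ ENNReal.ofReal ((m : ℝ) ^ (-(p * (n + 1 : ℝ)))) := fun n hn =>
        (hgen n (hN0.trans hn) (by rw [← hz]; positivity)).trans
          (ENNReal.ofReal_le_ofReal (hN n hn))
      have hlim : Tendsto (fun n : ℕ => ENNReal.ofReal ((m : ℝ) ^ (-(p * (n + 1 : ℝ))))) atTop
          (𝓝 0) := by
        rw [← ENNReal.ofReal_zero]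
        refine (ENNReal.continuous_ofReal.tendsto 0).comp ?_
        have h1 : Tendsto (fun n : ℕ => ((m : ℝ) ^ (-(p : ℝ))) ^ (n + 1)) atTop (𝓝 0) :=
          (tendsto_pow_atTop_nhds_zero_of_lt_one (Real.rpow_pos_of_pos hm0 _).le
            (Real.rpow_lt_one_of_one_lt_of_neg hm1 (by linarith))).comp (tendsto_add_atTop_nat 1)
        refine h1.congr fun n => ?_
        rw [← Real.rpow_natCast, ← Real.rpow_mul hm0.le]
        push_cast
        congr 1; ring
      have h0' : μ.map V U ≤ 0 := ge_of_tendsto hlim (eventually_atTop.2 ⟨N, this⟩)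
      exact h0'.trans bot_le
    · have hδ1 : δ ≤ 1 := hδN.trans (inv_le_one_of_one_le₀ (one_le_pow₀ hm1.le))
      obtain ⟨n, hn1, hn2⟩ := exists_nat_pow_near (x := δ⁻¹) ((one_le_inv₀ hpos).2 hδ1) hm1
      have hd1 : δ ≤ ((m : ℝ) ^ n)⁻¹ := by
        rw [le_inv_comm₀ hpos (by positivity)]; exact hn1
      have hd2 : ((m : ℝ) ^ (n + 1))⁻¹ < δ := by
        rw [inv_lt_comm₀ (by positivity) hpos]; exact hn2
      have hNn : N ≤ n := by
        have h1 : ((m : ℝ) ^ (n + 1))⁻¹ < ((m : ℝ) ^ N)⁻¹ := hd2.trans_le hδN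
        rw [inv_lt_inv₀ (by positivity) (by positivity)] at h1
        have := (pow_lt_pow_iff_right₀ hm1).1 h1
        omega
      refine (hgen n (hN0.trans hNn) hd1).trans ?_
      rw [hδ, ENNReal.ofReal_rpow_of_pos hpos]
      refine ENNReal.ofReal_le_ofReal ((hN n hNn).trans ?_)
      have h1 : (m : ℝ) ^ (-(p * (n + 1 : ℝ))) = (((m : ℝ) ^ (n + 1))⁻¹) ^ (p : ℝ) := by
        rw [← Real.rpow_natCast, ← Real.rpow_neg hm0.le, ← Real.rpow_mul hm0.le]
        push_cast
        congr 1; ring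
      rw [h1]
      exact Real.rpow_le_rpow (by positivity) hd2.le hp0.le
  apply le_dimH_of_hausdorffMeasure_ne_zero
  have h1 : (1 : ℝ≥0∞) ≤ μH[(p : ℝ)] (XiSet X) := by
    calc (1 : ℝ≥0∞) = μ Set.univ := measure_univ.symm
      _ ≤ μ (V ⁻¹' XiSet X) := measure_mono fun ω _ => ⟨_, hX ω, rfl⟩
      _ ≤ μ.map V (XiSet X) := Measure.le_map_apply hVm.aemeasurable _
      _ ≤ _ := hle _
  exact (zero_lt_one.trans_le h1).ne'

end MS

namespace MS

/-- number of choices at position `k` -/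
def cc (m q r k : ℕ) : ℕ := if q ∣ k then r else m

/-- random sequence -/
def Phi {m : ℕ} [NeZero m] (q r : ℕ) (hq : 2 ≤ q) (G : ∀ k, Fin m → Fin (cc m q r k) → Fin m)
    (ω : ∀ k, Fin (cc m q r k)) (k : ℕ) : Fin m :=
  if _h : k = 0 then 0 else G k (Phi q r hq G ω (k / q)) (ω k)
termination_by k
decreasing_by exact Nat.div_lt_self (by omega) (by omega)

lemma Phi_zero {m : ℕ} [NeZero m] (q r : ℕ) (hq : 2 ≤ q)
    (G : ∀ k, Fin m → Fin (cc m q r k) → Fin m) (ω : ∀ k, Fin (cc m q r k)) :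
    Phi q r hq G ω 0 = 0 := by
  rw [Phi, dif_pos rfl]

lemma Phi_pos {m : ℕ} [NeZero m] (q r : ℕ) (hq : 2 ≤ q)
    (G : ∀ k, Fin m → Fin (cc m q r k) → Fin m) (ω : ∀ k, Fin (cc m q r k)) (k : ℕ) (hk : k ≠ 0) :
    Phi q r hq G ω k = G k (Phi q r hq G ω (k / q)) (ω k) := by
  rw [Phi, dif_neg hk]

lemma Phi_meas {m : ℕ} [NeZero m] (q r : ℕ) (hq : 2 ≤ q)
    (G : ∀ k, Fin m → Fin (cc m q r k) → Fin m) (k : ℕ) :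
    Measurable (fun ω : ∀ k, Fin (cc m q r k) => Phi q r hq G ω k) := by
  induction k using Nat.strong_induction_on with
  | _ k ih =>
    by_cases hk : k = 0
    · subst hk
      simp only [Phi_zero]
      exact measurable_const
    · simp only [Phi_pos q r hq G _ k hk]
      have h1 := ih (k / q) (Nat.div_lt_self (by omega) (by omega))
      have h2 : Measurable (fun ω : ∀ k, Fin (cc m q r k) => ω k) := measurable_pi_apply k
      have h3 : Measurable (fun p : Fin m × Fin (cc m q r k) => G k p.1 p.2) :=
        Measurable.of_discrete
      exact h3.comp (h1.prodMk h2)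

lemma card_W_eq {m : ℕ} [NeZero m] {q r : ℕ} {A : Matrix (Fin m) (Fin m) ℝ}
    (hA01 : ∀ i j, A i j = 0 ∨ A i j = 1) (hr : ∀ i, ∑ j, A i j = r) (n : ℕ) :
    (W q A n).card = ∏ k ∈ Finset.Icc 1 n, cc m q r k := by
  induction n with
  | zero => simp [W]
  | succ n ih =>
    rw [show Finset.Icc 1 (n + 1) = insert (n + 1) (Finset.Icc 1 n) by
      ext k; simp only [Finset.mem_Icc, Finset.mem_insert]; omega, Finset.prod_insert (by simp), ← ih]
    have h1 : (((W q A (n + 1)).card : ℕ) : ℝ) =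
        ∑ w ∈ W q A (n + 1), (fun _ => (1 : ℝ)) w * (fun _ => (1 : ℝ)) (w (n + 1)) := by simp
    have h2 : (((W q A (n + 1)).card : ℕ) : ℝ) = ((cc m q r (n + 1) * (W q A n).card : ℕ) : ℝ) := by
      rw [h1, cc]
      split_ifs with hd
      · refine (sum_step_mul (g := fun _ => 1) hA01 hd (fun _ _ _ => rfl) (fun _ => 1)).trans ?_
        simp [hr, mul_comm]
      · refine (sum_step_free (g := fun _ => 1) hd (fun _ _ _ => rfl) (fun _ => 1)).trans ?_
        simp
    exact_mod_cast h2

lemma dimH_ge_mink {m : ℕ} [NeZero m] (hm : 2 ≤ m) {q : ℕ+} (hq : 2 ≤ (q : ℕ))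
    {A : Matrix (Fin m) (Fin m) ℝ} (hA01 : ∀ i j, A i j = 0 ∨ A i j = 1)
    (hrow : ∀ i, ∃ j, A i j = 1) (heq : ∀ i i', ∑ j, A i j = ∑ j, A i' j) {d : ℝ}
    (hd : Tendsto (fun n : ℕ => Real.logb m (W q A n).card / n) atTop (𝓝 d)) :
    ENNReal.ofReal d ≤ dimH (XiSet (XA q A)) := by
  have hm1 : (1 : ℝ) < m := by exact_mod_cast hm
  have hm0 : (0 : ℝ) < m := by linarith
  let R : Fin m → Finset (Fin m) := fun i => Finset.univ.filter (fun j => A i j = 1)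
  have hR : ∀ i, ∑ j, A i j = ((R i).card : ℝ) := by
    intro i
    rw [Finset.card_filter]
    push_cast
    refine Finset.sum_congr rfl fun j _ => ?_
    rcases hA01 i j with h | h <;> simp [h]
  set r := (R 0).card with hr
  have hRr : ∀ i, (R i).card = r := by
    intro i
    have := heq i 0
    rw [hR, hR] at this
    exact_mod_cast this
  have hr0 : 0 < r := by
    obtain ⟨j, hj⟩ := hrow 0
    exact Finset.card_pos.2 ⟨j, by simp [R, hj]⟩
  have hc0 : ∀ k, 0 < cc m q r k := fun k => by
    unfold cc; split_ifs <;> omega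
  have hG : ∀ k (i : Fin m), ∃ g : Fin (cc m q r k) → Fin m, Function.Injective g ∧
      ∀ b, (q : ℕ) ∣ k → A i (g b) = 1 := by
    intro k i
    by_cases hk : (q : ℕ) ∣ k
    · have hck : (R i).card = cc m q r k := by rw [cc, if_pos hk, hRr]
      refine ⟨(R i).orderEmbOfFin hck, ((R i).orderEmbOfFin hck).injective, fun b _ => ?_⟩
      have := (R i).orderEmbOfFin_mem hck b
      exact (Finset.mem_filter.1 this).2
    · have hck : cc m q r k = m := by rw [cc, if_neg hk]
      exact ⟨Fin.cast hck, Fin.cast_injective hck, fun b h => absurd h hk⟩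
  choose G hGinj hGA using hG
  have : ∀ k, Nonempty (Fin (cc m q r k)) := fun k => ⟨⟨0, hc0 k⟩⟩
  let μ : ∀ k, Measure (Fin (cc m q r k)) := fun k => (cc m q r k : ℝ≥0∞)⁻¹ • Measure.count
  have hμ : ∀ k, IsProbabilityMeasure (μ k) := fun k => ⟨by
    have : (cc m q r k : ℝ≥0∞) ≠ 0 := by exact_mod_cast (hc0 k).ne'
    simp only [μ, Measure.smul_apply, smul_eq_mul, Measure.count_univ]
    simp [ENNReal.inv_mul_cancel this]⟩
  have hsing : ∀ k (S : Set (Fin (cc m q r k))), S.Subsingleton →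
      μ k S ≤ (cc m q r k : ℝ≥0∞)⁻¹ := by
    intro k S hS
    rcases hS.eq_empty_or_singleton with rfl | ⟨a, rfl⟩
    · simp
    · simp [μ]
  have hcyl : ∀ n (w : ℕ → Fin m), w 0 = 0 →
      Measure.infinitePi μ {ω | ∀ k, 1 ≤ k → k ≤ n → Phi q r hq G ω k = w k} ≤
        ((W q A n).card : ℝ≥0∞)⁻¹ := by
    intro n w hw
    have hsub : {ω | ∀ k, 1 ≤ k → k ≤ n → Phi q r hq G ω k = w k} ⊆
        Set.pi (Finset.Icc 1 n : Finset ℕ) (fun k => {b | G k (w (k / q)) b = w k}) := by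
      intro ω hω k hk
      have hk' := Finset.mem_Icc.1 (Finset.mem_coe.1 hk)
      have h1 := hω k hk'.1 hk'.2
      rw [Phi_pos q r hq G ω k (by omega)] at h1
      have h2 : Phi q r hq G ω (k / q) = w (k / q) := by
        by_cases h0 : k / q = 0
        · rw [h0, Phi_zero, hw]
        · exact hω _ (Nat.one_le_iff_ne_zero.2 h0) ((Nat.div_le_self _ _).trans hk'.2)
      rw [h2] at h1
      exact h1
    refine (measure_mono hsub).trans ?_
    rw [Measure.infinitePi_pi _ (fun _ _ => MeasurableSet.of_discrete),
      card_W_eq hA01 (fun i => by rw [hR, hRr]) n]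
    push_cast
    rw [ENNReal.prod_inv_distrib]
    · refine Finset.prod_le_prod' fun k _ => hsing k _ ?_
      intro a ha b hb
      exact hGinj k _ (Eq.trans ha (Eq.symm hb))
    · intro a _ b _ _
      right; exact ENNReal.natCast_ne_top _
  have hXmem : ∀ ω, (fun k : ℕ+ => Phi q r hq G ω k) ∈ XA q A := by
    intro ω
    refine XA_of_nat fun k hk => ?_
    have hqk : (q : ℕ) * k ≠ 0 := by positivity
    rw [Phi_pos q r hq G ω (q * k) hqk, Nat.mul_div_cancel_left _ q.pos]
    exact hGA _ _ _ (Dvd.intro _ rfl)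
  refine le_of_forall_lt fun c hc => ?_
  obtain ⟨p, hcp, hpd⟩ := ENNReal.lt_iff_exists_nnreal_btwn.1 hc
  refine hcp.trans_le ?_
  have hp0 : 0 < (p : ℝ) := by
    have : (0 : ℝ≥0∞) < p := bot_le.trans_lt hcp
    exact_mod_cast this
  have hpd' : (p : ℝ) < d := by
    rw [← ENNReal.ofReal_coe_nnreal] at hpd
    exact (ENNReal.ofReal_lt_ofReal_iff_of_nonneg p.coe_nonneg).1 hpd
  obtain ⟨s, hps, hsd⟩ := exists_between hpd'
  obtain ⟨n0, hn0⟩ := eventually_atTop.1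
    ((hd.eventually (lt_mem_nhds hsd)).and (eventually_gt_atTop 0))
  refine dimH_ge hm (XA q A) (Measure.infinitePi μ) (Phi q r hq G) (Phi_meas q r hq G) hXmem
    (s := s) n0 (fun n hn w hw => (hcyl n w hw).trans ?_) (Phi_zero q r hq G) hp0 hps
  obtain ⟨h1, h2⟩ := hn0 n hn
  have hn' : (0 : ℝ) < n := by exact_mod_cast h2
  have hWp : (0 : ℝ) < (W q A n).card := by
    exact_mod_cast Finset.card_pos.2 (W_nonempty hrow n)
  rw [lt_div_iff₀ hn', Real.lt_logb_iff_rpow_lt hm1 hWp] at h1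
  rw [Real.rpow_neg hm0.le, ENNReal.ofReal_inv_of_pos (Real.rpow_pos_of_pos hm0 _),
    ENNReal.inv_le_inv]
  refine (ENNReal.ofReal_le_ofReal h1.le).trans ?_
  rw [ENNReal.ofReal_natCast]

end MS

/-- **Theorem 1.3 (ii), second part.** `dim_H(Ξ_A) = dim_M(X_A)` iff all row sums of `A`
are equal. -/
theorem stmt3 (m : ℕ) (hm : 2 ≤ m) (q : ℕ+) (hq : 2 ≤ (q : ℕ))
    (A : Matrix (Fin m) (Fin m) ℝ)
    (hA01 : ∀ i j, A i j = 0 ∨ A i j = 1)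
    (hAprim : ∃ n : ℕ, ∀ i j, 0 < (A ^ n) i j)
    (d : ℝ)
    (hlim : Tendsto
      (fun n : ℕ =>
        Real.logb m (NWords n {x : ℕ+ → Fin m | ∀ k : ℕ+, A (x k) (x (q * k)) = 1}) / n)
      atTop (𝓝 d)) :
    dimH (XiSet {x : ℕ+ → Fin m | ∀ k : ℕ+, A (x k) (x (q * k)) = 1}) =
        ENNReal.ofReal d ↔
      ∀ i i' : Fin m, ∑ j, A i j = ∑ j, A i' j := by
  have hnez : NeZero m := ⟨by omega⟩
  have hm1 : (1 : ℝ) < m := by exact_mod_cast hm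
  have hlm : 0 < Real.log m := Real.log_pos hm1
  have hrow : ∀ i, ∃ j, A i j = 1 := by
    intro i
    by_contra hcon
    have hz : ∀ j, A i j = 0 := fun j => by
      rcases hA01 i j with h | h
      · exact h
      · exact absurd ⟨j, h⟩ hcon
    obtain ⟨n, hn⟩ := hAprim
    rcases n with _ | n
    · have h01 : (⟨0, by omega⟩ : Fin m) ≠ ⟨1, by omega⟩ := by simp
      have := hn ⟨0, by omega⟩ ⟨1, by omega⟩
      rw [pow_zero, Matrix.one_apply_ne h01] at this
      exact lt_irrefl _ this
    · have := hn i i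
      rw [pow_succ', Matrix.mul_apply] at this
      simp [hz] at this
  have hd : Tendsto (fun n : ℕ => Real.logb m (MS.W q A n).card / n) atTop (𝓝 d) := by
    refine hlim.congr fun n => ?_
    have := MS.nwords_eq hq hrow n
    rw [← this]
    rfl
  change dimH (XiSet (MS.XA q A)) = ENNReal.ofReal d ↔ _
  constructor
  · intro hdim
    by_contra hne
    obtain ⟨t, ht, hte⟩ := MS.exists_t hq hA01 hrow (by omega)
    have hnc : ∃ i j, t i ≠ t j := by
      by_contra hcon
      push Not at hcon
      apply hne
      have key : ∀ i, ∑ j, A i j = t 0 ^ (q : ℕ) / t 0 := by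
        intro i
        have h1 := hte i
        have h2 : ∀ j, A i j * t j = A i j * t 0 := fun j => by rw [hcon j 0]
        rw [Finset.sum_congr rfl (fun j _ => h2 j), ← Finset.sum_mul, hcon i 0] at h1
        rw [h1, mul_div_cancel_right₀]
        exact (zero_lt_one.trans_le (ht 0)).ne'
      intro i i'
      rw [key, key]
    obtain ⟨i, j, hij⟩ := hnc
    have hD : Tendsto (fun n : ℕ => Real.log (MS.W q A n).card / n) atTop (𝓝 (d * Real.log m)) := by
      refine (hd.mul_const (Real.log m)).congr fun n => ?_
      rw [Real.logb]
      field_simp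
    have hlt := MS.strict_dim hq hA01 hrow ht hte hij hD
    set E := (1 - 1 / ((q : ℕ) : ℝ)) * Real.log (∑ a, t a) with hE
    have hE0 : 0 ≤ E := by
      have hq1 : (1 : ℝ) ≤ ((q : ℕ) : ℝ) := by exact_mod_cast q.pos
      have h1 : 0 ≤ 1 - 1 / ((q : ℕ) : ℝ) := by
        rw [sub_nonneg, div_le_one (by linarith)]; exact hq1
      have hT1 : 1 ≤ ∑ a, t a := (ht 0).trans
        (Finset.single_le_sum (f := t) (fun a _ => zero_le_one.trans (ht a)) (Finset.mem_univ 0))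
      exact mul_nonneg h1 (Real.log_nonneg hT1)
    have hε : 0 < (d * Real.log m - E) / 2 := by linarith
    have hle := MS.dimH_le_t hm hq hA01 ht hte hε
    rw [hdim] at hle
    have hd0 : 0 < d := by
      by_contra h
      have := mul_nonpos_of_nonpos_of_nonneg (not_lt.1 h) hlm.le
      linarith
    rw [ENNReal.ofReal_le_ofReal_iff', le_div_iff₀ hlm] at hle
    rcases hle with h | h
    · rw [← hE] at h
      linarith
    · linarith
  · intro heq
    exact le_antisymm (MS.dimH_le_mink hm hq hrow hd) (MS.dimH_ge_mink hm hq hA01 hrow heq hd)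
end
end
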